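/- arXiv:2307.10985 — 15 statements merged into one kernel-verified Lean document; each statement's English description precedes it below -/
import Mathlib

section
/- For every number of agents n ≥ 1 and every finite set M of m indivisible goods, if each agent i has a monotone valuation v_i : 2^M → ℝ with v_i(∅) = 0 and v_i(S) ≤ v_i(T) whenever S ⊆ T, then there exists a complete allocation A = (A_1,…,A_n) that is EF1 for goods: for all agents i, j, either v_i(A_i) ≥ v_i(A_j), or there exists a good g ∈ A_j such that v_i(A_i) ≥ v_i(A_j \ {g}). -/
/-- A partial allocation, distributing exactly the goods in `S`, that is EF1. -/
def IsPartialEF1 {ι α : Type*} [Fintype ι] [DecidableEq α] (v : ι → Finset α → ℝ)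
    (S : Finset α) (A : ι → Finset α) : Prop :=
  (∀ i j, i ≠ j → Disjoint (A i) (A j)) ∧
  Finset.univ.biUnion A = S ∧
  ∀ i j, v i (A i) ≥ v i (A j) ∨ ∃ g ∈ A j, v i (A i) ≥ v i (A j \ {g})

/-- Permuting the bundles of an EF1 allocation so that no agent loses keeps it EF1. -/
lemma IsPartialEF1.comp_equiv {ι α : Type*} [Fintype ι] [DecidableEq α]
    {v : ι → Finset α → ℝ} {S : Finset α} {A : ι → Finset α} (hA : IsPartialEF1 v S A)
    (σ : Equiv.Perm ι) (hσ : ∀ i, v i (A i) ≤ v i (A (σ i))) :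
    IsPartialEF1 v S (A ∘ σ) := by
  obtain ⟨hdisj, hcover, hef⟩ := hA
  refine ⟨fun i j hij => hdisj _ _ (σ.injective.ne hij), ?_, fun i j => ?_⟩
  · rw [← hcover]
    ext g
    simp only [Finset.mem_biUnion, Finset.mem_univ, true_and, Function.comp_apply]
    exact (σ.surjective.exists (p := fun i => g ∈ A i)).symm
  · rcases hef i (σ j) with h | ⟨g, hg, h⟩
    · exact Or.inl (h.trans (hσ i))
    · exact Or.inr ⟨g, hg, h.trans (hσ i)⟩

lemma exists_mem_periodicPts {ι : Type*} [Finite ι] [Nonempty ι] (f : ι → ι) :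
    ∃ x, x ∈ Function.periodicPts f := by
  obtain ⟨x⟩ := ‹Nonempty ι›
  obtain ⟨a, b, hab, hne⟩ := Function.not_injective_iff.mp
    (not_injective_infinite_finite fun k : ℕ => f^[k] x)
  wlog h : a < b generalizing a b
  · exact this b a hab.symm hne.symm (by omega)
  refine ⟨f^[a] x, Function.mk_mem_periodicPts (Nat.sub_pos_of_lt h) ?_⟩
  rw [Function.IsPeriodicPt, Function.IsFixedPt, ← Function.iterate_add_apply,
    Nat.sub_add_cancel h.le]
  exact hab.symm

/-- A self-map of a finite nonempty type agrees with a permutation on its periodic points,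
which are the only points this permutation moves. -/
lemma exists_perm_eq_or_fixed {ι : Type*} [Finite ι] [Nonempty ι] (f : ι → ι) :
    ∃ τ : Equiv.Perm ι, (∃ x, τ x = f x) ∧ ∀ x, τ x = f x ∨ τ x = x := by
  classical
  let t : ι → ι := fun x => if x ∈ Function.periodicPts f then f x else x
  have hbij := Function.bijOn_periodicPts f
  have ht : Function.Injective t := by
    intro x y hxy
    by_cases hx : x ∈ Function.periodicPts f <;> by_cases hy : y ∈ Function.periodicPts f <;>
      simp only [t, hx, hy, if_true, if_false] at hxy
    · exact hbij.injOn hx hy hxy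
    · exact absurd (hxy ▸ hbij.mapsTo hx) hy
    · exact absurd (hxy ▸ hbij.mapsTo hy) hx
    · exact hxy
  obtain ⟨x, hx⟩ := exists_mem_periodicPts f
  refine ⟨Equiv.ofBijective t (Finite.injective_iff_bijective.mp ht), ⟨x, if_pos hx⟩,
    fun y => ?_⟩
  by_cases hy : y ∈ Function.periodicPts f
  · exact Or.inl (if_pos hy)
  · exact Or.inr (if_neg hy)

/-- Envy-cycle elimination: some EF1 allocation of the same goods has an agent nobody envies. -/
lemma IsPartialEF1.exists_unenvied {ι α : Type*} [Fintype ι] [Nonempty ι] [Finite α]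
    [DecidableEq α] {v : ι → Finset α → ℝ} {S : Finset α} {A : ι → Finset α}
    (hA : IsPartialEF1 v S A) :
    ∃ B, IsPartialEF1 v S B ∧ ∃ j, ∀ i, v i (B j) ≤ v i (B i) := by
  obtain ⟨B, hB, hmax⟩ := Set.exists_max_image {B | IsPartialEF1 v S B}
    (fun B => ∑ i, v i (B i)) (Set.toFinite _) ⟨A, hA⟩
  refine ⟨B, hB, ?_⟩
  by_contra! henvy
  choose f hf using henvy
  obtain ⟨τ, ⟨x, hx⟩, hτ⟩ := exists_perm_eq_or_fixed f
  have hle : ∀ i, v i (B i) ≤ v i (B (τ.symm i)) := by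
    intro i
    obtain ⟨y, rfl⟩ := τ.surjective i
    rw [Equiv.symm_apply_apply]
    rcases hτ y with h | h
    · rw [h]
      exact (hf y).le
    · rw [h]
  have hlt : v (τ x) (B (τ x)) < v (τ x) (B (τ.symm (τ x))) := by
    rw [Equiv.symm_apply_apply, hx]
    exact hf x
  exact absurd (hmax _ (hB.comp_equiv τ.symm hle)) (not_le.mpr
    (Finset.sum_lt_sum (fun i _ => hle i) ⟨τ x, Finset.mem_univ _, hlt⟩))

/-- Giving a new good to an agent nobody envies keeps the allocation EF1. -/
lemma IsPartialEF1.update_insert {ι α : Type*} [Fintype ι] [DecidableEq ι] [DecidableEq α]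
    {v : ι → Finset α → ℝ} {S : Finset α} {A : ι → Finset α} (hA : IsPartialEF1 v S A)
    (hmono : ∀ i, Monotone (v i)) {g : α} (hg : g ∉ S) {j : ι}
    (hj : ∀ i, v i (A j) ≤ v i (A i)) :
    IsPartialEF1 v (insert g S) (Function.update A j (insert g (A j))) := by
  obtain ⟨hdisj, hcover, hef⟩ := hA
  have hgA : ∀ i, g ∉ A i := fun i h =>
    hg (hcover ▸ Finset.mem_biUnion.mpr ⟨i, Finset.mem_univ i, h⟩)
  refine ⟨fun i k hik => ?_, ?_, fun i k => ?_⟩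
  · rcases eq_or_ne i j with rfl | hi
    · simpa [hik.symm, hgA] using hdisj _ _ hik
    · rcases eq_or_ne k j with rfl | hk
      · simpa [hi, hgA] using hdisj _ _ hik
      · simpa [hi, hk] using hdisj _ _ hik
  · ext x
    simp only [← hcover, Finset.mem_biUnion, Finset.mem_univ, true_and, Finset.mem_insert]
    constructor
    · rintro ⟨i, hi⟩
      rcases eq_or_ne i j with rfl | hij
      · rw [Function.update_self, Finset.mem_insert] at hi
        exact hi.imp_right fun h => ⟨_, h⟩
      · rw [Function.update_of_ne hij] at hi
        exact Or.inr ⟨i, hi⟩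
    · rintro (rfl | ⟨i, hi⟩)
      · exact ⟨j, by simp⟩
      · refine ⟨i, ?_⟩
        rcases eq_or_ne i j with rfl | hij
        · simp [hi]
        · simpa [hij] using hi
  · rcases eq_or_ne k j with rfl | hk
    · rcases eq_or_ne i k with rfl | hi
      · exact Or.inl le_rfl
      · refine Or.inr ⟨g, by simp, ?_⟩
        rw [Function.update_self, Function.update_of_ne hi, Finset.sdiff_singleton_eq_erase,
          Finset.erase_insert (hgA k)]
        exact hj i
    · have hle : v i (A i) ≤ v i (Function.update A j (insert g (A j)) i) := by
        rcases eq_or_ne i j with rfl | hi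
        · rw [Function.update_self]
          exact hmono i (Finset.subset_insert _ _)
        · rw [Function.update_of_ne hi]
      rw [Function.update_of_ne hk]
      rcases hef i k with h | ⟨x, hx, h⟩
      · exact Or.inl (h.trans hle)
      · exact Or.inr ⟨x, hx, h.trans hle⟩

lemma exists_isPartialEF1 {ι α : Type*} [Fintype ι] [Nonempty ι] [Finite α] [DecidableEq α]
    {v : ι → Finset α → ℝ} (hmono : ∀ i, Monotone (v i)) (S : Finset α) :
    ∃ A, IsPartialEF1 v S A := by
  classical
  induction S using Finset.induction_on with
  | empty =>
    refine ⟨fun _ => ∅, fun _ _ _ => Finset.disjoint_empty_left _, ?_, fun _ _ => Or.inl le_rfl⟩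
    ext
    simp
  | insert g S hg ih =>
    obtain ⟨A, hA⟩ := ih
    obtain ⟨B, hB, j, hj⟩ := hA.exists_unenvied
    exact ⟨_, hB.update_insert hmono hg hj⟩

/-- For every number of agents `n ≥ 1` and every finite set of `m` indivisible
goods, if each agent has a monotone valuation with `v i ∅ = 0`, then there exists a complete
allocation that is EF1 for goods. -/
theorem ef1_exists_goods_monotone (n m : ℕ) (hn : 1 ≤ n)
    (v : Fin n → Finset (Fin m) → ℝ)
    (hv0 : ∀ i, v i ∅ = 0)
    (hmono : ∀ i (S T : Finset (Fin m)), S ⊆ T → v i S ≤ v i T) :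
    ∃ A : Fin n → Finset (Fin m),
      (∀ i j, i ≠ j → Disjoint (A i) (A j)) ∧
      Finset.univ.biUnion A = Finset.univ ∧
      ∀ i j, v i (A i) ≥ v i (A j) ∨ ∃ g ∈ A j, v i (A i) ≥ v i (A j \ {g}) := by
  have : Nonempty (Fin n) := ⟨⟨0, hn⟩⟩
  exact exists_isPartialEF1 (fun i S T h => hmono i S T h) Finset.univ
end

section
/- For every number of agents n ≥ 1 and every finite set M of m indivisible chores, if each agent i has an anti-monotone valuation v_i : 2^M → ℝ with v_i(∅) = 0 and v_i(S) ≥ v_i(T) whenever S ⊆ T, then there exists a complete allocation A = (A_1,…,A_n) that is EF1 for chores: for all agents i, j, either v_i(A_i) ≥ v_i(A_j), or there exists a chore k ∈ A_i such that v_i(A_i \ {k}) ≥ v_i(A_j). -/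
/-- A self-map of a nonempty finite type has a periodic point. -/
theorem Function.exists_mem_periodicPts_of_finite {α : Type*} [Finite α] [Nonempty α]
    (f : α → α) : ∃ x, x ∈ Function.periodicPts f := by
  obtain ⟨x⟩ := ‹Nonempty α›
  obtain ⟨a, b, hne, heq⟩ := Finite.exists_ne_map_eq_of_infinite fun t : ℕ => f^[t] x
  wlog hab : a < b generalizing a b
  · exact this b a hne.symm heq.symm (by omega)
  refine ⟨f^[a] x, Function.mk_mem_periodicPts (n := b - a) (by omega) ?_⟩
  change f^[b - a] (f^[a] x) = f^[a] x
  rw [← Function.iterate_add_apply, Nat.sub_add_cancel hab.le]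
  exact heq.symm

/-- Every self-map of a nonempty finite type agrees with some permutation on a nonempty set
outside of which the permutation is the identity. -/
theorem Equiv.Perm.exists_apply_eq_or_fixed {α : Type*} [Finite α] [Nonempty α]
    (f : α → α) : ∃ σ : Equiv.Perm α, (∃ x, σ x = f x) ∧ ∀ x, σ x = f x ∨ σ x = x := by
  classical
  have hbij := Function.bijOn_periodicPts f
  let g : α → α := fun x => if x ∈ Function.periodicPts f then f x else x
  have hg : Function.Injective g := by
    intro x y hxy
    by_cases hx : x ∈ Function.periodicPts f <;> by_cases hy : y ∈ Function.periodicPts f <;>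
      simp only [g, hx, hy, if_true, if_false] at hxy
    · exact hbij.injOn hx hy hxy
    · exact absurd (hxy ▸ hbij.mapsTo hx) hy
    · exact absurd (hxy ▸ hbij.mapsTo hy) hx
    · exact hxy
  obtain ⟨x, hx⟩ := Function.exists_mem_periodicPts_of_finite f
  refine ⟨Equiv.ofBijective g (Finite.injective_iff_bijective.mp hg), ⟨x, if_pos hx⟩, fun y => ?_⟩
  by_cases hy : y ∈ Function.periodicPts f
  · exact Or.inl (if_pos hy)
  · exact Or.inr (if_neg hy)

/-- Any finite set of chores has an EF1 allocation among agents with antitone valuations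
(top-trading envy-cycle elimination). -/
theorem exists_ef1_allocation_of_antitone {ι α : Type*} [Fintype ι] [Nonempty ι] [DecidableEq α]
    (v : ι → Finset α → ℝ) (hv : ∀ i, Antitone (v i)) (S : Finset α) :
    ∃ A : ι → Finset α,
      (∀ i j, i ≠ j → Disjoint (A i) (A j)) ∧
      Finset.univ.biUnion A = S ∧
      ∀ i j, v i (A i) ≥ v i (A j) ∨ ∃ k ∈ A i, v i (A i \ {k}) ≥ v i (A j) := by
  classical
  induction S using Finset.induction_on with
  | empty => exact ⟨fun _ => ∅, by simp, by ext; simp, fun _ _ => Or.inl le_rfl⟩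
  | insert c S hc ih =>
    obtain ⟨A, hdisj, hunion, hef⟩ := ih
    choose f hf using fun i => Finite.exists_max fun j => v i (A j)
    obtain ⟨σ, ⟨s, hs⟩, hσ⟩ := Equiv.Perm.exists_apply_eq_or_fixed f
    have hcA : ∀ i, c ∉ A i := fun i hi =>
      hc (hunion ▸ Finset.mem_biUnion.mpr ⟨i, Finset.mem_univ i, hi⟩)
    have hefσ : ∀ i j, v i (A (σ i)) ≥ v i (A j) ∨
        ∃ k ∈ A (σ i), v i (A (σ i) \ {k}) ≥ v i (A j) := by
      intro i j
      rcases hσ i with h | h <;> rw [h]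
      · exact Or.inl (hf i j)
      · exact hef i j
    let B : ι → Finset α := Function.update (fun i => A (σ i)) s (insert c (A (σ s)))
    have hBs : B s = insert c (A (σ s)) := Function.update_self ..
    have hB : ∀ i, i ≠ s → B i = A (σ i) := fun i hi => Function.update_of_ne hi ..
    have hsub : ∀ i, A (σ i) ⊆ B i := by
      intro i
      by_cases hi : i = s
      · subst hi
        exact hBs ▸ Finset.subset_insert ..
      · exact (hB i hi).ge
    refine ⟨B, fun i j hij => ?_, ?_, fun i j => ?_⟩
    · have hd := hdisj _ _ (σ.injective.ne hij)
      by_cases hi : i = s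
      · subst hi
        rw [hBs, hB j hij.symm]
        exact Finset.disjoint_insert_left.mpr ⟨hcA _, hd⟩
      · by_cases hj : j = s
        · subst hj
          rw [hBs, hB i hi]
          exact Finset.disjoint_insert_right.mpr ⟨hcA _, hd⟩
        · rwa [hB i hi, hB j hj]
    · ext x
      simp only [← hunion, Finset.mem_biUnion, Finset.mem_univ, true_and, Finset.mem_insert]
      constructor
      · rintro ⟨i, hi⟩
        by_cases his : i = s
        · subst his
          rw [hBs, Finset.mem_insert] at hi
          exact hi.imp_right fun h => ⟨_, h⟩
        · exact Or.inr ⟨_, hB i his ▸ hi⟩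
      · rintro (rfl | ⟨i, hi⟩)
        · exact ⟨s, hBs ▸ Finset.mem_insert_self ..⟩
        · exact ⟨σ.symm i, hsub _ (by simpa using hi)⟩
    · have hj : v i (B j) ≤ v i (A (σ j)) := hv i (hsub j)
      by_cases hi : i = s
      · subst hi
        refine Or.inr ⟨c, hBs ▸ Finset.mem_insert_self .., hj.trans ?_⟩
        rw [hBs, Finset.sdiff_singleton_eq_erase, Finset.erase_insert (hcA _), hs]
        exact hf i _
      · rw [hB i hi]
        exact (hefσ i (σ j)).imp hj.trans fun ⟨k, hk, h⟩ => ⟨k, hk, hj.trans h⟩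

/-- For every number of agents `n ≥ 1` and every finite set of `m` indivisible
chores, if each agent has an anti-monotone valuation with `v i ∅ = 0`, then there exists a
complete allocation that is EF1 for chores. -/
theorem ef1_exists_chores_antimonotone (n m : ℕ) (hn : 1 ≤ n)
    (v : Fin n → Finset (Fin m) → ℝ)
    (hv0 : ∀ i, v i ∅ = 0)
    (hanti : ∀ i (S T : Finset (Fin m)), S ⊆ T → v i T ≤ v i S) :
    ∃ A : Fin n → Finset (Fin m),
      (∀ i j, i ≠ j → Disjoint (A i) (A j)) ∧
      Finset.univ.biUnion A = Finset.univ ∧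
      ∀ i j, v i (A i) ≥ v i (A j) ∨ ∃ k ∈ A i, v i (A i \ {k}) ≥ v i (A j) := by
  have : Nonempty (Fin n) := ⟨⟨0, hn⟩⟩
  exact exists_ef1_allocation_of_antitone v (fun i S T h => hanti i S T h) Finset.univ
end

section
/- For every number of agents n ≥ 1 and every finite set M of m indivisible items, if each agent i has an additive valuation given by arbitrary real item values v_i(k) ∈ ℝ for k ∈ M (so items may be goods for some agents and chores for others), then there exists a complete allocation A = (A_1,…,A_n) that is EF1 for mixed goods and chores: for all agents i, j, either v_i(A_i) ≥ v_i(A_j), or there exists an item k ∈ A_i ∪ A_j such that v_i(A_i \ {k}) ≥ v_i(A_j \ {k}). -/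
/-- The value under `w` of the part of `S` that the owner map `a` gives to agent `y`. -/
noncomputable def bundleValue {ι α : Type*} [DecidableEq α] (S : Finset ι) (a : ι → α)
    (w : ι → ℝ) (y : α) : ℝ :=
  ∑ k ∈ S, if a k = y then w k else 0

/-- Round-robin on goods: an agent of smaller rank does not envy one of larger rank, and all
envy disappears after removing one item from the envied bundle. -/
theorem exists_goods_allocation {ι α : Type*} [DecidableEq ι] [DecidableEq α] [Fintype α]
    [Nonempty α] (v : α → ι → ℝ) (S : Finset ι) :
    ∀ r : α → ℕ, (∀ k ∈ S, ∃ x, 0 < v x k) → ∃ a : ι → α,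
      (∀ x y, r x < r y → bundleValue S a (v x) y ≤ bundleValue S a (v x) x) ∧
      ∀ x y, bundleValue S a (v x) y ≤ bundleValue S a (v x) x ∨
        ∃ k ∈ S, a k = y ∧ bundleValue S a (v x) y - v x k ≤ bundleValue S a (v x) x := by
  induction S using Finset.strongInduction with
  | H S ih =>
    intro r hS
    rcases S.eq_empty_or_nonempty with rfl | hne
    · exact ⟨fun _ => Classical.arbitrary α, by simp [bundleValue], by simp [bundleValue]⟩
    obtain ⟨p, hp, hmin⟩ := Finset.exists_min_image
      (Finset.univ.filter fun x => ∃ k ∈ S, 0 < v x k) r (by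
        obtain ⟨k, hk⟩ := hne
        obtain ⟨x, hx⟩ := hS k hk
        exact ⟨x, by simpa using ⟨k, hk, hx⟩⟩)
    obtain ⟨g, hg, hmax⟩ := Finset.exists_max_image S (v p) hne
    have hpg : 0 < v p g := by
      obtain ⟨k, hk, hk'⟩ := (Finset.mem_filter.1 hp).2
      exact hk'.trans_le (hmax k hk)
    obtain ⟨a, ha, hef⟩ := ih (S.erase g) (Finset.erase_ssubset hg)
      (Function.update r p (1 + ∑ x, r x)) fun k hk => hS k (Finset.mem_of_mem_erase hk)
    have hlast : ∀ x, x ≠ p →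
        bundleValue (S.erase g) a (v x) p ≤ bundleValue (S.erase g) a (v x) x := by
      intro x hx
      apply ha
      have := Finset.single_le_sum (f := r) (fun _ _ => Nat.zero_le _) (Finset.mem_univ x)
      simp only [Function.update_self, Function.update_of_ne hx]
      omega
    have hval : ∀ (w : ι → ℝ) y, bundleValue S (Function.update a g p) w y =
        bundleValue (S.erase g) a w y + if p = y then w g else 0 := by
      intro w y
      rw [bundleValue, ← Finset.sum_erase_add _ _ hg, Function.update_self, bundleValue]
      congr 1
      refine Finset.sum_congr rfl fun k hk => ?_
      rw [Function.update_of_ne (Finset.ne_of_mem_erase hk)]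
    refine ⟨Function.update a g p, fun x y hxy => ?_, fun x y => ?_⟩
    · rw [hval, hval]
      have hne : x ≠ y := by rintro rfl; exact lt_irrefl _ hxy
      by_cases hy : p = y
      · subst hy
        have hx : v x g ≤ 0 := by
          by_contra! h
          exact absurd (hmin x (by simpa using ⟨g, hg, h⟩)) (not_le.2 hxy)
        have := hlast x hne
        simp only [if_true, if_neg hne.symm]
        linarith
      · by_cases hx : p = x
        · subst hx
          simp only [if_true, if_neg hy]
          rcases hef p y with h | ⟨k, hk, -, h⟩
          · linarith
          · have := hmax k (Finset.mem_of_mem_erase hk)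
            linarith
        · simp only [if_neg hx, if_neg hy]
          have := ha x y (by
            rwa [Function.update_of_ne (Ne.symm hx), Function.update_of_ne (Ne.symm hy)])
          linarith
    · rw [hval, hval]
      by_cases hxy : x = y
      · subst hxy; exact Or.inl le_rfl
      by_cases hy : p = y
      · subst hy
        have := hlast x hxy
        refine Or.inr ⟨g, hg, Function.update_self .., ?_⟩
        simp only [if_true, if_neg (Ne.symm hxy)]
        linarith
      · have hx : 0 ≤ if p = x then v x g else 0 := by
          split_ifs with h
          · exact h ▸ hpg.le
          · exact le_rfl
        simp only [if_neg hy]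
        rcases hef x y with h | ⟨k, hk, hky, h⟩
        · left; linarith
        · refine Or.inr ⟨k, Finset.mem_of_mem_erase hk, ?_, by linarith⟩
          rwa [Function.update_of_ne (Finset.ne_of_mem_erase hk)]

/-- Serial dictatorship: the agents of `T` pick in increasing order a favourite among the items
of `S` that are left. -/
theorem exists_serial_dictatorship {ι α : Type*} [DecidableEq ι] [LinearOrder α] [Nonempty ι]
    (v : α → ι → ℝ) (T : Finset α) :
    ∀ S : Finset ι, T.card ≤ S.card → ∃ f : α → ι, (∀ x ∈ T, f x ∈ S) ∧ Set.InjOn f T ∧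
      ∀ x ∈ T, ∀ k ∈ S, (∀ y ∈ T, y < x → f y ≠ k) → v x k ≤ v x (f x) := by
  induction T using Finset.induction_on_min with
  | empty => exact fun S _ => ⟨fun _ => Classical.arbitrary ι, by simp⟩
  | insert p T hp ih =>
    intro S hS
    have hpT : p ∉ T := fun h => lt_irrefl _ (hp p h)
    rw [Finset.card_insert_of_notMem hpT] at hS
    obtain ⟨g, hg, hmax⟩ := Finset.exists_max_image S (v p) (Finset.card_pos.1 (by omega))
    obtain ⟨f, hfS, hinj, hf⟩ := ih (S.erase g) (by rw [Finset.card_erase_of_mem hg]; omega)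
    have hne : ∀ x ∈ T, x ≠ p := fun x hx => (hp x hx).ne'
    have hup : ∀ x ∈ T, Function.update f p g x = f x := fun x hx =>
      Function.update_of_ne (hne x hx) _ _
    refine ⟨Function.update f p g, fun x hx => ?_, fun x hx y hy hxy => ?_,
      fun x hx k hk hky => ?_⟩
    · rcases Finset.mem_insert.1 hx with rfl | hx
      · simpa using hg
      · rw [hup x hx]; exact Finset.mem_of_mem_erase (hfS x hx)
    · rcases Finset.mem_insert.1 hx with rfl | hxT <;> rcases Finset.mem_insert.1 hy with rfl | hyT
      · rfl
      · rw [hup y hyT, Function.update_self] at hxy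
        exact absurd hxy.symm (Finset.ne_of_mem_erase (hfS y hyT))
      · rw [hup x hxT, Function.update_self] at hxy
        exact absurd hxy (Finset.ne_of_mem_erase (hfS x hxT))
      · rw [hup x hxT, hup y hyT] at hxy
        exact hinj hxT hyT hxy
    · rcases Finset.mem_insert.1 hx with rfl | hx
      · simpa using hmax k hk
      · rw [hup x hx]
        have hgk : g ≠ k := by
          simpa using hky p (Finset.mem_insert_self _ _) (hp x hx)
        refine hf x hx k (Finset.mem_erase.2 ⟨hgk.symm, hk⟩) fun y hy hyx => ?_
        rw [← hup y hy]
        exact hky y (Finset.mem_insert_of_mem hy) hyx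

/-- Round-robin with complete rounds: an agent does not envy a later one, and all envy
disappears after removing one item from each of the two bundles. -/
theorem exists_balanced_allocation {ι α : Type*} [DecidableEq ι] [LinearOrder α] [Fintype α]
    [Nonempty α] (v : α → ι → ℝ) (t : ℕ) :
    ∀ S : Finset ι, S.card = Fintype.card α * t → ∃ a : ι → α,
      (∀ x y, x ≤ y → bundleValue S a (v x) y ≤ bundleValue S a (v x) x) ∧
      (t ≠ 0 → ∀ x y, ∃ k ∈ S, a k = x ∧ ∃ k' ∈ S, a k' = y ∧
        bundleValue S a (v x) y - v x k' ≤ bundleValue S a (v x) x - v x k) := by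
  induction t with
  | zero =>
    intro S hS
    obtain rfl : S = ∅ := by simpa using hS
    exact ⟨fun _ => Classical.arbitrary α, by simp [bundleValue], by simp⟩
  | succ t ih =>
    intro S hS
    rw [Nat.mul_succ] at hS
    have hpos : 0 < Fintype.card α := Fintype.card_pos
    have : Nonempty ι := by
      obtain ⟨k, -⟩ := Finset.card_pos.1 (show 0 < S.card by omega)
      exact ⟨k⟩
    obtain ⟨f, hfS, hinj, hf⟩ := exists_serial_dictatorship v Finset.univ S
      (by rw [Finset.card_univ]; omega)
    replace hinj : Function.Injective f := by simpa using hinj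
    have hsub : Finset.univ.image f ⊆ S := by
      intro k hk
      obtain ⟨x, hx, rfl⟩ := Finset.mem_image.1 hk
      exact hfS x hx
    obtain ⟨a, ha, hef⟩ := ih (S \ Finset.univ.image f) (by
      rw [Finset.card_sdiff_of_subset hsub, Finset.card_image_of_injective _ hinj,
        Finset.card_univ]
      omega)
    obtain ⟨b, hbf, hba⟩ : ∃ b : ι → α, (∀ x, b (f x) = x) ∧
        ∀ k ∈ S \ Finset.univ.image f, b k = a k :=
      ⟨Function.extend f id a, fun x => hinj.extend_apply _ _ _, fun k hk =>
        Function.extend_apply' _ _ _ (by simpa using (Finset.mem_sdiff.1 hk).2)⟩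
    have hval : ∀ (w : ι → ℝ) y, bundleValue S b w y =
        bundleValue (S \ Finset.univ.image f) a w y + w (f y) := by
      intro w y
      rw [bundleValue, ← Finset.sum_sdiff hsub, bundleValue]
      congr 1
      · exact Finset.sum_congr rfl fun k hk => by rw [hba k hk]
      · rw [Finset.sum_image hinj.injOn]
        simp [hbf]
    have hrest : ∀ x, ∀ k ∈ S \ Finset.univ.image f, v x k ≤ v x (f x) := by
      intro x k hk
      obtain ⟨hkS, hk⟩ := Finset.mem_sdiff.1 hk
      exact hf x (Finset.mem_univ x) k hkS fun y _ _ h =>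
        hk (Finset.mem_image.2 ⟨y, Finset.mem_univ y, h⟩)
    refine ⟨b, fun x y hxy => ?_, fun _ x y => ?_⟩
    · rw [hval, hval]
      exact add_le_add (ha x y hxy) (hf x (Finset.mem_univ x) _ (hfS y (Finset.mem_univ y))
        fun z _ hz h => absurd (hinj h) (hz.trans_le hxy).ne)
    · rw [hval, hval]
      rcases eq_or_ne t 0 with rfl | ht
      · refine ⟨f x, hfS x (Finset.mem_univ x), hbf x, f y, hfS y (Finset.mem_univ y), hbf y, ?_⟩
        have h0 : S \ Finset.univ.image f = ∅ := by
          rw [← Finset.card_eq_zero, Finset.card_sdiff_of_subset hsub,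
            Finset.card_image_of_injective _ hinj, Finset.card_univ]
          omega
        simp [h0, bundleValue]
      · obtain ⟨k, hk, hkx, k', hk', -, h⟩ := hef ht x y
        refine ⟨k, (Finset.mem_sdiff.1 hk).1, by rw [hba k hk, hkx], f y,
          hfS y (Finset.mem_univ y), hbf y, ?_⟩
        have := hrest x k' hk'
        linarith

/-- Round-robin on chores: an agent does not envy a later one, and all envy disappears after
removing one item from the envious agent's own bundle. -/
theorem exists_chores_allocation {ι α : Type*} [DecidableEq ι] [LinearOrder α] [Fintype α]
    [Nonempty α] (v : α → ι → ℝ) (S : Finset ι) (hS : ∀ k ∈ S, ∀ x, v x k ≤ 0) :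
    ∃ a : ι → α,
      (∀ x y, x ≤ y → bundleValue S a (v x) y ≤ bundleValue S a (v x) x) ∧
      ∀ x y, bundleValue S a (v x) y ≤ bundleValue S a (v x) x ∨
        ∃ k ∈ S, a k = x ∧ bundleValue S a (v x) y ≤ bundleValue S a (v x) x - v x k := by
  have hpos : 0 < Fintype.card α := Fintype.card_pos
  -- Pad with items of value zero so that the number of items is a multiple of that of agents.
  let S' : Finset (ι ⊕ Fin ((Fintype.card α - 1) * S.card)) := S.disjSum Finset.univ
  obtain ⟨a, ha, hef⟩ := exists_balanced_allocation
    (fun x => Sum.elim (v x) fun _ : Fin ((Fintype.card α - 1) * S.card) => 0) S.card S' (by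
      obtain ⟨c, hc⟩ := Nat.exists_eq_succ_of_ne_zero hpos.ne'
      simp only [S', Finset.card_disjSum, Finset.card_univ, Fintype.card_fin, hc,
        Nat.succ_sub_one]
      rw [Nat.succ_mul, add_comm])
  have hval : ∀ x y, bundleValue S' a (Sum.elim (v x) fun _ => 0) y =
      bundleValue S (a ∘ Sum.inl) (v x) y := by
    intro x y
    simp [bundleValue, S', Finset.sum_disjSum]
  simp only [hval] at ha hef
  refine ⟨a ∘ Sum.inl, ha, fun x y => ?_⟩
  rcases eq_or_ne S.card 0 with h0 | h0
  · left
    simp [Finset.card_eq_zero.1 h0, bundleValue]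
  obtain ⟨k, hk, hkx, k', hk', -, h⟩ := hef h0 x y
  have hnonpos : (Sum.elim (v x) (fun _ => 0) k' : ℝ) ≤ 0 := by
    rcases k' with k' | k'
    · exact hS k' (by simpa [S'] using hk') x
    · exact le_rfl
  rcases k with k | k
  · refine Or.inr ⟨k, by simpa [S'] using hk, hkx, ?_⟩
    simp only [Sum.elim_inl] at h
    linarith
  · left
    simp only [Sum.elim_inr] at h
    linarith

/-- For every number of agents `n ≥ 1` and every finite set of `m` indivisible
items with additive valuations given by arbitrary real item values (mixed goods and chores),
there exists a complete allocation that is EF1 for mixed goods and chores. -/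
theorem ef1_exists_mixed_additive (n m : ℕ) (hn : 1 ≤ n)
    (v : Fin n → Fin m → ℝ) :
    ∃ A : Fin n → Finset (Fin m),
      (∀ i j, i ≠ j → Disjoint (A i) (A j)) ∧
      Finset.univ.biUnion A = Finset.univ ∧
      ∀ i j, (∑ k ∈ A i, v i k) ≥ (∑ k ∈ A j, v i k) ∨
        ∃ k ∈ A i ∪ A j, (∑ l ∈ A i \ {k}, v i l) ≥ (∑ l ∈ A j \ {k}, v i l) := by
  have : Nonempty (Fin n) := ⟨⟨0, hn⟩⟩
  let C : Finset (Fin m) := Finset.univ.filter fun k => ∀ x, v x k ≤ 0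
  have hC : ∀ k, k ∈ C ↔ ∀ x, v x k ≤ 0 := by simp [C]
  obtain ⟨a, ha, haef⟩ := exists_chores_allocation v C fun k hk => (hC k).1 hk
  obtain ⟨b, hb, hbef⟩ := exists_goods_allocation v Cᶜ (fun x => (Fin.rev x : ℕ)) (by
    intro k hk
    simpa [hC] using hk)
  let c : Fin m → Fin n := fun k => if k ∈ C then a k else b k
  let A : Fin n → Finset (Fin m) := fun y => Finset.univ.filter fun k => c k = y
  have hmem : ∀ k y, k ∈ A y ↔ c k = y := by simp [A]
  have hval : ∀ x y, ∑ k ∈ A y, v x k = bundleValue C a (v x) y + bundleValue Cᶜ b (v x) y := by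
    intro x y
    rw [Finset.sum_filter, ← Finset.sum_add_sum_compl C]
    refine congrArg₂ _ (Finset.sum_congr rfl fun k hk => ?_) (Finset.sum_congr rfl fun k hk => ?_)
    · simp only [c, if_pos hk]
    · simp only [c, if_neg (Finset.mem_compl.1 hk)]
  have hdrop_mem : ∀ x y k, c k = y → ∑ l ∈ A y \ {k}, v x l = ∑ l ∈ A y, v x l - v x k := by
    intro x y k hk
    rw [Finset.sdiff_singleton_eq_erase, Finset.sum_erase_eq_sub ((hmem k y).2 hk)]
  have hdrop_not_mem : ∀ x y k, c k ≠ y → ∑ l ∈ A y \ {k}, v x l = ∑ l ∈ A y, v x l := by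
    intro x y k hk
    rw [Finset.sdiff_singleton_eq_erase, Finset.erase_eq_of_notMem (by rwa [hmem])]
  refine ⟨A, fun i j hij => ?_, ?_, fun i j => ?_⟩
  · rw [Finset.disjoint_left]
    intro k hi hj
    exact hij (((hmem k i).1 hi).symm.trans ((hmem k j).1 hj))
  · ext k
    simp [hmem]
  · rcases lt_trichotomy i j with hij | rfl | hij
    · have h1 := ha i j hij.le
      rcases hbef i j with h | ⟨k, hk, hkj, h⟩
      · left
        rw [hval, hval]
        linarith
      · have hck : c k = j := by simp only [c, if_neg (Finset.mem_compl.1 hk), hkj]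
        refine Or.inr ⟨k, Finset.mem_union_right _ ((hmem k j).2 hck), ?_⟩
        rw [hdrop_mem i j k hck, hdrop_not_mem i i k (hck ▸ hij.ne'), hval, hval]
        linarith
    · exact Or.inl le_rfl
    · have h1 := hb i j (Fin.rev_lt_rev.2 hij)
      rcases haef i j with h | ⟨k, hk, hki, h⟩
      · left
        rw [hval, hval]
        linarith
      · have hck : c k = i := by simp only [c, if_pos hk, hki]
        refine Or.inr ⟨k, Finset.mem_union_left _ ((hmem k i).2 hck), ?_⟩
        rw [hdrop_mem i i k hck, hdrop_not_mem i j k (hck ▸ hij.ne'), hval, hval]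
        linarith
end

section
/- For every number of agents n ≥ 1 and every finite set M of m indivisible goods, if all agents share one identical monotone valuation v : 2^M → ℝ with v(∅) = 0 and v(S) ≤ v(T) whenever S ⊆ T, then there exists a complete allocation A = (A_1,…,A_n) that is EFX: for all agents i, j and every good g ∈ A_j, v(A_i) ≥ v(A_j \ {g}). -/
open Finset in
/-- If exponents change only at `i` and `j`, and both new ones are below the old exponent at `i`,
the sum of powers of three decreases. -/
lemma sum_three_pow_lt_of_exchange {ι : Type*} [Fintype ι] [DecidableEq ι] {c d : ι → ℕ} {i j : ι}
    (hij : i ≠ j) (hi : d i < c i) (hj : d j < c i) (h : ∀ k, k ≠ i → k ≠ j → d k = c k) :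
    ∑ k, 3 ^ d k < ∑ k, 3 ^ c k := by
  have hj_mem : j ∈ univ.erase i := mem_erase.2 ⟨hij.symm, mem_univ j⟩
  rw [← add_sum_erase univ _ (mem_univ i), ← add_sum_erase univ (fun k => 3 ^ c k) (mem_univ i),
    ← add_sum_erase _ _ hj_mem, ← add_sum_erase _ (fun k => 3 ^ c k) hj_mem]
  have hrest : ∑ k ∈ (univ.erase i).erase j, 3 ^ d k = ∑ k ∈ (univ.erase i).erase j, 3 ^ c k :=
    sum_congr rfl fun k hk => by
      simp only [mem_erase, mem_univ, and_true] at hk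
      rw [h k hk.2 hk.1]
  have hdi : 3 ^ (d i + 1) ≤ 3 ^ c i := Nat.pow_le_pow_right (by norm_num) hi
  have hdj : 3 ^ (d j + 1) ≤ 3 ^ c i := Nat.pow_le_pow_right (by norm_num) hj
  have hcj : 0 < 3 ^ c j := by positivity
  rw [pow_succ] at hdi hdj
  omega

/-- The number of bundles that beat `S` when bundles are compared by value, ties being broken in
favour of the larger bundle. -/
noncomputable def bundleRank {α : Type*} [Fintype α] (v : Finset α → ℝ) (S : Finset α) : ℕ :=
  (Finset.univ.filter fun T : Finset α =>
    toLex (v S, S.card) < toLex (v T, T.card)).card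

lemma bundleRank_lt {α : Type*} [Fintype α] {v : Finset α → ℝ} {S T : Finset α}
    (h : toLex (v S, S.card) < toLex (v T, T.card)) : bundleRank v T < bundleRank v S := by
  refine Finset.card_lt_card (Finset.ssubset_iff_of_subset ?_ |>.2 ⟨T, ?_, ?_⟩)
  · intro U hU
    simp only [Finset.mem_filter, Finset.mem_univ, true_and] at hU ⊢
    exact h.trans hU
  · simpa using h
  · simp

lemma bundleRank_lt_of_value_lt {α : Type*} [Fintype α] {v : Finset α → ℝ} {S T : Finset α}
    (h : v S < v T) : bundleRank v T < bundleRank v S :=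
  bundleRank_lt (Prod.Lex.toLex_lt_toLex.2 (Or.inl h))

lemma bundleRank_lt_of_ssubset {α : Type*} [Fintype α] {v : Finset α → ℝ}
    (hmono : ∀ S T : Finset α, S ⊆ T → v S ≤ v T) {S T : Finset α} (h : S ⊂ T) :
    bundleRank v T < bundleRank v S :=
  bundleRank_lt (Prod.Lex.toLex_lt_toLex.2
    ((hmono S T h.subset).lt_or_eq.imp id fun he => ⟨he, Finset.card_lt_card h⟩))


/-- For every number of agents `n ≥ 1` and every finite set of `m` indivisible
goods, if all agents share one identical monotone valuation `v` with `v ∅ = 0`, then there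
exists a complete allocation that is EFX. -/
theorem efx_exists_identical_monotone (n m : ℕ) (hn : 1 ≤ n)
    (v : Finset (Fin m) → ℝ)
    (hv0 : v ∅ = 0)
    (hmono : ∀ S T : Finset (Fin m), S ⊆ T → v S ≤ v T) :
    ∃ A : Fin n → Finset (Fin m),
      (∀ i j, i ≠ j → Disjoint (A i) (A j)) ∧
      Finset.univ.biUnion A = Finset.univ ∧
      ∀ i j, ∀ g ∈ A j, v (A i) ≥ v (A j \ {g}) := by
  classical
  have : Nonempty (Fin n) := ⟨⟨0, hn⟩⟩
  let bundle (f : Fin m → Fin n) (i : Fin n) : Finset (Fin m) := Finset.univ.filter (f · = i)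
  obtain ⟨f, hf⟩ := Finite.exists_min fun f : Fin m → Fin n => ∑ i, 3 ^ bundleRank v (bundle f i)
  refine ⟨bundle f, fun i j hij => ?_, ?_, fun i j g hg => ?_⟩
  · refine Finset.disjoint_left.2 fun x hi hj => hij ?_
    simp only [bundle, Finset.mem_filter, Finset.mem_univ, true_and] at hi hj
    exact hi.symm.trans hj
  · ext x
    simp [bundle]
  · by_contra! hlt
    have hgj : f g = j := by simpa [bundle] using hg
    have hij : i ≠ j := by
      rintro rfl
      exact hlt.not_ge (hmono _ _ Finset.sdiff_subset)
    refine (hf (Function.update f g i)).not_gt (sum_three_pow_lt_of_exchange hij ?_ ?_ ?_)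
    · refine bundleRank_lt_of_ssubset hmono (Finset.ssubset_iff_of_subset ?_ |>.2 ⟨g, ?_, ?_⟩)
      · intro x hx
        by_cases hxg : x = g <;> simp_all [bundle]
      · simp [bundle]
      · simp [bundle, hgj, hij.symm]
    · have hnew : bundle (Function.update f g i) j = bundle f j \ {g} := by
        ext x
        by_cases hxg : x = g <;> simp_all [bundle]
      rw [hnew]
      exact bundleRank_lt_of_value_lt hlt
    · intro k hki hkj
      congr 1
      ext x
      by_cases hxg : x = g
      · simp [bundle, hxg, hgj, hki.symm, hkj.symm]
      · simp [bundle, hxg]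
end

section
/- For n = 2 agents and any finite set M of m indivisible goods, if each agent i ∈ {1,2} has a monotone valuation v_i : 2^M → ℝ with v_i(∅) = 0 and v_i(S) ≤ v_i(T) whenever S ⊆ T, then there exists a complete allocation A = (A_1, A_2) that is EFX: for all agents i, j and every good g ∈ A_j, v_i(A_i) ≥ v_i(A_j \ {g}). -/
/-- A monotone valuation admits a partition `(S, Sᶜ)` that is EFX for two agents sharing it. -/
lemma exists_efx_partition {α β : Type*} [Fintype α] [DecidableEq α] [LinearOrder β]
    {v : Finset α → β} (hv : Monotone v) :
    ∃ S : Finset α, (∀ g ∈ Sᶜ, v (Sᶜ \ {g}) ≤ v S) ∧ ∀ g ∈ S, v (S \ {g}) ≤ v Sᶜ := by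
  have hne : (Finset.univ.filter fun S : Finset α => v S ≤ v Sᶜ).Nonempty :=
    ⟨∅, by simpa using hv (Finset.empty_subset _)⟩
  obtain ⟨S, hS, hmax⟩ := Finset.exists_max_image _ (fun S => toLex (v S, S.card)) hne
  simp only [Finset.mem_filter, Finset.mem_univ, true_and, Prod.Lex.toLex_le_toLex] at hS hmax
  refine ⟨S, fun g hg => ?_, fun g _ => (hv Finset.sdiff_subset).trans hS⟩
  by_contra! hlt
  have hgS : g ∉ S := Finset.mem_compl.mp hg
  have hcompl : (insert g S)ᶜ = Sᶜ \ {g} := by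
    rw [Finset.compl_insert, Finset.sdiff_singleton_eq_erase]
  rcases le_total (v (insert g S)) (v (Sᶜ \ {g})) with h | h
  · have hle : v S ≤ v (insert g S) := hv (Finset.subset_insert g S)
    rcases hmax (insert g S) (hcompl ▸ h) with h' | ⟨_, h'⟩
    · exact absurd h' hle.not_gt
    · rw [Finset.card_insert_of_notMem hgS] at h'
      omega
  · rcases hmax (Sᶜ \ {g}) (by rwa [← hcompl, compl_compl, hcompl]) with h' | ⟨h', _⟩
    · exact absurd h' hlt.not_gt
    · exact absurd h' hlt.ne'

/-- For `n = 2` agents and any finite set of `m` indivisible goods with monotone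
valuations (with `v i ∅ = 0`), there exists a complete allocation that is EFX. -/
theorem efx_exists_two_agents_monotone (m : ℕ)
    (v : Fin 2 → Finset (Fin m) → ℝ)
    (hv0 : ∀ i, v i ∅ = 0)
    (hmono : ∀ i (S T : Finset (Fin m)), S ⊆ T → v i S ≤ v i T) :
    ∃ A : Fin 2 → Finset (Fin m),
      (∀ i j, i ≠ j → Disjoint (A i) (A j)) ∧
      Finset.univ.biUnion A = Finset.univ ∧
      ∀ i j, ∀ g ∈ A j, v i (A i) ≥ v i (A j \ {g}) := by
  obtain ⟨S, h₁, h₂⟩ := exists_efx_partition (v := v 0) fun S T h => hmono 0 S T h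
  -- Agent `0` splits the goods and agent `1` takes the bundle she prefers.
  obtain ⟨T, hT, hpref⟩ : ∃ T : Finset (Fin m),
      (∀ g ∈ Tᶜ, v 0 (Tᶜ \ {g}) ≤ v 0 T) ∧ v 1 T ≤ v 1 Tᶜ := by
    rcases le_total (v 1 S) (v 1 Sᶜ) with h | h
    · exact ⟨S, h₁, h⟩
    · exact ⟨Sᶜ, by simpa using h₂, by simpa using h⟩
  have hself : ∀ i U (g : Fin m), v i (U \ {g}) ≤ v i U :=
    fun i U g => hmono i _ _ Finset.sdiff_subset
  refine ⟨![T, Tᶜ], ?_, ?_, ?_⟩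
  · simp [Fin.forall_fin_two, disjoint_compl_right, disjoint_compl_left]
  · ext x
    simp [Fin.exists_fin_two, em]
  · simp only [Fin.forall_fin_two, Matrix.cons_val_zero, Matrix.cons_val_one]
    exact ⟨⟨fun g _ => hself 0 T g, hT⟩,
      fun g _ => (hself 1 T g).trans hpref, fun g _ => hself 1 Tᶜ g⟩
end

section
/- For n = 3 agents and any finite set M of m indivisible goods, if each agent i has an additive valuation given by nonnegative item values v_i(k) ≥ 0 for k ∈ M, then there exists a complete allocation A = (A_1, A_2, A_3) that is EFX: for all agents i, j and every good g ∈ A_j, v_i(A_i) ≥ v_i(A_j \ {g}). -/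
namespace EFX

variable {α L : Type*} [DecidableEq α] [LinearOrder L]

/-- A bundle valuation that is strictly monotone, takes distinct values on distinct bundles,
and is maximin-share feasible. -/
structure IsValuation (v : Finset α → L) : Prop where
  strictMono : StrictMono v
  injective : Function.Injective v
  min_le_max : ∀ P Q Y W : Finset α, Disjoint P Q → Disjoint Y W → P ∪ Q = Y ∪ W →
    min (v P) (v Q) ≤ max (v Y) (v W)

/-- An owner of `P` with valuation `v` does not strongly envy the bundle `Q`. -/
def NoEnvy (v : Finset α → L) (P Q : Finset α) : Prop :=
  ∀ h ∈ Q, v (Q.erase h) ≤ v P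

/-- `X`, `Y`, `Z` partition the set of all goods. -/
structure IsPartition [Fintype α] (X Y Z : Finset α) : Prop where
  disjoint₁₂ : Disjoint X Y
  disjoint₁₃ : Disjoint X Z
  disjoint₂₃ : Disjoint Y Z
  union_eq : X ∪ Y ∪ Z = Finset.univ

/-- Some partition is EFX when its parts go to owners with valuations `a`, `b`, `c`. -/
def HasEFX [Fintype α] (a b c : Finset α → L) : Prop :=
  ∃ X Y Z, IsPartition X Y Z ∧ NoEnvy a X Y ∧ NoEnvy a X Z ∧ NoEnvy b Y X ∧ NoEnvy b Y Z ∧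
    NoEnvy c Z X ∧ NoEnvy c Z Y

/-- The first two parts are EFX-feasible for `a` and worth more than nothing,
and the third part is EFX-feasible for `b` or for `c`. -/
structure IsState [Fintype α] (a b c : Finset α → L) (X Y Z : Finset α) : Prop where
  isPartition : IsPartition X Y Z
  pos₁ : a ∅ < a X
  pos₂ : a ∅ < a Y
  noEnvy₁₂ : NoEnvy a X Y
  noEnvy₂₁ : NoEnvy a Y X
  noEnvy₁₃ : NoEnvy a X Z
  noEnvy₂₃ : NoEnvy a Y Z
  feasible : (NoEnvy b Z X ∧ NoEnvy b Z Y) ∨ (NoEnvy c Z X ∧ NoEnvy c Z Y)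

theorem NoEnvy.of_le {v : Finset α → L} (hv : IsValuation v) {P Q : Finset α} (h : v Q ≤ v P) :
    NoEnvy v P Q :=
  fun _ _ => (hv.strictMono.monotone (Finset.erase_subset _ _)).trans h

theorem NoEnvy.mono {v : Finset α → L} (hv : IsValuation v) {P Q P' Q' : Finset α}
    (h : NoEnvy v P Q) (hP : v P ≤ v P') (hQ : Q' ⊆ Q) : NoEnvy v P' Q' :=
  fun g hg => (hv.strictMono.monotone (Finset.erase_subset_erase g hQ)).trans
    ((h g (hQ hg)).trans hP)

theorem exists_of_not_noEnvy {v : Finset α → L} {P Q : Finset α} (h : ¬ NoEnvy v P Q) :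
    ∃ g ∈ Q, v P < v (Q.erase g) := by
  simpa [NoEnvy] using h

theorem lt_of_not_noEnvy {v : Finset α → L} (hv : IsValuation v) {P Q : Finset α}
    (h : ¬ NoEnvy v P Q) : v P < v Q := by
  by_contra! hle
  exact h (NoEnvy.of_le hv hle)

theorem IsPartition.swap [Fintype α] {X Y Z : Finset α} (h : IsPartition X Y Z) :
    IsPartition Y X Z :=
  ⟨h.disjoint₁₂.symm, h.disjoint₂₃, h.disjoint₁₃, by rw [Finset.union_comm Y X, h.union_eq]⟩

theorem IsPartition.rotate [Fintype α] {X Y Z : Finset α} (h : IsPartition X Y Z) :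
    IsPartition Y Z X :=
  ⟨h.disjoint₂₃, h.disjoint₁₂.symm, h.disjoint₁₃.symm, by
    rw [← h.union_eq, Finset.union_comm, Finset.union_assoc]⟩

theorem HasEFX.swap [Fintype α] {a b c : Finset α → L} (h : HasEFX a c b) : HasEFX a b c := by
  obtain ⟨X, Y, Z, hp, h₁, h₂, h₃, h₄, h₅, h₆⟩ := h
  exact ⟨X, Z, Y, hp.swap.rotate, h₂, h₁, h₅, h₆, h₃, h₄⟩

theorem IsState.swap_agents [Fintype α] {a b c : Finset α → L} {X Y Z : Finset α}
    (h : IsState a c b X Y Z) : IsState a b c X Y Z :=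
  { h with feasible := h.feasible.symm }

theorem IsState.swap [Fintype α] {a b c : Finset α → L} {X Y Z : Finset α}
    (h : IsState a b c X Y Z) : IsState a b c Y X Z :=
  ⟨h.isPartition.swap, h.pos₂, h.pos₁, h.noEnvy₂₁, h.noEnvy₁₂, h.noEnvy₂₃, h.noEnvy₁₃,
    h.feasible.imp And.symm And.symm⟩

/-- Two disjoint bundles can be redistributed into two bundles that do not strongly envy
each other, without decreasing the smaller value. -/
theorem exists_noEnvy_pair {v : Finset α → L} (hv : IsValuation v) (P Q : Finset α)
    (hPQ : Disjoint P Q) :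
    ∃ Y W, Disjoint Y W ∧ Y ∪ W = P ∪ Q ∧ NoEnvy v Y W ∧ NoEnvy v W Y ∧
      min (v P) (v Q) ≤ v Y ∧ min (v P) (v Q) ≤ v W := by
  obtain ⟨Y, hYS, hmax⟩ := Finset.exists_max_image (P ∪ Q).powerset
    (fun Y => min (v Y) (v ((P ∪ Q) \ Y))) ⟨∅, by simp⟩
  rw [Finset.mem_powerset] at hYS
  have key : ∀ Y W, Disjoint Y W → Y ∪ W = P ∪ Q →
      (∀ Z ⊆ P ∪ Q, min (v Z) (v ((P ∪ Q) \ Z)) ≤ min (v Y) (v W)) → NoEnvy v Y W := by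
    intro Y W hd hu hm g hg
    by_contra! hlt
    have h₁ : (P ∪ Q) \ insert g Y = W.erase g := by
      rw [Finset.disjoint_left] at hd
      ext x
      have := Finset.ext_iff.1 hu x
      grind
    have h₂ := hm (insert g Y) (by rw [← hu]; grind)
    rw [h₁] at h₂
    have h₃ : v Y < v (insert g Y) :=
      hv.strictMono (Finset.ssubset_insert fun h => Finset.disjoint_left.1 hd h hg)
    exact absurd (h₂.trans (min_le_left _ _)) (not_le.2 (lt_min h₃ hlt))
  have hu : Y ∪ (P ∪ Q) \ Y = P ∪ Q := Finset.union_sdiff_of_subset hYS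
  have hQ : (P ∪ Q) \ P = Q := by
    rw [Finset.union_sdiff_left, Finset.sdiff_eq_self_of_disjoint hPQ.symm]
  have hm := hmax P (Finset.mem_powerset.2 Finset.subset_union_left)
  rw [hQ] at hm
  refine ⟨Y, (P ∪ Q) \ Y, Finset.disjoint_sdiff, hu,
    key _ _ Finset.disjoint_sdiff hu fun Z hZ => hmax Z (Finset.mem_powerset.2 hZ),
    key _ _ Finset.disjoint_sdiff.symm (by rw [Finset.union_comm, hu]) fun Z hZ => ?_,
    hm.trans (min_le_left _ _), hm.trans (min_le_right _ _)⟩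
  rw [min_comm (v (_ \ Y))]
  exact hmax Z (Finset.mem_powerset.2 hZ)

/-- The goods assigned to `i` by `f`. -/
def bundle [Fintype α] (f : α → Fin 3) (i : Fin 3) : Finset α :=
  Finset.univ.filter (f · = i)

theorem mem_bundle {β : Type*} [Fintype β] {f : β → Fin 3} {i : Fin 3} {x : β} :
    x ∈ bundle f i ↔ f x = i := by
  simp [bundle]

theorem bundle_isPartition [Fintype α] (f : α → Fin 3) :
    IsPartition (bundle f 0) (bundle f 1) (bundle f 2) := by
  refine ⟨?_, ?_, ?_, ?_⟩
  iterate 3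
    rw [Finset.disjoint_left]
    intro x
    rw [mem_bundle, mem_bundle]
    rintro h
    simp [h]
  ext x
  simp only [Finset.mem_union, mem_bundle, Finset.mem_univ, iff_true]
  generalize f x = i
  fin_cases i <;> simp

theorem IsPartition.exists_bundle [Fintype α] {X Y Z : Finset α} (h : IsPartition X Y Z) :
    ∃ f : α → Fin 3, bundle f 0 = X ∧ bundle f 1 = Y ∧ bundle f 2 = Z := by
  have h₁ := Finset.disjoint_left.1 h.disjoint₁₂
  have h₂ := Finset.disjoint_left.1 h.disjoint₁₃
  have h₃ := Finset.disjoint_left.1 h.disjoint₂₃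
  have h₄ : ∀ x, x ∈ X ∨ x ∈ Y ∨ x ∈ Z := fun x => by
    have := Finset.ext_iff.1 h.union_eq x
    simpa [or_assoc] using this
  refine ⟨fun x => if x ∈ X then 0 else if x ∈ Y then 1 else 2, ?_, ?_, ?_⟩ <;>
  · ext x
    rw [mem_bundle]
    have := h₁ (a := x)
    have := h₂ (a := x)
    have := h₃ (a := x)
    have := h₄ x
    by_cases hX : x ∈ X <;> by_cases hY : x ∈ Y <;> simp_all

/-- With identical valuations, any assignment can be rearranged into an envy-free one
up to any good, without decreasing the smallest value. -/
theorem exists_noEnvy_bundle [Fintype α] {v : Finset α → L} (hv : IsValuation v)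
    (f : α → Fin 3) (hf : ∀ i, v ∅ < v (bundle f i)) :
    ∃ f' : α → Fin 3, (∀ i j, NoEnvy v (bundle f' i) (bundle f' j)) ∧
      ∀ t, (∀ i, t < v (bundle f i)) → ∀ i, t < v (bundle f' i) := by
  let m : (α → Fin 3) → L := fun f => Finset.univ.inf' Finset.univ_nonempty fun i => v (bundle f i)
  obtain ⟨e, -, he⟩ := Finset.exists_max_image Finset.univ m ⟨f, Finset.mem_univ f⟩
  have hm : ∀ t, (∀ i, t < v (bundle f i)) → ∀ i, t < v (bundle e i) := by
    intro t ht i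
    have h₁ : t < m f := by simpa [m] using ht
    exact (h₁.trans_le (he f (Finset.mem_univ f))).trans_le (Finset.inf'_le _ (Finset.mem_univ i))
  refine ⟨e, fun i j g hg => ?_, hm⟩
  by_contra! hlt
  obtain ⟨k, -, hk⟩ := Finset.exists_min_image Finset.univ (fun i => v (bundle e i))
    Finset.univ_nonempty
  have hk : ∀ l, v (bundle e k) ≤ v (bundle e l) := fun l => hk l (Finset.mem_univ l)
  have hlt := (hk i).trans_lt hlt
  rw [mem_bundle] at hg
  have hjk : j ≠ k := by
    rintro rfl
    exact absurd hlt (not_lt.2 (hv.strictMono.monotone (Finset.erase_subset _ _)))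
  have h₁ : v (bundle e k) < m (Function.update e g k) := by
    simp only [m, Finset.lt_inf'_iff, Finset.mem_univ, true_imp_iff]
    intro l
    by_cases hlk : l = k
    · subst hlk
      refine hv.strictMono ((Finset.ssubset_iff_of_subset fun x hx => ?_).2 ⟨g, ?_, ?_⟩)
      · rw [mem_bundle] at *
        by_cases hxg : x = g <;> simp [hxg, hx]
      · simp [mem_bundle]
      · rwa [mem_bundle, hg]
    by_cases hlj : l = j
    · subst hlj
      convert hlt using 2
      ext x
      rw [Finset.mem_erase, mem_bundle, mem_bundle]
      by_cases hxg : x = g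
      · subst hxg
        simp [Ne.symm hlk]
      · simp [hxg]
    · have : bundle (Function.update e g k) l = bundle e l := by
        ext x
        rw [mem_bundle, mem_bundle]
        by_cases hxg : x = g
        · subst hxg
          simp [Ne.symm hlk, hg, Ne.symm hlj]
        · simp [hxg]
      rw [this]
      refine lt_of_le_of_ne (hk l) fun heq => ?_
      have heq := hv.injective heq
      have hne : (bundle e l).Nonempty := by
        rw [Finset.nonempty_iff_ne_empty]
        intro h0
        exact absurd (hm _ hf l) (by simp [h0])
      obtain ⟨x, hx⟩ := hne
      have hx' := heq ▸ hx
      rw [mem_bundle] at hx hx'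
      exact hlk (hx.symm.trans hx')
  refine absurd (h₁.trans_le (he _ (Finset.mem_univ _))) (not_lt.2 ?_)
  exact Finset.inf'_le _ (Finset.mem_univ k)

/-- A partition all of whose parts are worth more than `t` to `a` yields a state
whose first two parts are. -/
theorem exists_isState_of_lt [Fintype α] {a b c : Finset α → L} (ha : IsValuation a)
    (hb : IsValuation b) {P Q R : Finset α} (hp : IsPartition P Q R) {t : L} (ht : a ∅ ≤ t)
    (hP : t < a P) (hQ : t < a Q) (hR : t < a R) :
    ∃ X Y Z, IsState a b c X Y Z ∧ t < a X ∧ t < a Y := by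
  obtain ⟨f, rfl, rfl, rfl⟩ := hp.exists_bundle
  have hf : ∀ i, t < a (bundle f i) := by
    intro i
    fin_cases i <;> assumption
  obtain ⟨e, he, hlt⟩ := exists_noEnvy_bundle ha f fun i => ht.trans_lt (hf i)
  have hlt := hlt t hf
  obtain ⟨k, -, hk⟩ := Finset.exists_max_image Finset.univ (fun i => b (bundle e i))
    Finset.univ_nonempty
  have hk : ∀ l, NoEnvy b (bundle e k) (bundle e l) :=
    fun l => NoEnvy.of_le hb (hk l (Finset.mem_univ l))
  have key : ∀ i j, IsPartition (bundle e i) (bundle e j) (bundle e k) →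
      ∃ X Y Z, IsState a b c X Y Z ∧ t < a X ∧ t < a Y := fun i j hp =>
    ⟨_, _, _, ⟨hp, ht.trans_lt (hlt i), ht.trans_lt (hlt j), he _ _, he _ _, he _ _, he _ _,
      Or.inl ⟨hk _, hk _⟩⟩, hlt i, hlt j⟩
  have hp := bundle_isPartition e
  fin_cases k
  · exact key 1 2 hp.rotate
  · exact key 2 0 hp.rotate.rotate
  · exact key 0 1 hp

theorem exists_isState_of_feasible_of_le [Fintype α] {a b c : Finset α → L} (ha : IsValuation a)
    (hb : IsValuation b) {P Q R : Finset α} (hp : IsPartition P Q R) {t : L} (ht : a ∅ ≤ t)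
    (hQ : t < a Q) (hRP : NoEnvy b R P) (hRQ : NoEnvy b R Q) (hle : a Q ≤ a P) :
    ∃ X Y Z, IsState a b c X Y Z ∧ t < a X ∧ t < a Y := by
  obtain ⟨Z, hZ, hmin⟩ := Finset.exists_min_image (P.powerset.filter fun Z => a Q ≤ a Z)
    Finset.card ⟨P, by simpa using hle⟩
  simp only [Finset.mem_filter, Finset.mem_powerset] at hZ hmin
  obtain ⟨hZP, hQZ⟩ := hZ
  have hQZ' : NoEnvy a Q Z := by
    intro h hh
    by_contra! hlt
    have := hmin (Z.erase h) ⟨(Finset.erase_subset _ _).trans hZP, hlt.le⟩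
    exact absurd (Finset.card_erase_lt_of_mem hh) (not_lt.2 this)
  have hp' : IsPartition Z Q (R ∪ P \ Z) := by
    have h₁ := Finset.disjoint_left.1 hp.disjoint₁₂
    have h₂ := Finset.disjoint_left.1 hp.disjoint₁₃
    have h₃ := Finset.disjoint_left.1 hp.disjoint₂₃
    have h₄ := Finset.ext_iff.1 hp.union_eq
    refine ⟨?_, ?_, ?_, ?_⟩
    iterate 3
      rw [Finset.disjoint_left]
      grind
    ext x
    have := h₄ x
    grind
  rcases lt_or_ge t (a (R ∪ P \ Z)) with hR | hR
  · exact exists_isState_of_lt ha hb hp' ht (hQ.trans_le hQZ) hQ hR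
  have hmono : b R ≤ b (R ∪ P \ Z) := hb.strictMono.monotone Finset.subset_union_left
  exact ⟨Z, Q, R ∪ P \ Z, ⟨hp', ht.trans_lt (hQ.trans_le hQZ), ht.trans_lt hQ,
    NoEnvy.of_le ha hQZ, hQZ', NoEnvy.of_le ha (hR.trans (hQ.le.trans hQZ)),
    NoEnvy.of_le ha (hR.trans hQ.le), Or.inl ⟨hRP.mono hb hmono hZP, hRQ.mono hb hmono subset_rfl⟩⟩,
    hQ.trans_le hQZ, hQ⟩

/-- A partition whose first two parts are worth more than `t` to `a` and whose third part is
feasible for `b` yields a state whose first two parts are worth more than `t` to `a`. -/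
theorem exists_isState_of_feasible [Fintype α] {a b c : Finset α → L} (ha : IsValuation a)
    (hb : IsValuation b) {P Q R : Finset α} (hp : IsPartition P Q R) {t : L} (ht : a ∅ ≤ t)
    (hP : t < a P) (hQ : t < a Q) (hRP : NoEnvy b R P) (hRQ : NoEnvy b R Q) :
    ∃ X Y Z, IsState a b c X Y Z ∧ t < a X ∧ t < a Y := by
  rcases le_total (a Q) (a P) with hle | hle
  · exact exists_isState_of_feasible_of_le ha hb hp ht hQ hRP hRQ hle
  · exact exists_isState_of_feasible_of_le ha hb hp.swap ht hP hRQ hRP hle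

theorem IsPartition.move [Fintype α] {X Y Z : Finset α} (h : IsPartition X Y Z) {g : α}
    (hg : g ∈ Z) : IsPartition (insert g X) Y (Z.erase g) := by
  have h₁ := Finset.disjoint_left.1 h.disjoint₁₂
  have h₂ := Finset.disjoint_left.1 h.disjoint₁₃
  have h₃ := Finset.disjoint_left.1 h.disjoint₂₃
  have h₄ := Finset.ext_iff.1 h.union_eq
  refine ⟨?_, ?_, ?_, ?_⟩
  iterate 3
    rw [Finset.disjoint_left]
    grind
  ext x
  have := h₄ x
  grind

/-- If neither `X` nor `Y` is feasible for `v`, then removing some good from `Z` leaves a bundle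
that `v` prefers to both. -/
theorem exists_lt_erase {v : Finset α → L} (hv : IsValuation v) {X Y Z : Finset α}
    (hX : ¬ (NoEnvy v X Y ∧ NoEnvy v X Z)) (hY : ¬ (NoEnvy v Y X ∧ NoEnvy v Y Z)) :
    ∃ g ∈ Z, v X < v (Z.erase g) ∧ v Y < v (Z.erase g) := by
  rcases le_total (v X) (v Y) with h | h
  · obtain ⟨g, hg, hlt⟩ := exists_of_not_noEnvy fun hn => hY ⟨NoEnvy.of_le hv h, hn⟩
    exact ⟨g, hg, h.trans_lt hlt, hlt⟩
  · obtain ⟨g, hg, hlt⟩ := exists_of_not_noEnvy fun hn => hX ⟨NoEnvy.of_le hv h, hn⟩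
    exact ⟨g, hg, hlt, h.trans_lt hlt⟩

theorem noEnvy_of_not_feasible {v : Finset α → L} (hv : IsValuation v) {X Y Z : Finset α}
    (hX : ¬ (NoEnvy v X Y ∧ NoEnvy v X Z)) (hY : ¬ (NoEnvy v Y X ∧ NoEnvy v Y Z)) :
    NoEnvy v Z X ∧ NoEnvy v Z Y := by
  obtain ⟨g, -, h₁, h₂⟩ := exists_lt_erase hv hX hY
  have := hv.strictMono.monotone (Finset.erase_subset g Z)
  exact ⟨NoEnvy.of_le hv (h₁.le.trans this), NoEnvy.of_le hv (h₂.le.trans this)⟩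

/-- A partition in which `Y` and `W` are feasible for `b`, `W` is feasible for `c`, and `Q` is
worth more than `t` to `a`, is EFX or yields a state whose first two parts are worth more. -/
theorem exists_isState_or_hasEFX [Fintype α] {a b c : Finset α → L} (ha : IsValuation a)
    (hb : IsValuation b) (hc : IsValuation c) {Y Q W : Finset α} (hp : IsPartition Y Q W) {t : L}
    (ht : a ∅ ≤ t) (hQ : t < a Q) (hbYW : NoEnvy b Y W) (hbYQ : NoEnvy b Y Q)
    (hcWY : NoEnvy c W Y) (hcWQ : NoEnvy c W Q) :
    HasEFX a b c ∨ ∃ X Y Z, IsState a b c X Y Z ∧ t < a X ∧ t < a Y := by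
  by_cases h₁ : NoEnvy a Q Y
  · by_cases h₂ : NoEnvy a Q W
    · exact Or.inl ⟨Q, Y, W, hp.swap, h₁, h₂, hbYQ, hbYW, hcWQ, hcWY⟩
    · exact Or.inr (exists_isState_of_feasible ha hb hp.rotate.swap ht
        (hQ.trans (lt_of_not_noEnvy ha h₂)) hQ hbYW hbYQ)
  · obtain ⟨X, Y, Z, h, hlt⟩ := exists_isState_of_feasible (c := b) ha hc hp ht
      (hQ.trans (lt_of_not_noEnvy ha h₁)) hQ hcWY hcWQ
    exact Or.inr ⟨X, Y, Z, h.swap_agents, hlt⟩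

theorem IsState.exists_better_of_lt [Fintype α] {a b c : Finset α → L} (ha : IsValuation a)
    (hb : IsValuation b) (hc : IsValuation c) (hno : ¬ HasEFX a b c) {X Y Z : Finset α}
    (hs : IsState a b c X Y Z) (hlt : a X < a Y) :
    ∃ X' Y' Z', IsState a b c X' Y' Z' ∧ a X < a X' ∧ a X < a Y' := by
  have hp := hs.isPartition
  have hno' : ¬ HasEFX a c b := fun h => hno h.swap
  have notFeasible : ∀ {b c : Finset α → L}, ¬ HasEFX a b c → NoEnvy b Z X ∧ NoEnvy b Z Y →
      ¬ (NoEnvy c X Y ∧ NoEnvy c X Z) ∧ ¬ (NoEnvy c Y X ∧ NoEnvy c Y Z) := by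
    intro b c hno hZ
    refine ⟨fun h => hno ?_, fun h => hno ?_⟩
    · exact ⟨Y, Z, X, hp.rotate, hs.noEnvy₂₃, hs.noEnvy₂₁, hZ.2, hZ.1, h.1, h.2⟩
    · exact ⟨X, Z, Y, hp.swap.rotate, hs.noEnvy₁₃, hs.noEnvy₁₂, hZ.1, hZ.2, h.1, h.2⟩
  have hboth : (¬ (NoEnvy b X Y ∧ NoEnvy b X Z) ∧ ¬ (NoEnvy b Y X ∧ NoEnvy b Y Z)) ∧
      (¬ (NoEnvy c X Y ∧ NoEnvy c X Z) ∧ ¬ (NoEnvy c Y X ∧ NoEnvy c Y Z)) := by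
    rcases hs.feasible with h | h
    · have hc' := notFeasible hno h
      exact ⟨notFeasible hno' (noEnvy_of_not_feasible hc hc'.1 hc'.2), hc'⟩
    · have hb' := notFeasible hno' h
      exact ⟨hb', notFeasible hno (noEnvy_of_not_feasible hb hb'.1 hb'.2)⟩
  have hins : ∀ {g}, g ∈ Z → a X < a (insert g X) := fun hg =>
    ha.strictMono (Finset.ssubset_insert fun h => Finset.disjoint_left.1 hp.disjoint₁₃ h hg)
  obtain ⟨g, hg, hgX, hgY⟩ := exists_lt_erase hb hboth.1.1 hboth.1.2
  obtain ⟨k, hk, hkX, hkY⟩ := exists_lt_erase hc hboth.2.1 hboth.2.2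
  rcases le_or_gt (b (insert g X)) (b (Z.erase g)) with h | hgZ
  · exact exists_isState_of_feasible ha hb (hp.move hg) hs.pos₁.le (hins hg) hlt
      (NoEnvy.of_le hb h) (NoEnvy.of_le hb hgY.le)
  rcases le_or_gt (c (insert k X)) (c (Z.erase k)) with h | hkZ
  · obtain ⟨X', Y', Z', h', hlt'⟩ := exists_isState_of_feasible (c := b) ha hc (hp.move hk)
      hs.pos₁.le (hins hk) hlt (NoEnvy.of_le hc h) (NoEnvy.of_le hc hkY.le)
    exact ⟨X', Y', Z', h'.swap_agents, hlt'⟩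
  have hunion : ∀ {g}, g ∈ Z → insert g X ∪ Z.erase g = X ∪ Z := by
    intro g hg
    ext x
    grind
  obtain ⟨U, W, hd, hu, hUW, hWU, hU, hW⟩ := exists_noEnvy_pair hb _ _ (hp.move hg).disjoint₁₃
  rw [hunion hg] at hu
  have hYU : b Y < b U := (lt_min (hgY.trans hgZ) hgY).trans_le hU
  have hYW : b Y < b W := (lt_min (hgY.trans hgZ) hgY).trans_le hW
  have hYmax : c Y < max (c U) (c W) := (lt_min (hkY.trans hkZ) hkY).trans_le
    (hc.min_le_max _ _ _ _ (hp.move hk).disjoint₁₃ hd (by rw [hunion hk, hu]))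
  have hp' : IsPartition U Y W := by
    have h₁ : Disjoint Y (U ∪ W) := by
      rw [hu]
      exact Finset.disjoint_union_right.2 ⟨hp.disjoint₁₂.symm, hp.disjoint₂₃⟩
    rw [Finset.disjoint_union_right] at h₁
    refine ⟨h₁.1.symm, hd, h₁.2, ?_⟩
    rw [Finset.union_right_comm, hu, Finset.union_right_comm, hp.union_eq]
  rcases le_total (c U) (c W) with hle | hle
  · rw [max_eq_right hle] at hYmax
    exact (exists_isState_or_hasEFX ha hb hc hp' hs.pos₁.le hlt hUW (NoEnvy.of_le hb hYU.le)
      (NoEnvy.of_le hc hle) (NoEnvy.of_le hc hYmax.le)).resolve_left hno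
  · rw [max_eq_left hle] at hYmax
    exact (exists_isState_or_hasEFX ha hb hc hp'.swap.rotate.rotate
      hs.pos₁.le hlt hWU (NoEnvy.of_le hb hYW.le)
      (NoEnvy.of_le hc hle) (NoEnvy.of_le hc hYmax.le)).resolve_left hno

theorem IsState.exists_better [Fintype α] {a b c : Finset α → L} (ha : IsValuation a)
    (hb : IsValuation b) (hc : IsValuation c) (hno : ¬ HasEFX a b c) {X Y Z : Finset α}
    (hs : IsState a b c X Y Z) :
    ∃ X' Y' Z', IsState a b c X' Y' Z' ∧ min (a X) (a Y) < min (a X') (a Y') := by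
  rcases lt_trichotomy (a X) (a Y) with h | h | h
  · obtain ⟨X', Y', Z', hs', h₁, h₂⟩ := hs.exists_better_of_lt ha hb hc hno h
    exact ⟨X', Y', Z', hs', (min_le_left _ _).trans_lt (lt_min h₁ h₂)⟩
  · have hXY := hs.isPartition.disjoint₁₂
    rw [← ha.injective h, disjoint_self, Finset.bot_eq_empty] at hXY
    exact absurd hs.pos₁ (by simp [hXY])
  · obtain ⟨X', Y', Z', hs', h₁, h₂⟩ := hs.swap.exists_better_of_lt ha hb hc hno h
    exact ⟨X', Y', Z', hs', (min_le_right _ _).trans_lt (lt_min h₁ h₂)⟩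

theorem hasEFX_of_surjective [Fintype α] {a b c : Finset α → L} (ha : IsValuation a)
    (hb : IsValuation b) (hc : IsValuation c) {f : α → Fin 3} (hf : Function.Surjective f) :
    HasEFX a b c := by
  by_contra hno
  have hpos : ∀ i, a ∅ < a (bundle f i) := fun i => by
    obtain ⟨x, hx⟩ := hf i
    exact ha.strictMono (Finset.empty_ssubset.2 ⟨x, mem_bundle.2 hx⟩)
  obtain ⟨X₀, Y₀, Z₀, hs₀, -⟩ := exists_isState_of_lt (c := c) ha hb (bundle_isPartition f) le_rfl
    (hpos 0) (hpos 1) (hpos 2)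
  obtain ⟨⟨X, Y, Z⟩, hs, hmax⟩ := Set.exists_max_image
    {p : Finset α × Finset α × Finset α | IsState a b c p.1 p.2.1 p.2.2}
    (fun p => min (a p.1) (a p.2.1)) (Set.toFinite _) ⟨(X₀, Y₀, Z₀), hs₀⟩
  obtain ⟨X', Y', Z', hs', hlt⟩ := IsState.exists_better ha hb hc hno hs
  exact absurd hlt (not_lt.2 (hmax (X', Y', Z') hs'))

theorem isValuation_sum {G : Type*} [AddCommMonoid G] [LinearOrder G]
    [IsOrderedCancelAddMonoid G] (w : α → G) (hw : ∀ k, 0 < w k)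
    (hinj : Function.Injective fun S : Finset α => ∑ k ∈ S, w k) :
    IsValuation fun S : Finset α => ∑ k ∈ S, w k where
  injective := hinj
  strictMono := by
    refine Monotone.strictMono_of_injective (fun S T h => ?_) hinj
    exact Finset.sum_le_sum_of_subset_of_nonneg h fun k _ _ => (hw k).le
  min_le_max P Q Y W hPQ hYW hu := by
    by_contra! h
    simp only [max_lt_iff, lt_min_iff] at h
    have := add_lt_add h.1.1 h.2.2
    rw [← Finset.sum_union hPQ, ← Finset.sum_union hYW, hu] at this
    exact lt_irrefl _ this

/-- The value of a good together with a tie-breaking power of two. -/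
def lexValue {m : ℕ} (v : Fin m → ℝ) (k : Fin m) : ℝ ×ₗ ℕ :=
  toLex (v k, 2 ^ (k : ℕ))

theorem ofLex_sum_lexValue {m : ℕ} (v : Fin m → ℝ) (S : Finset (Fin m)) :
    ofLex (∑ k ∈ S, lexValue v k) = (∑ k ∈ S, v k, ∑ k ∈ S, 2 ^ (k : ℕ)) := by
  induction S using Finset.induction_on with
  | empty => rfl
  | insert k S hk ih =>
    rw [Finset.sum_insert hk, Finset.sum_insert hk, Finset.sum_insert hk, ofLex_add, ih]
    rfl

theorem isValuation_lexValue {m : ℕ} (v : Fin m → ℝ) (hv : ∀ k, 0 ≤ v k) :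
    IsValuation fun S : Finset (Fin m) => ∑ k ∈ S, lexValue v k := by
  refine isValuation_sum _ (fun k => ?_) fun S T h => ?_
  · rw [Prod.Lex.lt_iff]
    rcases (hv k).lt_or_eq with h | h
    · exact Or.inl h
    · exact Or.inr ⟨h, pow_pos two_pos _⟩
  · have h := congrArg (fun p => (ofLex p).2) h
    simp only [ofLex_sum_lexValue] at h
    have hmap : ∀ S : Finset (Fin m),
        ∑ k ∈ S, 2 ^ (k : ℕ) = ∑ k ∈ S.map Fin.valEmbedding, 2 ^ k := by simp
    rw [hmap, hmap] at h
    exact Finset.map_injective _ (Finset.geomSum_injective le_rfl h)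

theorem NoEnvy.sum_sdiff_le {m : ℕ} {v : Fin m → ℝ} {P Q : Finset (Fin m)}
    (h : NoEnvy (fun S => ∑ k ∈ S, lexValue v k) P Q) :
    ∀ g ∈ Q, ∑ k ∈ P, v k ≥ ∑ k ∈ Q \ {g}, v k := by
  intro g hg
  have := h g hg
  rw [Prod.Lex.le_iff, ofLex_sum_lexValue, ofLex_sum_lexValue] at this
  rw [Finset.sdiff_singleton_eq_erase]
  rcases this with h | h
  · exact h.le
  · exact h.1.le

end EFX

open EFX in
/-- For `n = 3` agents and any finite set of `m` indivisible goods with additive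
valuations given by nonnegative item values, there exists a complete allocation that is EFX. -/
theorem efx_exists_three_agents_additive (m : ℕ)
    (v : Fin 3 → Fin m → ℝ)
    (hv : ∀ i k, 0 ≤ v i k) :
    ∃ A : Fin 3 → Finset (Fin m),
      (∀ i j, i ≠ j → Disjoint (A i) (A j)) ∧
      Finset.univ.biUnion A = Finset.univ ∧
      ∀ i j, ∀ g ∈ A j, (∑ k ∈ A i, v i k) ≥ ∑ k ∈ A j \ {g}, v i k := by
  suffices h : ∃ f : Fin m → Fin 3, ∀ i j, ∀ g ∈ bundle f j,
      (∑ k ∈ bundle f i, v i k) ≥ ∑ k ∈ bundle f j \ {g}, v i k by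
    obtain ⟨f, hf⟩ := h
    refine ⟨bundle f, fun i j hij => ?_, ?_, hf⟩
    · rw [Finset.disjoint_left]
      intro x hi hj
      rw [mem_bundle] at hi hj
      exact hij (hi.symm.trans hj)
    · ext x
      simp [mem_bundle]
  rcases le_total m 3 with hm | hm
  · refine ⟨Fin.castLE hm, fun i j g hg => ?_⟩
    have : bundle (Fin.castLE hm) j \ {g} = ∅ := by
      ext x
      simp only [Finset.mem_sdiff, mem_bundle, Finset.mem_singleton, Finset.notMem_empty,
        iff_false, not_and, not_not]
      intro hx
      exact Fin.castLE_injective hm (hx.trans (mem_bundle.1 hg).symm)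
    rw [this, Finset.sum_empty]
    exact Finset.sum_nonneg fun k _ => hv i k
  · have hval := fun i => isValuation_lexValue (v i) (hv i)
    obtain ⟨X, Y, Z, hp, h₁, h₂, h₃, h₄, h₅, h₆⟩ := hasEFX_of_surjective (hval 0) (hval 1) (hval 2)
      (Function.invFun_surjective (Fin.castLE_injective hm))
    obtain ⟨f, rfl, rfl, rfl⟩ := hp.exists_bundle
    refine ⟨f, fun i j => ?_⟩
    by_cases hij : i = j
    · subst hij
      exact NoEnvy.sum_sdiff_le (NoEnvy.of_le (hval i) le_rfl)
    · apply NoEnvy.sum_sdiff_le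
      fin_cases i <;> fin_cases j <;> first | assumption | exact absurd rfl hij
end

section
/- For every number of agents n ≥ 1 and every finite set M of m indivisible goods, if each agent i has an additive valuation with nonnegative item values and the instance is identically ordered (IDO), i.e., there is an enumeration g_1,…,g_m of M such that v_i(g_1) ≥ v_i(g_2) ≥ … ≥ v_i(g_m) for every agent i, then there exists a complete allocation A = (A_1,…,A_n) that is EFX: for all agents i, j and every good g ∈ A_j, v_i(A_i) ≥ v_i(A_j \ {g}). -/
/-- A self-map of a nonempty finite type has a periodic point. -/
theorem periodicPts_nonempty_of_finite {ι : Type*} [Finite ι] [Nonempty ι] (f : ι → ι) :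
    (Function.periodicPts f).Nonempty := by
  inhabit ι
  obtain ⟨a, b, hab, h⟩ := Finite.exists_ne_map_eq_of_infinite fun k : ℕ => f^[k] default
  wlog hlt : a < b generalizing a b
  · exact this b a hab.symm h.symm (by omega)
  refine ⟨f^[a] default, Function.mk_mem_periodicPts (n := b - a) (by omega) ?_⟩
  change f^[b - a] (f^[a] default) = f^[a] default
  rw [← Function.iterate_add_apply, Nat.sub_add_cancel hlt.le]
  exact h.symm

/-- For every self-map of a nonempty finite type there is a permutation that agrees with it on a
nonempty set and fixes everything else. -/
theorem exists_perm_apply_eq_or_fixed {ι : Type*} [Finite ι] [Nonempty ι] (f : ι → ι) :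
    ∃ g : Equiv.Perm ι, (∀ s, g s = f s ∨ g s = s) ∧ ∃ s, g s = f s := by
  classical
  let g : ι → ι := fun s => if s ∈ Function.periodicPts f then f s else s
  have hsurj : Function.Surjective g := fun y => by
    by_cases hy : y ∈ Function.periodicPts f
    · obtain ⟨x, hx, rfl⟩ := (Function.bijOn_periodicPts f).surjOn hy
      exact ⟨x, if_pos hx⟩
    · exact ⟨y, if_neg hy⟩
  refine ⟨Equiv.ofBijective g (Finite.surjective_iff_bijective.mp hsurj), fun s => ?_, ?_⟩
  · exact ite_eq_or_eq _ _ _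
  · obtain ⟨s, hs⟩ := periodicPts_nonempty_of_finite f
    exact ⟨s, if_pos hs⟩

/-- Envy-cycle elimination: if `W i j` is the value of agent `i` for bundle `j`, the bundles can be
permuted so that no agent is worse off and some agent is not envied by anyone. -/
theorem exists_perm_unenvied {ι : Type*} [Fintype ι] [Nonempty ι] (W : ι → ι → ℝ) :
    ∃ σ : Equiv.Perm ι, (∀ i, W i i ≤ W i (σ i)) ∧ ∃ s, ∀ i, W i (σ s) ≤ W i (σ i) := by
  classical
  obtain ⟨σ, hσ, hmax⟩ := Set.exists_max_image {σ : Equiv.Perm ι | ∀ i, W i i ≤ W i (σ i)}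
    (fun σ => ∑ i, W i (σ i)) (Set.toFinite _) ⟨1, fun _ => le_rfl⟩
  refine ⟨σ, hσ, ?_⟩
  by_contra! hcon
  choose f hf using hcon
  obtain ⟨g, hg, s, hs⟩ := exists_perm_apply_eq_or_fixed f
  have hle : ∀ t, W (g t) (σ (g t)) ≤ W (g t) (σ t) := fun t => by
    rcases hg t with h | h
    · rw [h]; exact (hf t).le
    · rw [h]
  have hmem : ∀ i, W i i ≤ W i (σ (g.symm i)) := fun i => by
    have := hle (g.symm i)
    rw [Equiv.apply_symm_apply] at this
    exact (hσ i).trans this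
  have hlt : ∑ t, W (g t) (σ (g t)) < ∑ t, W (g t) (σ t) :=
    Finset.sum_lt_sum (fun t _ => hle t) ⟨s, Finset.mem_univ _, by rw [hs]; exact hf s⟩
  have hsum : ∑ i, W i (σ (g.symm i)) ≤ ∑ i, W i (σ i) := hmax (g.symm.trans σ) hmem
  rw [← Equiv.sum_comp g, ← Equiv.sum_comp g fun i => W i (σ i)] at hsum
  simp only [Equiv.symm_apply_apply] at hsum
  exact hlt.not_ge hsum

/-- An EFX partial allocation can be extended by an item that every agent values at most as much as
each item allocated so far. -/
theorem exists_efx_insert {ι M : Type*} [Fintype ι] [Nonempty ι] [DecidableEq M]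
    (v : ι → M → ℝ) (A : ι → Finset M) (x : M)
    (hdisj : ∀ i j, i ≠ j → Disjoint (A i) (A j))
    (hefx : ∀ i j, ∀ g ∈ A j, (∑ k ∈ A i, v i k) ≥ ∑ k ∈ A j \ {g}, v i k)
    (hx : ∀ j, x ∉ A j) (hmin : ∀ i j, ∀ g ∈ A j, v i x ≤ v i g)
    (hv : ∀ i, 0 ≤ v i x) :
    ∃ B : ι → Finset M,
      (∀ i j, i ≠ j → Disjoint (B i) (B j)) ∧
      Finset.univ.biUnion B = insert x (Finset.univ.biUnion A) ∧
      ∀ i j, ∀ g ∈ B j, (∑ k ∈ B i, v i k) ≥ ∑ k ∈ B j \ {g}, v i k := by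
  classical
  obtain ⟨σ, hσ, s, hs⟩ := exists_perm_unenvied fun i j => ∑ k ∈ A j, v i k
  have hself : ∀ i, ∑ k ∈ A (σ i), v i k ≤
      ∑ k ∈ (if i = s then insert x (A (σ i)) else A (σ i)), v i k := fun i => by
    split_ifs
    · rw [Finset.sum_insert (hx _)]
      linarith [hv i]
    · exact le_rfl
  refine ⟨fun i => if i = s then insert x (A (σ i)) else A (σ i), fun i j hij => ?_, ?_,
    fun i j g hg => ?_⟩
  · have hd := hdisj (σ i) (σ j) (σ.injective.ne hij)
    dsimp only
    split_ifs with hi hj hj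
    · exact absurd (hi.trans hj.symm) hij
    · exact Finset.disjoint_insert_left.mpr ⟨hx _, hd⟩
    · exact Finset.disjoint_insert_right.mpr ⟨hx _, hd⟩
    · exact hd
  · ext y
    simp only [Finset.mem_biUnion, Finset.mem_univ, true_and, Finset.mem_insert]
    constructor
    · rintro ⟨i, hi⟩
      split_ifs at hi
      · exact (Finset.mem_insert.mp hi).imp_right fun h => ⟨_, h⟩
      · exact Or.inr ⟨_, hi⟩
    · rintro (rfl | ⟨j, hj⟩)
      · exact ⟨s, by simp⟩
      · refine ⟨σ.symm j, ?_⟩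
        split_ifs <;> simp [hj]
  · refine ge_trans (hself i) ?_
    dsimp only at hg ⊢
    split_ifs at hg ⊢ with hj
    · subst hj
      refine ge_trans (hs i) ?_
      rcases Finset.mem_insert.mp hg with rfl | hgA
      · rw [Finset.sdiff_singleton_eq_erase, Finset.erase_insert (hx _)]
      · rw [Finset.sdiff_singleton_eq_erase, Finset.sum_erase_eq_sub hg,
          Finset.sum_insert (hx _)]
        linarith [hmin i _ g hgA]
    · exact (hefx i (σ j) g hg).le.trans (hσ i)

/-- For every number of agents `n ≥ 1` and every finite set of `m` indivisible
goods with additive valuations (nonnegative item values), if the instance is identically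
ordered (IDO), i.e., there is an enumeration of the items along which every agent's item
values are non-increasing, then there exists a complete allocation that is EFX. -/
theorem efx_exists_ido_additive (n m : ℕ) (hn : 1 ≤ n)
    (v : Fin n → Fin m → ℝ)
    (hv : ∀ i k, 0 ≤ v i k)
    (e : Equiv.Perm (Fin m))
    (hido : ∀ i : Fin n, ∀ a b : Fin m, a ≤ b → v i (e b) ≤ v i (e a)) :
    ∃ A : Fin n → Finset (Fin m),
      (∀ i j, i ≠ j → Disjoint (A i) (A j)) ∧
      Finset.univ.biUnion A = Finset.univ ∧
      ∀ i j, ∀ g ∈ A j, (∑ k ∈ A i, v i k) ≥ ∑ k ∈ A j \ {g}, v i k := by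
  classical
  have : Nonempty (Fin n) := ⟨⟨0, hn⟩⟩
  have key : ∀ k ≤ m, ∃ A : Fin n → Finset (Fin m),
      (∀ i j, i ≠ j → Disjoint (A i) (A j)) ∧
      Finset.univ.biUnion A = Finset.univ.filter (fun y => (e.symm y : ℕ) < k) ∧
      ∀ i j, ∀ g ∈ A j, (∑ l ∈ A i, v i l) ≥ ∑ l ∈ A j \ {g}, v i l := by
    intro k
    induction k with
    | zero => exact fun _ => ⟨fun _ => ∅, by simp, by ext; simp, by simp⟩
    | succ k ih =>
      intro hk
      obtain ⟨A, hdisj, hunion, hefx⟩ := ih (by omega)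
      have hA : ∀ j, ∀ g ∈ A j, (e.symm g : ℕ) < k := fun j g hg => by
        have hmem := Finset.mem_biUnion.mpr ⟨j, Finset.mem_univ _, hg⟩
        rw [hunion] at hmem
        exact (Finset.mem_filter.mp hmem).2
      obtain ⟨B, hBdisj, hBunion, hBefx⟩ := exists_efx_insert v A (e ⟨k, hk⟩) hdisj hefx
        (fun j hj => by simpa using hA j _ hj)
        (fun i j g hg => by
          simpa using hido i (e.symm g) ⟨k, hk⟩ (Fin.le_def.mpr (hA j g hg).le))
        (fun i => hv i _)
      refine ⟨B, hBdisj, ?_, hBefx⟩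
      rw [hBunion, hunion]
      ext y
      simp only [Finset.mem_insert, Finset.mem_filter, Finset.mem_univ, true_and,
        ← Equiv.symm_apply_eq, Fin.ext_iff]
      omega
  obtain ⟨A, hdisj, hunion, hefx⟩ := key m le_rfl
  exact ⟨A, hdisj, by rw [hunion]; ext y; simp, hefx⟩
end

section
/- For every number of agents n ≥ 1 and every finite set M of m indivisible goods, if each agent i has an additive valuation given by nonnegative item values v_i(k) ≥ 0 for k ∈ M, then there exists a complete allocation A = (A_1,…,A_n) that is simultaneously EF1 (for all agents i, j, either v_i(A_i) ≥ v_i(A_j) or there exists g ∈ A_j with v_i(A_i) ≥ v_i(A_j \ {g})) and Pareto optimal (there is no other complete allocation B with v_i(B_i) ≥ v_i(A_i) for all agents i and v_i(B_i) > v_i(A_i) for at least one agent i). -/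
section NashWelfare

variable {ι κ : Type*} [DecidableEq ι] [Fintype κ]

/-- The utility of agent `i` when each good `k` is assigned to the agent `f k`. -/
def utility (v : ι → κ → ℝ) (f : κ → ι) (i : ι) : ℝ :=
  ∑ k with f k = i, v i k

lemma utility_nonneg {v : ι → κ → ℝ} (hv : ∀ i k, 0 ≤ v i k) (f : κ → ι) (i : ι) :
    0 ≤ utility v f i :=
  Finset.sum_nonneg fun k _ => hv i k

lemma utility_update [DecidableEq κ] (v : ι → κ → ℝ) (f : κ → ι) (g : κ) (i l : ι) :
    utility v (Function.update f g i) l =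
      utility v f l + (if i = l then v l g else 0) - (if f g = l then v l g else 0) := by
  simp only [utility, Finset.sum_filter]
  rw [Fintype.sum_eq_add_sum_compl g, Fintype.sum_eq_add_sum_compl g 
    (fun k => if f k = l then _ else _)]
  have : ∑ k ∈ {g}ᶜ, (if Function.update f g i k = l then v l k else 0) =
      ∑ k ∈ {g}ᶜ, (if f k = l then v l k else 0) := by
    refine Finset.sum_congr rfl fun k hk => ?_
    rw [Function.update_of_ne (by simpa using hk)]
  rw [this, Function.update_self]
  ring

variable [Fintype ι]

/-- An assignment is a Nash optimum if no assignment that keeps every positive utility positive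
makes another utility positive or increases the product of the positive utilities. -/
def IsNashOptimum (v : ι → κ → ℝ) (f : κ → ι) : Prop :=
  ∀ f', (∀ i, 0 < utility v f i → 0 < utility v f' i) →
    (∀ i, 0 < utility v f' i → 0 < utility v f i) ∧
      ∏ i with 0 < utility v f i, utility v f' i ≤ ∏ i with 0 < utility v f i, utility v f i

lemma exists_isNashOptimum [Nonempty ι] (v : ι → κ → ℝ) : ∃ f, IsNashOptimum v f := by
  obtain ⟨f, hf⟩ := Finite.exists_max fun f : κ → ι =>
    toLex ((Finset.univ.filter fun i => 0 < utility v f i).card,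
      ∏ i with 0 < utility v f i, utility v f i)
  refine ⟨f, fun f' hpos => ?_⟩
  have hsub : (Finset.univ.filter fun i => 0 < utility v f i) ⊆
      Finset.univ.filter fun i => 0 < utility v f' i := by
    intro i
    simpa using hpos i
  have hlex := Prod.Lex.toLex_le_toLex.1 (hf f')
  have hcard : (Finset.univ.filter fun i => 0 < utility v f' i).card ≤
      (Finset.univ.filter fun i => 0 < utility v f i).card := by
    rcases hlex with h | h
    exacts [h.le, h.1.le]
  have heq := Finset.eq_of_subset_of_card_le hsub hcard
  refine ⟨fun i hi => ?_, ?_⟩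
  · have : i ∈ Finset.univ.filter fun i => 0 < utility v f i := by rw [heq]; simpa using hi
    simpa using this
  · simp only [← heq, lt_irrefl, true_and, false_or] at hlex
    exact hlex

namespace IsNashOptimum

variable {v : ι → κ → ℝ} {f : κ → ι}

lemma not_paretoDominated (hf : IsNashOptimum v f) (f' : κ → ι)
    (hle : ∀ i, utility v f i ≤ utility v f' i) (hv : ∀ i k, 0 ≤ v i k) (i : ι) :
    utility v f' i ≤ utility v f i := by
  by_contra! hlt
  obtain ⟨hpos, hprod⟩ := hf f' fun i hi => hi.trans_le (hle i)
  refine hprod.not_gt (Finset.prod_lt_prod (fun j hj => by simpa using hj) (fun j _ => hle j)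
    ⟨i, ?_, hlt⟩)
  simpa using hpos i ((utility_nonneg hv f i).trans_lt hlt)

variable [DecidableEq κ]

lemma transfer_le (hf : IsNashOptimum v f) (hv : ∀ i k, 0 ≤ v i k) {i : ι} {g : κ}
    (hne : f g ≠ i) (hg : 0 < v i g) (hj : 0 < utility v f (f g)) :
    v i g * utility v f (f g) ≤ v (f g) g * (utility v f i + v i g) := by
  by_contra! hlt
  have hi0 := utility_nonneg hv f i
  have hself : utility v (Function.update f g i) i = utility v f i + v i g := by
    simp [utility_update, hne]
  have howner : utility v (Function.update f g i) (f g) = utility v f (f g) - v (f g) g := by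
    simp [utility_update, hne.symm]
  have hother : ∀ l, l ≠ i → l ≠ f g → utility v (Function.update f g i) l = utility v f l := by
    intro l h₁ h₂
    simp [utility_update, h₁.symm, h₂.symm]
  have howner_pos : 0 < utility v f (f g) - v (f g) g := by
    nlinarith [mul_nonneg (hv (f g) g) hi0]
  obtain ⟨hpos, hprod⟩ := hf (Function.update f g i) fun l hl => by
    by_cases h₁ : l = i
    · subst h₁; rw [hself]; linarith
    by_cases h₂ : l = f g
    · subst h₂; rwa [howner]
    rwa [hother l h₁ h₂]
  have hi : 0 < utility v f i := hpos i (by rw [hself]; linarith)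
  have himem : i ∈ (Finset.univ.filter fun l => 0 < utility v f l) := by simpa using hi
  have hjmem : f g ∈ (Finset.univ.filter fun l => 0 < utility v f l).erase i := by
    simpa [hne] using hj
  rw [← Finset.mul_prod_erase _ _ himem, ← Finset.mul_prod_erase _ _ hjmem,
    ← Finset.mul_prod_erase _ (utility v f) himem, ← Finset.mul_prod_erase _ (utility v f) hjmem,
    ← mul_assoc, ← mul_assoc, hself, howner] at hprod
  rw [Finset.prod_congr rfl fun l hl => hother l
    (Finset.ne_of_mem_erase (Finset.mem_of_mem_erase hl)) (Finset.ne_of_mem_erase hl)] at hprod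
  have := le_of_mul_le_mul_right hprod (Finset.prod_pos fun l hl => by
    simpa using Finset.mem_of_mem_erase (Finset.mem_of_mem_erase hl))
  nlinarith

lemma utility_pos_of_valued (hf : IsNashOptimum v f) (hv : ∀ i k, 0 ≤ v i k) {i : ι} {g : κ}
    (hne : f g ≠ i) (hg : 0 < v i g) : 0 < utility v f (f g) := by
  by_contra! hj
  have hgj : v (f g) g = 0 := le_antisymm
    ((Finset.single_le_sum (f := v (f g)) (fun k _ => hv _ k) (by simp)).trans hj) (hv _ _)
  have := hf.not_paretoDominated (Function.update f g i) (fun l => ?_) hv i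
  · simp [utility_update, hne] at this
    linarith
  · rw [utility_update]
    have : 0 ≤ if i = l then v l g else 0 := by split_ifs <;> simp [hv]
    by_cases h : f g = l
    · subst h; simp_all
    · simp [h, this]

lemma envyFreeUpToOne (hf : IsNashOptimum v f) (hv : ∀ i k, 0 ≤ v i k) (i j : ι) :
    ∑ k with f k = j, v i k ≤ utility v f i ∨
      ∃ g, f g = j ∧ ∑ k with f k = j, v i k - v i g ≤ utility v f i := by
  by_contra! h
  obtain ⟨henvy, hstrong⟩ := h
  have hij : j ≠ i := by
    rintro rfl
    exact henvy.false
  obtain ⟨g₀, hg₀, hg₀pos⟩ : ∃ g, f g = j ∧ 0 < v i g := by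
    obtain ⟨g, hg, hpos⟩ := Finset.exists_lt_of_sum_lt (s := {k | f k = j}) (f := fun _ => (0 : ℝ))
      (g := v i) (by simpa using (utility_nonneg hv f i).trans_lt henvy)
    exact ⟨g, by simpa using hg, hpos⟩
  have hj : 0 < utility v f j := hg₀ ▸ hf.utility_pos_of_valued hv (hg₀ ▸ hij) hg₀pos
  have hlt : ∀ g, f g = j → 0 < v i g →
      v i g * utility v f j < v j g * ∑ k with f k = j, v i k := by
    rintro g rfl hg
    have hle := hf.transfer_le hv hij hg hj
    have hgj : 0 < v (f g) g := by
      by_contra! hgj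
      have := le_antisymm hgj (hv _ _)
      rw [this, zero_mul] at hle
      exact hle.not_gt (mul_pos hg hj)
    refine hle.trans_lt (mul_lt_mul_of_pos_left ?_ hgj)
    linarith [hstrong g rfl]
  have hsum : ∑ g with f g = j, v i g * utility v f j <
      ∑ g with f g = j, v j g * ∑ k with f k = j, v i k := by
    refine Finset.sum_lt_sum (fun g hg => ?_) ⟨g₀, by simpa using hg₀, hlt g₀ hg₀ hg₀pos⟩
    rcases (hv i g).eq_or_lt with h0 | hpos
    · rw [← h0, zero_mul]
      exact mul_nonneg (hv _ _) (Finset.sum_nonneg fun k _ => hv _ _)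
    · exact (hlt g (by simpa using hg) hpos).le
  rw [← Finset.sum_mul, ← Finset.sum_mul, mul_comm] at hsum
  exact hsum.false

end IsNashOptimum

end NashWelfare


/-- For every number of agents `n ≥ 1` and every finite set of `m` indivisible
goods with additive valuations (nonnegative item values), there exists a complete allocation
that is simultaneously EF1 and Pareto optimal. -/
theorem ef1_po_exists_goods_additive (n m : ℕ) (hn : 1 ≤ n)
    (v : Fin n → Fin m → ℝ)
    (hv : ∀ i k, 0 ≤ v i k) :
    ∃ A : Fin n → Finset (Fin m),
      (∀ i j, i ≠ j → Disjoint (A i) (A j)) ∧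
      Finset.univ.biUnion A = Finset.univ ∧
      (∀ i j, (∑ k ∈ A i, v i k) ≥ (∑ k ∈ A j, v i k) ∨
        ∃ g ∈ A j, (∑ k ∈ A i, v i k) ≥ ∑ k ∈ A j \ {g}, v i k) ∧
      ¬ ∃ B : Fin n → Finset (Fin m),
        (∀ i j, i ≠ j → Disjoint (B i) (B j)) ∧
        Finset.univ.biUnion B = Finset.univ ∧
        (∀ i, (∑ k ∈ A i, v i k) ≤ ∑ k ∈ B i, v i k) ∧
        (∃ i, (∑ k ∈ A i, v i k) < ∑ k ∈ B i, v i k) := by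
  have : Nonempty (Fin n) := ⟨⟨0, hn⟩⟩
  obtain ⟨f, hf⟩ := exists_isNashOptimum v
  refine ⟨fun i => {k | f k = i}, fun i j hij => ?_, ?_, fun i j => ?_, ?_⟩
  · rw [Finset.disjoint_left]
    intro k hi hj
    simp only [Finset.mem_filter, Finset.mem_univ, true_and] at hi hj
    exact hij (hi.symm.trans hj)
  · ext k
    simp
  · refine (hf.envyFreeUpToOne hv i j).imp id ?_
    rintro ⟨g, hg, hle⟩
    have hmem : g ∈ ({k | f k = j} : Finset (Fin m)) := by simpa using hg
    refine ⟨g, hmem, ?_⟩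
    rw [Finset.sdiff_singleton_eq_erase, Finset.sum_erase_eq_sub hmem]
    exact hle
  · rintro ⟨B, hdisj, hcover, hle, i, hlt⟩
    have hex : ∀ k, ∃ i, k ∈ B i := fun k => by
      have : k ∈ Finset.univ.biUnion B := hcover ▸ Finset.mem_univ k
      simpa using this
    choose b hb using hex
    have hB : ∀ i, B i = Finset.univ.filter fun k => b k = i := by
      intro i
      ext k
      simp only [Finset.mem_filter, Finset.mem_univ, true_and]
      refine ⟨fun hk => ?_, fun hk => hk ▸ hb k⟩
      by_contra hne
      exact Finset.disjoint_left.1 (hdisj _ _ hne) (hb k) hk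
    simp only [hB] at hle hlt
    exact (hf.not_paretoDominated b hle hv i).not_gt hlt
end

section
/- For every number of agents n ≥ 1 and every finite set M of m indivisible goods, if each agent i has a monotone valuation v_i : 2^M → ℝ with v_i(∅) = 0 and v_i(S) ≤ v_i(T) whenever S ⊆ T, then there exists a partial allocation A = (A_1,…,A_n) of pairwise disjoint bundles A_i ⊆ M with unallocated pool C = M \ (A_1 ∪ … ∪ A_n) such that: (i) |C| ≤ n − 1; (ii) A is EFX, i.e., for all agents i, j and every good g ∈ A_j, v_i(A_i) ≥ v_i(A_j \ {g}); and (iii) no agent envies the pool, i.e., v_i(A_i) ≥ v_i(C) for every agent i. -/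
/-- The pool of items that no bundle of `A` contains. -/
def unallocatedPool {n m : ℕ} (A : Fin n → Finset (Fin m)) : Finset (Fin m) :=
  (Finset.univ : Finset (Fin m)) \ Finset.univ.biUnion A

/-- A family of pairwise disjoint bundles that is envy-free up to any good. -/
def IsEFXAllocation {n m : ℕ} (v : Fin n → Finset (Fin m) → ℝ)
    (A : Fin n → Finset (Fin m)) : Prop :=
  (∀ i j, i ≠ j → Disjoint (A i) (A j)) ∧ ∀ i j, ∀ g ∈ A j, v i (A j \ {g}) ≤ v i (A i)

theorem not_mem_of_mem_unallocatedPool {n m : ℕ} {A : Fin n → Finset (Fin m)} {g : Fin m}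
    (hg : g ∈ unallocatedPool A) (i : Fin n) : g ∉ A i := by
  simp only [unallocatedPool, Finset.mem_sdiff, Finset.mem_univ, Finset.mem_biUnion, true_and,
    not_exists] at hg
  exact hg i

/-- An envied set contains an envied set none of whose proper subsets is envied. -/
theorem exists_minimal_envied {n m : ℕ} (v : Fin n → Finset (Fin m) → ℝ)
    (A : Fin n → Finset (Fin m)) {W : Finset (Fin m)} (hW : ∃ i, v i (A i) < v i W) :
    ∃ Z ⊆ W, (∃ j, v j (A j) < v j Z) ∧ ∀ k, ∀ g ∈ Z, v k (Z \ {g}) ≤ v k (A k) := by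
  induction W using Finset.strongInduction with
  | H W ih =>
    by_cases h : ∀ k, ∀ g ∈ W, v k (W \ {g}) ≤ v k (A k)
    · exact ⟨W, subset_rfl, hW, h⟩
    · push Not at h
      obtain ⟨k, g, hg, hk⟩ := h
      have hss : W \ {g} ⊂ W := Finset.sdiff_ssubset (by simpa using hg) (by simp)
      obtain ⟨Z, hZ, h⟩ := ih _ hss ⟨k, hk⟩
      exact ⟨Z, hZ.trans hss.subset, h⟩

/-- Every self-map of a nonempty finite type permutes some nonempty set; `q` is the inverse of
the map on that set. -/
theorem exists_rightInverse_on_invariant_finset {α : Type*} [Fintype α] [DecidableEq α]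
    [Nonempty α] (p : α → α) :
    ∃ S : Finset α, S.Nonempty ∧ ∃ q : α → α, ∀ j ∈ S, q j ∈ S ∧ p (q j) = j := by
  have hne : ((Finset.univ : Finset (Finset α)).filter
      fun S => S.Nonempty ∧ S.image p ⊆ S).Nonempty :=
    ⟨Finset.univ, by simp⟩
  obtain ⟨S, hS, hmin⟩ := Finset.exists_min_image _ Finset.card hne
  simp only [Finset.mem_filter, Finset.mem_univ, true_and] at hS hmin
  have himage : S.image p = S := Finset.eq_of_subset_of_card_le hS.2
    (hmin _ ⟨hS.1.image p, Finset.image_subset_image hS.2⟩)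
  have hsurj : ∀ j, ∃ i, j ∈ S → i ∈ S ∧ p i = j := by
    intro j
    by_cases hj : j ∈ S
    · rw [← himage, Finset.mem_image] at hj
      obtain ⟨i, hi⟩ := hj
      exact ⟨i, fun _ => hi⟩
    · exact ⟨j, fun h => absurd h hj⟩
  choose q hq using hsurj
  exact ⟨S, hS.1, q, hq⟩

/-- An EFX allocation of maximal welfare and, subject to that, allocating as many items as
possible. -/
theorem exists_optimal_efx {n m : ℕ} (v : Fin n → Finset (Fin m) → ℝ) :
    ∃ A, IsEFXAllocation v A ∧ ∀ B, IsEFXAllocation v B → (∀ i, v i (A i) ≤ v i (B i)) →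
      (∀ i, v i (B i) ≤ v i (A i)) ∧ ∑ i, (B i).card ≤ ∑ i, (A i).card := by
  classical
  have hne : ((Finset.univ : Finset (Fin n → Finset (Fin m))).filter
      (IsEFXAllocation v)).Nonempty :=
    ⟨fun _ => ∅, by simp [IsEFXAllocation]⟩
  obtain ⟨A, hA, hmax⟩ := Finset.exists_max_image _
    (fun A => toLex (∑ i, v i (A i), ∑ i, (A i).card)) hne
  simp only [Finset.mem_filter, Finset.mem_univ, true_and] at hA hmax
  refine ⟨A, hA, fun B hB hAB => ?_⟩
  have hle := Prod.Lex.toLex_le_toLex.mp (hmax B hB)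
  have hsum : ∑ i, v i (A i) ≤ ∑ i, v i (B i) := Finset.sum_le_sum fun i _ => hAB i
  rcases hle with hlt | ⟨heq, hcard⟩
  · exact absurd hlt (not_lt.mpr hsum)
  · refine ⟨fun i => ?_, hcard⟩
    exact ((Finset.sum_eq_sum_iff_of_le fun i _ => hAB i).mp heq.symm i (Finset.mem_univ i)).ge

/-- Replacing bundles by sets of which no proper subset was envied preserves EFX, provided that
no agent loses. -/
theorem IsEFXAllocation.update {n m : ℕ} {v : Fin n → Finset (Fin m) → ℝ}
    {A B : Fin n → Finset (Fin m)} (hdisj : ∀ i j, i ≠ j → Disjoint (B i) (B j))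
    (hle : ∀ i, v i (A i) ≤ v i (B i))
    (hB : ∀ j k, ∀ g ∈ B j, v k (B j \ {g}) ≤ v k (A k)) : IsEFXAllocation v B :=
  ⟨hdisj, fun i j g hg => (hB j i g hg).trans (hle i)⟩

theorem efx_with_charity_exists (n m : ℕ) (hn : 1 ≤ n)
    (v : Fin n → Finset (Fin m) → ℝ)
    (hv0 : ∀ i, v i ∅ = 0)
    (hmono : ∀ i (S T : Finset (Fin m)), S ⊆ T → v i S ≤ v i T) :
    ∃ A : Fin n → Finset (Fin m),
      (∀ i j, i ≠ j → Disjoint (A i) (A j)) ∧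
      ((Finset.univ : Finset (Fin m)) \ Finset.univ.biUnion A).card ≤ n - 1 ∧
      (∀ i j, ∀ g ∈ A j, v i (A i) ≥ v i (A j \ {g})) ∧
      (∀ i, v i (A i) ≥ v i ((Finset.univ : Finset (Fin m)) \ Finset.univ.biUnion A)) := by
  obtain ⟨A, hA, hopt⟩ := exists_optimal_efx v
  refine ⟨A, hA.1, ?_, hA.2, ?_⟩
  · change (unallocatedPool A).card ≤ n - 1
    by_contra! hcard
    -- By optimality no pool item can simply be handed over, so each `A i ∪ {g}` is envied.
    have henvied : ∀ i, ∀ g ∈ unallocatedPool A, ∃ k, v k (A k) < v k (insert g (A i)) := by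
      intro i g hg
      by_contra! hno
      have hgA := not_mem_of_mem_unallocatedPool hg
      have hle : ∀ k, v k (A k) ≤ v k (Function.update A i (insert g (A i)) k) := by
        intro k
        by_cases hk : k = i
        · subst hk
          simpa using hmono k _ _ (Finset.subset_insert g (A k))
        · simp [hk]
      have hEFX : IsEFXAllocation v (Function.update A i (insert g (A i))) := by
        refine IsEFXAllocation.update (A := A) ?_ hle ?_
        · intro j k hjk
          by_cases hj : j = i <;> by_cases hk : k = i
          · exact absurd (hj.trans hk.symm) hjk
          · subst hj
            simpa [hk, Finset.disjoint_insert_left, hgA] using hA.1 _ _ hjk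
          · subst hk
            simpa [hj, Finset.disjoint_insert_right, hgA] using hA.1 _ _ hjk
          · simpa [hj, hk] using hA.1 _ _ hjk
        · intro j k x hx
          by_cases hj : j = i
          · subst hj
            simp only [Function.update_self]
            exact (hmono k _ _ Finset.sdiff_subset).trans (hno k)
          · rw [Function.update_of_ne hj] at hx ⊢
            exact hA.2 k j x hx
      refine absurd (hopt _ hEFX hle).2 (not_le.mpr ?_)
      refine Finset.sum_lt_sum (fun k _ => ?_) ⟨i, Finset.mem_univ i, ?_⟩
      · by_cases hk : k = i
        · subst hk
          simp [hgA]
        · simp [hk]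
      · simp [hgA]
    have hcard' : Fintype.card (Fin n) ≤ Fintype.card (unallocatedPool A) := by
      simp only [Fintype.card_fin, Fintype.card_coe]
      omega
    obtain ⟨e⟩ := Function.Embedding.nonempty_of_card_le hcard'
    choose Z hZsub hZ hZmin using fun i =>
      exists_minimal_envied v A (henvied i (e i) (e i).2)
    choose p hp using hZ
    have : Nonempty (Fin n) := ⟨⟨0, hn⟩⟩
    obtain ⟨S, ⟨s, hs⟩, q, hq⟩ := exists_rightInverse_on_invariant_finset p
    have hgain : ∀ j ∈ S, v j (A j) < v j (Z (q j)) := fun j hj => by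
      simpa only [(hq j hj).2] using hp (q j)
    have hZA : ∀ i k, i ≠ k → Disjoint (Z i) (A k) := fun i k hik =>
      Finset.disjoint_of_subset_left (hZsub i) (Finset.disjoint_insert_left.mpr
        ⟨not_mem_of_mem_unallocatedPool (e i).2 k, hA.1 i k hik⟩)
    have hZZ : ∀ i k, i ≠ k → Disjoint (Z i) (Z k) := fun i k hik => by
      refine Finset.disjoint_of_subset_right (hZsub k)
        (Finset.disjoint_insert_right.mpr ⟨fun h => ?_, hZA i k hik⟩)
      rcases Finset.mem_insert.mp (hZsub i h) with h | h
      · exact hik (e.injective (Subtype.ext h.symm))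
      · exact not_mem_of_mem_unallocatedPool (e k).2 i h
    have hle : ∀ k, v k (A k) ≤ v k (if k ∈ S then Z (q k) else A k) := by
      intro k
      split_ifs with hk
      · exact (hgain k hk).le
      · exact le_rfl
    have hEFX : IsEFXAllocation v (fun k => if k ∈ S then Z (q k) else A k) := by
      refine IsEFXAllocation.update (A := A) ?_ hle ?_
      · intro j k hjk
        split_ifs with hj hk hk
        · refine hZZ _ _ fun h => hjk ?_
          rw [← (hq j hj).2, ← (hq k hk).2, h]
        · exact hZA _ _ fun h => hk (h ▸ (hq j hj).1)
        · exact (hZA (q k) j fun h => hj (h ▸ (hq k hk).1)).symm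
        · exact hA.1 j k hjk
      · intro j k x hx
        split_ifs at hx ⊢ with hj
        · exact hZmin _ k x hx
        · exact hA.2 k j x hx
    have hback := (hopt _ hEFX hle).1 s
    simp only [hs, if_true] at hback
    exact absurd (hgain s hs) (not_lt.mpr hback)
  · change ∀ i, v i (unallocatedPool A) ≤ v i (A i)
    by_contra! henv
    obtain ⟨Z, hZsub, ⟨j, hj⟩, hZmin⟩ := exists_minimal_envied v A henv
    have hZA : ∀ k, Disjoint Z (A k) := fun k => Finset.disjoint_left.mpr fun _ hx =>
      not_mem_of_mem_unallocatedPool (hZsub hx) k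
    have hle : ∀ k, v k (A k) ≤ v k (Function.update A j Z k) := by
      intro k
      by_cases hk : k = j
      · subst hk
        simpa using hj.le
      · simp [hk]
    have hEFX : IsEFXAllocation v (Function.update A j Z) := by
      refine IsEFXAllocation.update (A := A) ?_ hle ?_
      · intro i k hik
        by_cases hi : i = j <;> by_cases hk : k = j
        · exact absurd (hi.trans hk.symm) hik
        · subst hi
          simpa [hk] using hZA k
        · subst hk
          simpa [hi] using (hZA i).symm
        · simpa [hi, hk] using hA.1 _ _ hik
      · intro i k x hx
        by_cases hi : i = j
        · subst hi
          simp only [Function.update_self] at hx ⊢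
          exact hZmin k x hx
        · rw [Function.update_of_ne hi] at hx ⊢
          exact hA.2 k i x hx
    have hback := (hopt _ hEFX hle).1 j
    rw [Function.update_self] at hback
    exact absurd hj (not_lt.mpr hback)
end

section
/- For every number of agents n ≥ 1 and every sequence of m indivisible goods arranged on a path (items indexed 1,…,m), if each agent i has an additive valuation with nonnegative item values v_i(k) ≥ 0, then there exists a complete allocation A = (A_1,…,A_n) in which every bundle A_i is a contiguous interval {a_i, a_i+1, …, b_i} of item indices (or empty) and which is PROP1: for every agent i, either v_i(A_i) ≥ v_i(M)/n, or there exists an item g ∉ A_i with v_i(A_i) + v_i(g) ≥ v_i(M)/n. -/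
/-- Discrete moving knife: the positions `p, …, m` are cut into consecutive segments, one for each
agent in `S`, such that every agent reaches its threshold `t i` (measured by the cumulative value
`F i`), possibly after extending its segment by one position to the right. -/
theorem exists_consecutive_segments {ι : Type*} (m : ℕ) (F : ι → ℕ → ℝ) (t : ι → ℝ)
    (ht : ∀ i, 0 ≤ t i) (s : ℕ) (S : Finset ι) (p : ℕ) (hS : S.card = s + 1) (hp : p ≤ m)
    (hF : ∀ i ∈ S, (s + 1) * t i ≤ F i m - F i p) :
    ∃ l r : ι → ℕ,
      (∀ i ∈ S, p ≤ l i ∧ l i ≤ r i ∧ r i ≤ m) ∧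
      (∀ i ∈ S, ∀ j ∈ S, i ≠ j → r i ≤ l j ∨ r j ≤ l i) ∧
      (∀ k, p ≤ k → k < m → ∃ i ∈ S, l i ≤ k ∧ k < r i) ∧
      (∀ i ∈ S, t i ≤ F i (r i) - F i (l i) ∨
        r i < m ∧ t i ≤ F i (r i + 1) - F i (l i)) := by
  classical
  induction s generalizing S p with
  | zero =>
    obtain ⟨i, rfl⟩ := Finset.card_eq_one.mp hS
    refine ⟨fun _ => p, fun _ => m, by simp [hp], by simp, by simp +contextual, ?_⟩
    intro j hj
    have := hF j hj
    left
    simpa using this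
  | succ s ih =>
    let P : ℕ → Prop := fun q => p ≤ q ∧ ∃ i ∈ S, t i ≤ F i q - F i p ∨
      q < m ∧ t i ≤ F i (q + 1) - F i p
    have hPm : P m := by
      obtain ⟨i, hi⟩ : S.Nonempty := Finset.card_pos.mp (by omega)
      refine ⟨hp, i, hi, Or.inl ?_⟩
      have h1 := hF i hi
      have h2 : 0 ≤ ((s : ℝ) + 1) * t i := mul_nonneg (by positivity) (ht i)
      push_cast at h1
      linarith
    have hP : ∃ q, P q := ⟨m, hPm⟩
    obtain ⟨q, ⟨hpq, i, hi, hiq⟩, hmin⟩ : ∃ q, P q ∧ ∀ k < q, ¬ P k :=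
      ⟨Nat.find hP, Nat.find_spec hP, fun k hk => Nat.find_min hP hk⟩
    have hqm : q ≤ m := by
      by_contra h
      exact hmin m (by omega) hPm
    have hle : ∀ j ∈ S, F j q - F j p ≤ t j := by
      intro j hj
      rcases hpq.eq_or_lt with rfl | h
      · simpa using ht j
      · obtain ⟨k, rfl⟩ : ∃ k, q = k + 1 := ⟨q - 1, by omega⟩
        by_contra! hlt
        exact hmin k (by omega) ⟨by omega, j, hj, Or.inr ⟨by omega, hlt.le⟩⟩
    obtain ⟨l, r, hlr, hdisj, hcov, hval⟩ := ih (S.erase i) q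
      (by rw [Finset.card_erase_of_mem hi]; omega) hqm (by
        intro j hj
        have hj := Finset.mem_of_mem_erase hj
        have h1 := hF j hj
        have h2 := hle j hj
        push_cast at h1
        linarith)
    refine ⟨Function.update l i p, Function.update r i q, ?_, ?_, ?_, ?_⟩
    · intro j hj
      by_cases h : j = i
      · subst h; simp [hpq, hqm]
      · have := hlr j (Finset.mem_erase.mpr ⟨h, hj⟩)
        simp only [Function.update_of_ne h]
        omega
    · intro j hj k hk hjk
      by_cases h : j = i
      · subst h
        have := hlr k (Finset.mem_erase.mpr ⟨hjk.symm, hk⟩)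
        simp only [Function.update_self, Function.update_of_ne hjk.symm]
        omega
      · by_cases h' : k = i
        · subst h'
          have := hlr j (Finset.mem_erase.mpr ⟨h, hj⟩)
          simp only [Function.update_self, Function.update_of_ne h]
          omega
        · simp only [Function.update_of_ne h, Function.update_of_ne h']
          exact hdisj j (Finset.mem_erase.mpr ⟨h, hj⟩) k (Finset.mem_erase.mpr ⟨h', hk⟩) hjk
    · intro k hpk hkm
      by_cases hkq : k < q
      · exact ⟨i, hi, by simp [hpk, hkq]⟩
      · obtain ⟨j, hj, hjk⟩ := hcov k (by omega) hkm
        have h := Finset.ne_of_mem_erase hj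
        exact ⟨j, Finset.mem_of_mem_erase hj, by simpa only [Function.update_of_ne h] using hjk⟩
    · intro j hj
      by_cases h : j = i
      · subst h; simpa using hiq
      · simp only [Function.update_of_ne h]
        exact hval j (Finset.mem_erase.mpr ⟨h, hj⟩)

/-- The value of a segment is a difference of cumulative values. -/
theorem sum_filter_segment {m : ℕ} (f : Fin m → ℝ) {a b : ℕ} (hab : a ≤ b) :
    ∑ k : Fin m with a ≤ k.val ∧ k.val < b, f k =
      (∑ k : Fin m with k.val < b, f k) - ∑ k : Fin m with k.val < a, f k := by
  rw [eq_sub_iff_add_eq, ← Finset.sum_union (by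
    rw [Finset.disjoint_filter]; intros; omega)]
  refine Finset.sum_congr ?_ fun _ _ => rfl
  ext k
  simp only [Finset.mem_union, Finset.mem_filter, Finset.mem_univ, true_and]
  omega


/-- For every number of agents `n ≥ 1` and every sequence of `m` indivisible
goods arranged on a path, with additive valuations (nonnegative item values), there exists a
complete allocation in which every bundle is a contiguous interval of item indices (or empty)
and which is PROP1. -/
theorem connected_prop1_exists_goods (n m : ℕ) (hn : 1 ≤ n)
    (v : Fin n → Fin m → ℝ)
    (hv : ∀ i k, 0 ≤ v i k) :
    ∃ A : Fin n → Finset (Fin m),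
      (∀ i j, i ≠ j → Disjoint (A i) (A j)) ∧
      Finset.univ.biUnion A = Finset.univ ∧
      (∀ i, A i = ∅ ∨ ∃ a b : Fin m, A i = Finset.Icc a b) ∧
      (∀ i, (∑ k ∈ A i, v i k) ≥ (∑ k, v i k) / (n : ℝ) ∨
        ∃ g, g ∉ A i ∧ (∑ k ∈ A i, v i k) + v i g ≥ (∑ k, v i k) / (n : ℝ)) := by
  have hn0 : (0 : ℝ) < n := by exact_mod_cast hn
  obtain ⟨l, r, hlr, hdisj, hcov, hval⟩ := exists_consecutive_segments m
    (fun i b => ∑ k : Fin m with k.val < b, v i k) (fun i => (∑ k, v i k) / n)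
    (fun i => div_nonneg (Finset.sum_nonneg fun k _ => hv i k) hn0.le) (n - 1) Finset.univ 0
    (by simp; omega) (Nat.zero_le m) (by
      intro i _
      have hcast : ((n - 1 : ℕ) : ℝ) + 1 = n := by exact_mod_cast Nat.sub_add_cancel hn
      rw [hcast, mul_div_cancel₀ _ hn0.ne']
      simp)
  refine ⟨fun i => {k : Fin m | l i ≤ k.val ∧ k.val < r i}, ?_, ?_, ?_, ?_⟩
  · intro i j hij
    have := hdisj i (Finset.mem_univ i) j (Finset.mem_univ j) hij
    rw [Finset.disjoint_filter]
    intros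
    omega
  · ext k
    obtain ⟨i, -, hi⟩ := hcov k (Nat.zero_le _) k.isLt
    simpa using ⟨i, hi⟩
  · intro i
    obtain ⟨-, hle, hrm⟩ := hlr i (Finset.mem_univ i)
    rcases hle.eq_or_lt with h | h
    · left
      ext k
      simp
      omega
    · right
      refine ⟨⟨l i, by omega⟩, ⟨r i - 1, by omega⟩, ?_⟩
      ext k
      simp only [Finset.mem_filter, Finset.mem_univ, true_and, Finset.mem_Icc, Fin.le_def]
      omega
  · intro i
    obtain ⟨-, hle, -⟩ := hlr i (Finset.mem_univ i)
    rcases hval i (Finset.mem_univ i) with h | ⟨hr, h⟩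
    · left
      rwa [sum_filter_segment _ hle]
    · right
      refine ⟨⟨r i, hr⟩, by simp, ?_⟩
      rw [← sum_filter_segment _ (by omega)] at h
      rw [add_comm, ← Finset.sum_insert (by simp)]
      refine h.trans_eq (Finset.sum_congr ?_ fun _ _ => rfl)
      ext k
      simp only [Finset.mem_filter, Finset.mem_univ, true_and, Finset.mem_insert, Fin.ext_iff]
      omega
end

section
/- For every number of agents n ≥ 1 and every finite set M of m indivisible goods, if each agent i has an additive valuation with nonnegative item values v_i(k) ≥ 0, then there exists a complete allocation A = (A_1,…,A_n) that is PROPm: for every agent i, v_i(A_i) + d_i(A) ≥ v_i(M)/n, where d_i(A) = max over all agents j ≠ i with A_j ≠ ∅ of (min_{g ∈ A_j} v_i(g)), with d_i(A) = 0 if all bundles A_j with j ≠ i are empty. -/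
/-- The minimum value of an item in a bundle `S` according to item values `v`
(junk value `0` if the bundle is empty). -/
noncomputable def minItemVal {m : ℕ} (v : Fin m → ℝ) (S : Finset (Fin m)) : ℝ :=
  if h : S.Nonempty then S.inf' h v else 0

/-- The maximin item value `d_i(A)` of agent `i` in allocation `A`: the maximum, over all
other agents `j ≠ i` with nonempty bundles, of the least item value (to `i`) in `A j`;
`0` if every other bundle is empty. -/
noncomputable def maximinItemVal {n m : ℕ} (v : Fin n → Fin m → ℝ)
    (A : Fin n → Finset (Fin m)) (i : Fin n) : ℝ :=
  if h : (Finset.univ.filter fun j => j ≠ i ∧ (A j).Nonempty).Nonempty then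
    (Finset.univ.filter fun j => j ≠ i ∧ (A j).Nonempty).sup' h
      (fun j => minItemVal (v i) (A j))
  else 0

theorem minItemVal_nonneg {m : ℕ} {v : Fin m → ℝ} (hv : ∀ k, 0 ≤ v k) (S : Finset (Fin m)) :
    0 ≤ minItemVal v S := by
  unfold minItemVal
  split_ifs with h
  · exact (Finset.le_inf'_iff h v).2 fun k _ => hv k
  · exact le_rfl

theorem exists_mem_eq_minItemVal {m : ℕ} (v : Fin m → ℝ) {S : Finset (Fin m)}
    (hS : S.Nonempty) : ∃ g ∈ S, v g = minItemVal v S := by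
  obtain ⟨g, hg, h⟩ := Finset.exists_mem_eq_inf' hS v
  exact ⟨g, hg, by rw [minItemVal, dif_pos hS, h]⟩

theorem maximinItemVal_nonneg {n m : ℕ} {v : Fin n → Fin m → ℝ} (hv : ∀ i k, 0 ≤ v i k)
    (A : Fin n → Finset (Fin m)) (i : Fin n) : 0 ≤ maximinItemVal v A i := by
  unfold maximinItemVal
  split_ifs with h
  · obtain ⟨j, hj⟩ := h
    exact (minItemVal_nonneg (hv i) (A j)).trans
      (Finset.le_sup' (fun j => minItemVal (v i) (A j)) hj)
  · exact le_rfl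

theorem minItemVal_le_maximinItemVal {n m : ℕ} {v : Fin n → Fin m → ℝ} (hv : ∀ i k, 0 ≤ v i k)
    (A : Fin n → Finset (Fin m)) {i j : Fin n} (hij : j ≠ i) :
    minItemVal (v i) (A j) ≤ maximinItemVal v A i := by
  by_cases hA : (A j).Nonempty
  · have hj : j ∈ Finset.univ.filter fun j => j ≠ i ∧ (A j).Nonempty := by simp [hij, hA]
    rw [maximinItemVal, dif_pos ⟨j, hj⟩]
    exact Finset.le_sup' (fun j => minItemVal (v i) (A j)) hj
  · rw [minItemVal, dif_neg hA]
    exact maximinItemVal_nonneg hv A i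

/-- Diminishing step: hand out an inclusion-minimal bundle that, together with the current
slack `d i`, reaches the threshold `τ i` of some agent `i`. -/
theorem exists_minimal_acceptable_bundle {ι : Type*} {m : ℕ} (v : ι → Fin m → ℝ)
    {G : Finset ι} {R : Finset (Fin m)} {d τ : ι → ℝ} {i₀ : ι} (hi₀ : i₀ ∈ G)
    (h₀ : τ i₀ ≤ ∑ k ∈ R, v i₀ k + d i₀) :
    ∃ B ⊆ R, (∃ i ∈ G, τ i ≤ ∑ k ∈ B, v i k + d i) ∧
      (B.Nonempty → ∀ j ∈ G, ∑ k ∈ B, v j k < τ j - d j + minItemVal (v j) B) := by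
  obtain ⟨B, hBR, hB⟩ := exists_minimal_le_of_wellFoundedLT
    (fun B : Finset (Fin m) => ∃ i ∈ G, τ i ≤ ∑ k ∈ B, v i k + d i) R ⟨i₀, hi₀, h₀⟩
  refine ⟨B, hBR, hB.prop, fun hne j hj => ?_⟩
  obtain ⟨g, hg, hmin⟩ := exists_mem_eq_minItemVal (v j) hne
  have hlt : ¬ ∃ i ∈ G, τ i ≤ ∑ k ∈ B.erase g, v i k + d i :=
    hB.not_prop_of_lt (Finset.erase_ssubset hg)
  push Not at hlt
  have hsum := Finset.add_sum_erase B (v j) hg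
  linarith [hlt j hj]

/-- A division of the items `R` among the agents `G`, where agent `i` starts with a slack
`d i`, which in the recursion comes from the bundles already handed out. -/
theorem exists_division_with_slack {ι : Type*} [DecidableEq ι] {m : ℕ} {v : ι → Fin m → ℝ}
    {τ : ι → ℝ} (hτ : ∀ i, 0 ≤ τ i) (G : Finset ι) :
    ∀ (R : Finset (Fin m)) (d : ι → ℝ), G.Nonempty →
      (∀ i ∈ G, G.card * τ i ≤ ∑ k ∈ R, v i k + d i) →
      ∃ A : ι → Finset (Fin m),
        (∀ i ∈ G, ∀ j ∈ G, i ≠ j → Disjoint (A i) (A j)) ∧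
        G.biUnion A = R ∧
        ∀ i ∈ G, τ i ≤ ∑ k ∈ A i, v i k + d i ∨
          ∃ j ∈ G, j ≠ i ∧ τ i ≤ ∑ k ∈ A i, v i k + minItemVal (v i) (A j) := by
  induction G using Finset.strongInduction with
  | H G ih =>
    intro R d hG hR
    obtain ⟨i₀, hi₀⟩ := hG
    have h₀ : τ i₀ ≤ ∑ k ∈ R, v i₀ k + d i₀ := by
      have hcard : (1 : ℝ) ≤ G.card := by exact_mod_cast Finset.card_pos.2 ⟨i₀, hi₀⟩
      nlinarith [hR i₀ hi₀, hτ i₀]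
    obtain ⟨B, hBR, ⟨i, hi, hBi⟩, hBlt⟩ := exists_minimal_acceptable_bundle v hi₀ h₀
    rcases (G.erase i).eq_empty_or_nonempty with hE | hE
    · have hGi : G = {i} := by
        rw [← Finset.insert_erase hi, hE]
        rfl
      subst hGi
      refine ⟨fun _ => R, by simp, by simp, fun j hj => Or.inl ?_⟩
      simpa using hR j hj
    have hslack : ∀ j ∈ G.erase i, ((G.erase i).card : ℝ) * τ j ≤
        ∑ k ∈ R \ B, v j k + max (d j) (minItemVal (v j) B) := by
      intro j hj
      have hjG := Finset.mem_of_mem_erase hj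
      have hcard : ((G.erase i).card : ℝ) + 1 = G.card := by
        exact_mod_cast Finset.card_erase_add_one hi
      have hmul : ((G.erase i).card : ℝ) * τ j + τ j = G.card * τ j := by rw [← hcard]; ring
      have hsum := Finset.sum_sdiff (f := v j) hBR
      have hRj := hR j hjG
      rcases B.eq_empty_or_nonempty with rfl | hne
      · have := le_max_left (d j) (minItemVal (v j) ∅)
        simp only [Finset.sum_empty] at hsum
        linarith [hτ j]
      · have := le_max_right (d j) (minItemVal (v j) B)
        linarith [hBlt hne j hjG]
    obtain ⟨A, hdisj, hunion, hA⟩ := ih (G.erase i) (Finset.erase_ssubset hi) (R \ B)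
      (fun j => max (d j) (minItemVal (v j) B)) hE hslack
    have hAB : ∀ j ∈ G, j ≠ i → Disjoint (A j) B := fun j hj hji =>
      Finset.sdiff_disjoint.mono_left
        (hunion ▸ Finset.subset_biUnion_of_mem A (Finset.mem_erase.2 ⟨hji, hj⟩))
    refine ⟨Function.update A i B, fun j hj k hk hjk => ?_, ?_, fun j hj => ?_⟩
    · rcases eq_or_ne j i with rfl | hji
      · simpa [Function.update_of_ne hjk.symm] using (hAB k hk hjk.symm).symm
      · rcases eq_or_ne k i with rfl | hki
        · simpa [Function.update_of_ne hji] using hAB j hj hji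
        · simpa [Function.update_of_ne hji, Function.update_of_ne hki] using
            hdisj j (Finset.mem_erase.2 ⟨hji, hj⟩) k (Finset.mem_erase.2 ⟨hki, hk⟩) hjk
    · have hrest : (G.erase i).biUnion (Function.update A i B) = (G.erase i).biUnion A :=
        Finset.biUnion_congr rfl fun j hj => Function.update_of_ne (Finset.ne_of_mem_erase hj) _ _
      rw [← Finset.insert_erase hi, Finset.biUnion_insert, hrest, hunion, Function.update_self,
        Finset.union_sdiff_of_subset hBR]
    · rcases eq_or_ne j i with rfl | hji
      · left
        simpa using hBi
      · rw [Function.update_of_ne hji]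
        rcases hA j (Finset.mem_erase.2 ⟨hji, hj⟩) with h | ⟨k, hk, hkj, h⟩
        · rcases max_choice (d j) (minItemVal (v j) B) with hm | hm
          · exact Or.inl (by simpa only [hm] using h)
          · exact Or.inr ⟨i, hi, hji.symm, by simpa only [Function.update_self, hm] using h⟩
        · exact Or.inr ⟨k, Finset.mem_of_mem_erase hk, hkj, by
            rwa [Function.update_of_ne (Finset.ne_of_mem_erase hk)]⟩

/-- For every number of agents `n ≥ 1` and every finite set of `m` indivisible
goods with additive valuations (nonnegative item values), there exists a complete allocation
that is PROPm: `v_i(A_i) + d_i(A) ≥ v_i(M)/n` for every agent `i`. -/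
theorem propm_exists_goods (n m : ℕ) (hn : 1 ≤ n)
    (v : Fin n → Fin m → ℝ)
    (hv : ∀ i k, 0 ≤ v i k) :
    ∃ A : Fin n → Finset (Fin m),
      (∀ i j, i ≠ j → Disjoint (A i) (A j)) ∧
      Finset.univ.biUnion A = Finset.univ ∧
      ∀ i, (∑ k ∈ A i, v i k) + maximinItemVal v A i ≥ (∑ k, v i k) / (n : ℝ) := by
  have hn' : (0 : ℝ) < n := by exact_mod_cast hn
  obtain ⟨A, hdisj, hunion, hA⟩ := exists_division_with_slack (v := v)
    (τ := fun i => (∑ k, v i k) / (n : ℝ))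
    (fun i => div_nonneg (Finset.sum_nonneg fun k _ => hv i k) hn'.le)
    Finset.univ Finset.univ (fun _ => 0) ⟨⟨0, hn⟩, Finset.mem_univ _⟩
    (fun i _ => by
      rw [Finset.card_univ, Fintype.card_fin, mul_div_cancel₀ _ hn'.ne', add_zero])
  refine ⟨A, fun i j => hdisj i (Finset.mem_univ i) j (Finset.mem_univ j), hunion, fun i => ?_⟩
  rcases hA i (Finset.mem_univ i) with h | ⟨j, -, hji, h⟩
  · linarith [maximinItemVal_nonneg hv A i]
  · linarith [minItemVal_le_maximinItemVal hv A hji]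
end

section
/- Consider n = 3 agents and m = 5 indivisible goods with identical additive valuations in which the five goods have values 3, 3, 3, 3, and 1 respectively (so v(M) = 13 for every agent). Then no complete allocation of the five goods to the three agents is PROPX: for every allocation A = (A_1, A_2, A_3) there exist an agent i and a good g ∉ A_i such that v(A_i) + v(g) < 13/3. -/
/-- The identical additive item values of the counter-example: five goods valued
`3, 3, 3, 3, 1`. -/
noncomputable def propxCounterVal : Fin 5 → ℝ := ![3, 3, 3, 3, 1]

theorem sum_propxCounterVal_of_last_notMem {S : Finset (Fin 5)} (h : 4 ∉ S) :
    ∑ k ∈ S, propxCounterVal k = 3 * S.card := by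
  rw [Finset.sum_congr rfl (g := fun _ => (3 : ℝ)), Finset.sum_const, nsmul_eq_mul, mul_comm]
  intro k hk
  fin_cases k <;> simp_all [propxCounterVal]

/-- For `n = 3` agents and `m = 5` goods with identical additive values
`3, 3, 3, 3, 1` (total `13`), no complete allocation is PROPX: for every allocation there
are an agent `i` and a good `g ∉ A_i` with `v(A_i) + v(g) < 13/3`. -/
theorem propx_nonexistence_counterexample :
    ∀ A : Fin 3 → Finset (Fin 5),
      (∀ i j, i ≠ j → Disjoint (A i) (A j)) →
      Finset.univ.biUnion A = Finset.univ →
      ∃ i : Fin 3, ∃ g : Fin 5, g ∉ A i ∧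
        (∑ k ∈ A i, propxCounterVal k) + propxCounterVal g < 13 / 3 := by
  intro A hdisj hcover
  obtain ⟨i, -, hi⟩ := Finset.mem_biUnion.1 (hcover ▸ Finset.mem_univ (4 : Fin 5))
  by_cases h : ∃ j, j ≠ i ∧ (A j).card ≤ 1
  · obtain ⟨j, hji, hj⟩ := h
    have hmem : 4 ∉ A j := fun h4 => Finset.disjoint_left.1 (hdisj j i hji) h4 hi
    refine ⟨j, 4, hmem, ?_⟩
    have hcard : ((A j).card : ℝ) ≤ 1 := by exact_mod_cast hj
    have hval : propxCounterVal 4 = 1 := rfl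
    rw [sum_propxCounterVal_of_last_notMem hmem, hval]
    linarith
  · push Not at h
    have htotal : ∑ j, (A j).card = 5 := by
      rw [← Finset.card_biUnion fun j _ k _ hjk => hdisj j k hjk, hcover]
      rfl
    have hcard : (A i).card ≤ 1 := by
      have hothers : ∑ j ∈ Finset.univ.erase i, 2 ≤ ∑ j ∈ Finset.univ.erase i, (A j).card :=
        Finset.sum_le_sum fun j hj => h j (Finset.ne_of_mem_erase hj)
      have hsplit := Finset.add_sum_erase Finset.univ (fun j => (A j).card) (Finset.mem_univ i)
      simp at hothers hsplit
      omega
    have hAi : A i = {4} :=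
      Finset.eq_singleton_iff_unique_mem.2 ⟨hi, fun k hk => Finset.card_le_one.1 hcard k hk 4 hi⟩
    refine ⟨i, 0, by simp [hAi], ?_⟩
    have hval₀ : propxCounterVal 0 = 3 := rfl
    have hval₄ : propxCounterVal 4 = 1 := rfl
    rw [hAi, Finset.sum_singleton, hval₀, hval₄]
    norm_num
end

section
/- For every number of agents n ≥ 1 with positive entitlement weights w_1,…,w_n > 0 summing to 1 and every finite set M of m indivisible chores, if each agent i has an additive cost function with nonnegative item costs c_i(k) ≥ 0, then there exists a complete allocation A = (A_1,…,A_n) that is weighted PROPX: for every agent i and every chore k ∈ A_i, c_i(A_i \ {k}) ≤ w_i · c_i(M). In particular, with equal weights w_i = 1/n, a PROPX allocation of indivisible chores always exists. -/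
/-- Bid-and-take: chores are handed out from the last to the first, each to an active agent who
minds it least, and an agent retires once its budget is exceeded. -/
theorem exists_owner_sum_later_le {ι : Type*} [DecidableEq ι] (m : ℕ) (S : Finset ι)
    (b : ι → ℝ) (d : ι → Fin m → ℝ) (hS : S.Nonempty) (hb : ∀ i ∈ S, 0 ≤ b i)
    (hd : ∀ i a, 0 ≤ d i a) (hsum : ∀ i ∈ S, ∑ a, d i a ≤ ∑ j ∈ S, b j) :
    ∃ f : Fin m → ι, (∀ a, f a ∈ S) ∧
      ∀ a, (∑ l, if a < l ∧ f l = f a then d (f a) l else 0) ≤ b (f a) := by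
  induction m generalizing S b with
  | zero => exact ⟨fun a => a.elim0, fun a => a.elim0, fun a => a.elim0⟩
  | succ m ih =>
    obtain ⟨j, hj, hmin⟩ := S.exists_min_image (fun i => d i (Fin.last m)) hS
    simp only [Fin.sum_univ_castSucc] at hsum
    by_cases hle : d j (Fin.last m) ≤ b j
    · obtain ⟨f, hf, hfb⟩ := ih S (Function.update b j (b j - d j (Fin.last m)))
        (fun i a => d i a.castSucc) hS
        (fun i hi => by
          by_cases h : i = j
          · subst h; simpa using hle
          · simpa [h] using hb i hi)
        (fun i a => hd _ _)
        (fun i hi => by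
          rw [Finset.sum_update_of_mem hj]
          have h1 := hsum i hi
          have h2 := hmin i hi
          have h3 := Finset.sum_sdiff (f := b) (Finset.singleton_subset_iff.2 hj)
          rw [Finset.sum_singleton] at h3
          linarith)
      refine ⟨Fin.snoc (α := fun _ => ι) f j, fun a => ?_, fun a => ?_⟩
      · induction a using Fin.lastCases <;> simp [hj, hf]
      · induction a using Fin.lastCases with
        | last => simpa [(Fin.le_last _).not_gt] using hb j hj
        | cast a =>
          have h := hfb a
          simp only [Fin.sum_univ_castSucc, Fin.snoc_castSucc, Fin.snoc_last,
            Fin.castSucc_lt_castSucc_iff, Fin.castSucc_lt_last, true_and]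
          by_cases hja : j = f a
          · rw [← hja, Function.update_self] at h
            rw [← hja, if_pos rfl]
            linarith
          · rw [Function.update_of_ne (Ne.symm hja)] at h
            rw [if_neg hja, add_zero]
            exact h
    · push Not at hle
      have hrest : ∀ i ∈ S, ∑ a : Fin m, d i a.castSucc < ∑ i ∈ S.erase j, b i := by
        intro i hi
        have h1 := hsum i hi
        have h2 := hmin i hi
        have h3 := Finset.add_sum_erase S b hj
        linarith
      have hne : (S.erase j).Nonempty := by
        by_contra h
        have h1 := hrest j hj
        rw [Finset.not_nonempty_iff_eq_empty.1 h, Finset.sum_empty] at h1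
        exact h1.not_ge (Finset.sum_nonneg fun a _ => hd j a.castSucc)
      obtain ⟨f, hf, hfb⟩ := ih (S.erase j) b (fun i a => d i a.castSucc) hne
        (fun i hi => hb i (Finset.mem_of_mem_erase hi)) (fun i a => hd _ _)
        (fun i hi => (hrest i (Finset.mem_of_mem_erase hi)).le)
      refine ⟨Fin.snoc (α := fun _ => ι) f j, fun a => ?_, fun a => ?_⟩
      · induction a using Fin.lastCases with
        | last => simpa using hj
        | cast a => simpa using Finset.mem_of_mem_erase (hf a)
      · induction a using Fin.lastCases with
        | last => simpa [(Fin.le_last _).not_gt] using hb j hj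
        | cast a =>
          have hja : j ≠ f a := (Finset.ne_of_mem_erase (hf a)).symm
          simpa [Fin.sum_univ_castSucc, hja] using hfb a

/-- A picking sequence: position `a` receives an item that is cheapest for `u a` among those not
assigned to earlier positions. -/
theorem exists_perm_forall_le (m : ℕ) (u : Fin m → Fin m → ℝ) :
    ∃ g : Equiv.Perm (Fin m), ∀ a b, a ≤ b → u a (g a) ≤ u a (g b) := by
  obtain ⟨g, hg⟩ := Finite.exists_min
    fun g : Equiv.Perm (Fin m) => toLex fun a => u a (g a)
  refine ⟨g, fun a b hab => ?_⟩
  by_contra! hlt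
  have hne : a ≠ b := by rintro rfl; exact lt_irrefl _ hlt
  refine (hg (g * Equiv.swap a b)).not_gt ⟨a, fun l hl => ?_, ?_⟩
  · have hla : l ≠ a := hl.ne
    have hlb : l ≠ b := (hl.trans_le hab).ne
    simp [Equiv.swap_apply_of_ne_of_ne hla hlb]
  · simpa using hlt

/-- An item cheapest among those outside the first `a` picks costs at most the `a`-th smallest
value. -/
theorem apply_le_apply_sort {m : ℕ} (v : Fin m → ℝ) (g : Equiv.Perm (Fin m)) (a : Fin m)
    (h : ∀ b, a ≤ b → v (g a) ≤ v (g b)) : v (g a) ≤ v (Tuple.sort v a) := by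
  obtain ⟨x, hx, hxn⟩ : ∃ x ∈ (Finset.Iic a).map (Tuple.sort v).toEmbedding,
      x ∉ (Finset.Iio a).map g.toEmbedding :=
    Finset.exists_mem_notMem_of_card_lt_card (by simp)
  obtain ⟨l, hl, rfl⟩ := Finset.mem_map.1 hx
  refine le_trans ?_ (Tuple.monotone_sort v (Finset.mem_Iic.1 hl))
  have hb : a ≤ g.symm (Tuple.sort v l) := by
    by_contra! hlt
    exact hxn (Finset.mem_map.2 ⟨_, Finset.mem_Iio.2 hlt, by simp⟩)
  simpa using h _ hb


/-- For every number of agents `n ≥ 1` with positive entitlement weights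
summing to `1` and every finite set of `m` indivisible chores with additive nonnegative
costs, there exists a complete allocation that is weighted PROPX: for every agent `i` and
every chore `k ∈ A_i`, `c_i(A_i \ {k}) ≤ w_i · c_i(M)`. (With equal weights `w_i = 1/n`
this yields a PROPX allocation of indivisible chores.) -/
theorem weighted_propx_exists_chores (n m : ℕ) (hn : 1 ≤ n)
    (w : Fin n → ℝ) (hw : ∀ i, 0 < w i) (hwsum : ∑ i, w i = 1)
    (c : Fin n → Fin m → ℝ) (hc : ∀ i k, 0 ≤ c i k) :
    ∃ A : Fin n → Finset (Fin m),
      (∀ i j, i ≠ j → Disjoint (A i) (A j)) ∧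
      Finset.univ.biUnion A = Finset.univ ∧
      ∀ i, ∀ k ∈ A i, (∑ l ∈ A i \ {k}, c i l) ≤ w i * ∑ l, c i l := by
  classical
  have : NeZero n := ⟨by omega⟩
  have hT : ∀ i, 0 ≤ ∑ l, c i l := fun i => Finset.sum_nonneg fun l _ => hc i l
  obtain ⟨f, -, hf⟩ := exists_owner_sum_later_le m Finset.univ w
    (fun i a => c i (Tuple.sort (c i) a) / ∑ l, c i l) Finset.univ_nonempty
    (fun i _ => (hw i).le) (fun i a => div_nonneg (hc _ _) (hT i))
    (fun i _ => by
      rw [hwsum, ← Finset.sum_div, Equiv.sum_comp (Tuple.sort (c i)) (c i)]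
      exact div_self_le_one _)
  obtain ⟨g, hg⟩ := exists_perm_forall_le m fun a => c (f a)
  refine ⟨fun i => Finset.univ.filter fun x => f (g.symm x) = i, fun i j hij => ?_, ?_,
    fun i k hk => ?_⟩
  · rw [Finset.disjoint_left]
    intro x hx hx'
    simp only [Finset.mem_filter, Finset.mem_univ, true_and] at hx hx'
    exact hij (hx.symm.trans hx')
  · ext x
    simp
  · obtain ⟨a, ha, hmin⟩ := (Finset.univ.filter fun a => f a = i).exists_min_image id
      ⟨g.symm k, by simpa using hk⟩
    simp only [Finset.mem_filter, Finset.mem_univ, true_and, id] at ha hmin hk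
    subst ha
    rcases (hT (f a)).eq_or_lt with h0 | hpos
    · rw [← h0, mul_zero, h0]
      exact Finset.sum_le_sum_of_subset_of_nonneg (Finset.subset_univ _) fun l _ _ => hc _ l
    have hle := hg a _ (hmin _ hk)
    rw [Equiv.apply_symm_apply] at hle
    have hlater := hf a
    rw [← mul_le_mul_iff_left₀ hpos, Finset.sum_mul] at hlater
    refine le_trans ?_ hlater
    have hmem : k ∈ Finset.univ.filter fun x => f (g.symm x) = f a := by simpa using hk
    have hsplit := Finset.sum_sdiff (f := c (f a)) (Finset.singleton_subset_iff.2 hmem)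
    rw [Finset.sum_singleton, Finset.sum_filter, ← Equiv.sum_comp g,
      ← Finset.add_sum_erase _ _ (Finset.mem_univ a)] at hsplit
    simp only [Equiv.symm_apply_apply, if_true] at hsplit
    have hpick : (∑ l ∈ Finset.univ.erase a, if f l = f a then c (f a) (g l) else 0) ≤
        ∑ l, (if a < l ∧ f l = f a then
          c (f a) (Tuple.sort (c (f a)) l) / ∑ x, c (f a) x else 0) * ∑ x, c (f a) x := by
      rw [← Finset.add_sum_erase Finset.univ _ (Finset.mem_univ a)]
      simp only [lt_irrefl, false_and, if_false, zero_mul, zero_add]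
      refine Finset.sum_le_sum fun l hl => ?_
      by_cases hl' : f l = f a
      · rw [if_pos hl', if_pos ⟨lt_of_le_of_ne (hmin l hl') (Finset.ne_of_mem_erase hl).symm, hl'⟩,
          div_mul_cancel₀ _ hpos.ne', ← hl']
        exact apply_le_apply_sort _ g l (hg l)
      · simp [hl']
    linarith
end

section
/- For every n ≥ 3, there exist a finite set M of indivisible goods and additive valuations with nonnegative item values v_i(k) ≥ 0 for n agents such that no complete allocation is MMS: for every allocation A = (A_1,…,A_n) there exists an agent i with v_i(A_i) < μ_i, where μ_i = max over all partitions (P_1,…,P_n) of M into n bundles of min_j v_i(P_j). -/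
/-- Transfer of a bad integer-valued instance on arbitrary finite types of agents and goods,
with bundles given as fibres of maps from goods to agents, to `Fin n` and `Fin m`. -/
theorem exists_fin_instance {α ι : Type} [Fintype α] [DecidableEq α] [Fintype ι]
    {n : ℕ} (hn : 0 < n) (hcard : Fintype.card α = n) (v : α → ι → ℤ) (V : ℤ)
    (hv : ∀ i x, 0 ≤ v i x)
    (hshare : ∀ i, ∃ s : ι → α, ∀ j, V ≤ ∑ x, if s x = j then v i x else 0)
    (hbad : ∀ f : ι → α, ∃ i, (∑ x, if f x = i then v i x else 0) < V) :
    ∃ (m : ℕ) (v : Fin n → Fin m → ℝ),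
      (∀ i k, 0 ≤ v i k) ∧
      ∀ A : Fin n → Finset (Fin m),
        (∀ i j, i ≠ j → Disjoint (A i) (A j)) →
        Finset.univ.biUnion A = Finset.univ →
        ∃ i : Fin n, ∃ P : Fin n → Finset (Fin m),
          (∀ j l, j ≠ l → Disjoint (P j) (P l)) ∧
          Finset.univ.biUnion P = Finset.univ ∧
          (∑ k ∈ A i, v i k) <
            Finset.univ.inf' (Finset.univ_nonempty_iff.mpr ⟨⟨0, hn⟩⟩)
              (fun j => ∑ k ∈ P j, v i k) := by
  let e : α ≃ Fin n := Fintype.equivFinOfCardEq hcard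
  let u : ι ≃ Fin (Fintype.card ι) := Fintype.equivFin ι
  have fiber_sum (h : ι → α) (i : α) (j : Fin n) :
      ∑ k with e (h (u.symm k)) = j, ((v i (u.symm k) : ℤ) : ℝ) =
        ((∑ x, if h x = e.symm j then v i x else 0 : ℤ) : ℝ) := by
    rw [Finset.sum_filter, ← u.sum_comp]
    push_cast
    refine Finset.sum_congr rfl fun x _ => ?_
    simp [Equiv.eq_symm_apply]
  refine ⟨Fintype.card ι, fun i k => v (e.symm i) (u.symm k),
    fun i k => Int.cast_nonneg (hv _ _), fun A hdisj hcover => ?_⟩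
  have hmem : ∀ k, ∃ i, k ∈ A i := fun k => by
    have : k ∈ Finset.univ.biUnion A := hcover ▸ Finset.mem_univ k
    simpa using this
  choose g hg using hmem
  have hA : ∀ i, A i = Finset.univ.filter fun k => e (e.symm (g (u (u.symm k)))) = i := by
    intro i
    ext k
    simp only [Equiv.apply_symm_apply, Finset.mem_filter, Finset.mem_univ, true_and]
    refine ⟨fun hk => ?_, fun hk => hk ▸ hg k⟩
    by_contra hne
    exact Finset.disjoint_left.mp (hdisj _ _ hne) (hg k) hk
  obtain ⟨i, hi⟩ := hbad fun x => e.symm (g (u x))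
  obtain ⟨s, hs⟩ := hshare i
  refine ⟨e i, fun j => Finset.univ.filter fun k => e (s (u.symm k)) = j, ?_, ?_, ?_⟩
  · intro j l hjl
    rw [Finset.disjoint_left]
    intro k hj hl
    simp only [Finset.mem_filter, Finset.mem_univ, true_and] at hj hl
    exact hjl (hj.symm.trans hl)
  · ext k
    simp
  · rw [Finset.lt_inf'_iff]
    intro j _
    rw [hA]
    simp only [Equiv.symm_apply_apply]
    rw [fiber_sum (fun x => e.symm (g (u x))) i (e i), fiber_sum s i j]
    simp only [Equiv.symm_apply_apply]
    exact_mod_cast hi.trans_le (hs _)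

/-- Whether every way of handing out the listed goods to three agents, who already hold bundles
worth `x`, `y` and `z`, leaves some agent with less than `40`. -/
def alwaysShort : List (ℕ × ℕ × ℕ) → ℕ → ℕ → ℕ → Bool
  | [], x, y, z => Nat.blt x 40 || Nat.blt y 40 || Nat.blt z 40
  | a :: l, x, y, z => alwaysShort l (x + a.1) y z && alwaysShort l x (y + a.2.1) z &&
      alwaysShort l x y (z + a.2.2)

theorem exists_lt_of_alwaysShort (l : List (ℕ × ℕ × ℕ)) (x y z : ℕ)
    (h : alwaysShort l x y z = true) (f : Fin l.length → Fin 3) :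
    x + (∑ k, if f k = 0 then (l.get k).1 else 0) < 40 ∨
    y + (∑ k, if f k = 1 then (l.get k).2.1 else 0) < 40 ∨
    z + (∑ k, if f k = 2 then (l.get k).2.2 else 0) < 40 := by
  induction l generalizing x y z with
  | nil => simpa [alwaysShort, or_assoc] using h
  | cons a l ih =>
    simp only [alwaysShort, Bool.and_eq_true] at h
    obtain ⟨⟨h0, h1⟩, h2⟩ := h
    have h0 := ih _ _ _ h0 fun k => f k.succ
    have h1 := ih _ _ _ h1 fun k => f k.succ
    have h2 := ih _ _ _ h2 fun k => f k.succ
    simp only [List.length_cons, Fin.sum_univ_succ, List.get_eq_getElem, Fin.val_zero,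
      Fin.val_succ, List.getElem_cons_zero, List.getElem_cons_succ] at h0 h1 h2 ⊢
    obtain h | h | h : f 0 = 0 ∨ f 0 = 1 ∨ f 0 = 2 := by
      generalize f 0 = i
      fin_cases i <;> simp
    · simpa [h, add_assoc] using h0
    · simpa [h, add_assoc] using h1
    · simpa [h, add_assoc] using h2

/-- The nine goods of a three-agent instance with maximin shares `40`, each with its values for
the three agents. -/
def threeAgentGoods : List (ℕ × ℕ × ℕ) :=
  [(1, 1, 1), (16, 16, 15), (23, 22, 23), (26, 26, 25), (4, 4, 4), (10, 9, 10),
    (12, 13, 13), (19, 20, 20), (9, 9, 9)]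

theorem alwaysShort_threeAgentGoods : alwaysShort threeAgentGoods 0 0 0 = true := by
  decide +kernel

/-- The value of good `k` for agent `i` in the three-agent instance. -/
def threeAgentValue (i : Fin 3) (k : Fin 9) : ℤ :=
  ![((threeAgentGoods.get k).1 : ℤ), (threeAgentGoods.get k).2.1, (threeAgentGoods.get k).2.2] i

theorem threeAgentValue_bad (f : Fin 9 → Fin 3) :
    ∃ i, (∑ k, if f k = i then threeAgentValue i k else 0) < 40 := by
  have h := exists_lt_of_alwaysShort _ 0 0 0 alwaysShort_threeAgentGoods f
  simp only [zero_add] at h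
  obtain h | h | h := h
  · exact ⟨0, by simpa [threeAgentValue] using (by exact_mod_cast h :
      ((∑ k, if f k = 0 then (threeAgentGoods.get k).1 else 0 : ℕ) : ℤ) < 40)⟩
  · exact ⟨1, by simpa [threeAgentValue] using (by exact_mod_cast h :
      ((∑ k, if f k = 1 then (threeAgentGoods.get k).2.1 else 0 : ℕ) : ℤ) < 40)⟩
  · exact ⟨2, by simpa [threeAgentValue] using (by exact_mod_cast h :
      ((∑ k, if f k = 2 then (threeAgentGoods.get k).2.2 else 0 : ℕ) : ℤ) < 40)⟩

theorem threeAgentValue_share (i : Fin 3) :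
    ∃ s : Fin 9 → Fin 3, ∀ j, 40 ≤ ∑ k, if s k = j then threeAgentValue i k else 0 := by
  fin_cases i
  · exact ⟨![0, 0, 0, 1, 1, 1, 2, 2, 2], by decide +kernel⟩
  · exact ⟨![0, 1, 2, 0, 1, 2, 0, 1, 2], by decide +kernel⟩
  · exact ⟨![0, 1, 2, 1, 2, 0, 2, 0, 0], by decide +kernel⟩

/-- If the `x i` average to `A`, and each scaled and slightly perturbed `x i` reaches the scaled
`A`, then each `x i` equals `A`. -/
theorem eq_of_forall_scaled_le {α : Type} [Fintype α] {H A : ℤ} {x y : α → ℤ}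
    (hy : ∀ i, |y i| < H) (hsum : ∑ i, x i = ∑ _i : α, A)
    (h : ∀ i, H * A ≤ H * x i + y i) (i : α) : x i = A := by
  have hle : ∀ i ∈ Finset.univ, A ≤ x i := by
    intro i _
    by_contra! hlt
    have h1 := h i
    have h2 := abs_lt.mp (hy i)
    nlinarith
  exact ((Finset.sum_eq_sum_iff_of_le hle).mp hsum.symm i (Finset.mem_univ i)).symm

/-- A common strict bound on all subset sums of finitely many integer-valued functions. -/
theorem exists_bound_subset_sum {β ι : Type} [Fintype β] [Fintype ι] (p : β → ι → ℤ) :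
    ∃ H : ℤ, ∀ b (q : ι → Prop) [DecidablePred q], |∑ x, if q x then p b x else 0| < H := by
  refine ⟨(∑ b, ∑ x, |p b x|) + 1, fun b q _ => Int.lt_add_one_iff.mpr ?_⟩
  calc |∑ x, if q x then p b x else 0| ≤ ∑ x, |if q x then p b x else 0| :=
        Finset.abs_sum_le_sum_abs _ _
    _ ≤ ∑ x, |p b x| := Finset.sum_le_sum fun x _ => by split_ifs <;> simp
    _ ≤ ∑ b, ∑ x, |p b x| := Finset.single_le_sum (f := fun b => ∑ x, |p b x|)
        (fun b _ => Finset.sum_nonneg fun x _ => abs_nonneg _) (Finset.mem_univ b)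

/-- A subset of numbers from `[N, 2N)` whose sum is less than `2N` and positive
is a singleton. -/
theorem exists_forall_iff_of_sum_eq {β : Type} [Fintype β] {g : β → ℤ} {N a : ℤ}
    (hN : 0 < N) (hg : ∀ y, N ≤ g y) (ha : 0 < a) (ha' : a < 2 * N)
    (p : β → Prop) [DecidablePred p] (h : (∑ y, if p y then g y else 0) = a) :
    ∃ y, g y = a ∧ ∀ y', p y' ↔ y' = y := by
  classical
  rw [← Finset.sum_filter] at h
  have hcard : ((Finset.univ.filter p).card : ℤ) * N ≤ a := by
    rw [← h, ← nsmul_eq_mul]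
    exact Finset.card_nsmul_le_sum _ _ _ fun y _ => hg y
  have hlt : (Finset.univ.filter p).card < 2 := by
    by_contra! hge
    have : (2 : ℤ) ≤ (Finset.univ.filter p).card := by exact_mod_cast hge
    nlinarith
  have hne : (Finset.univ.filter p).card ≠ 0 := by
    intro h0
    rw [Finset.card_eq_zero.mp h0, Finset.sum_empty] at h
    exact ha.ne h
  obtain ⟨y, hy⟩ := Finset.card_eq_one.mp (by omega : (Finset.univ.filter p).card = 1)
  refine ⟨y, by simpa [hy] using h, fun y' => ?_⟩
  have : y' ∈ Finset.univ.filter p ↔ y' ∈ ({y} : Finset β) := by rw [hy]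
  simpa using this

namespace CyclicInstance

variable {N : ℕ}

/-- Distinct numbers in `[N, 2N)`. -/
def weight (k : ZMod N) : ℤ := N + k.val

theorem le_weight (k : ZMod N) : (N : ℤ) ≤ weight k := by
  unfold weight
  omega

/-- The agents can be split into two kinds with at least two agents of each. -/
theorem exists_kind (hN : 3 ≤ N) : ∃ kind : Option (ZMod N) → Bool,
    ∀ c i₀, ∃ i ≠ i₀, kind i = c := by
  have : Fact (1 < N) := ⟨by omega⟩
  have two_ne : (2 : ZMod N) ≠ 0 := by
    intro h
    have := (ZMod.natCast_eq_zero_iff 2 N).mp (by exact_mod_cast h)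
    exact absurd (Nat.le_of_dvd two_pos this) (by omega)
  have one_ne_two : (1 : ZMod N) ≠ 2 := by
    intro h
    exact one_ne_zero (α := ZMod N) (by linear_combination -h)
  refine ⟨fun o => decide (o = none ∨ o = some 0), fun c i₀ => ?_⟩
  cases c
  · by_cases h : i₀ = some 1
    · exact ⟨some 2, by simp [h, one_ne_two.symm], by simp [two_ne]⟩
    · exact ⟨some 1, Ne.symm h, by simp⟩
  · by_cases h : i₀ = none
    · exact ⟨some 0, by simp [h], by simp⟩
    · exact ⟨none, Ne.symm h, by simp⟩

variable [NeZero N]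

/-- The goods: a big one for each agent, two medium ones and a small one for each `k : ZMod N`. -/
abbrev Good (N : ℕ) : Type := Option (ZMod N) ⊕ (Bool × ZMod N) ⊕ ZMod N

/-- The leading part of the value of a good; the maximin share is `4 * N ^ 2`. -/
def mainValue : Good N → ℤ
  | .inl none => 4 * (N : ℤ) ^ 2 - ∑ k : ZMod N, weight k
  | .inl (some k) => 4 * (N : ℤ) ^ 2 - weight k
  | .inr (.inl (_, k)) => weight k
  | .inr (.inr _) => 0

/-- The second-order part of the value of a good, tying the choices of the bundles together
along the cycle `ZMod N`. -/
def tieValue : Good N → ℤ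
  | .inl none => ∑ k : ZMod N, weight k
  | .inl (some _) => 0
  | .inr (.inl (true, k)) => -weight k
  | .inr (.inl (false, k)) => -weight (k - 1)
  | .inr (.inr k) => weight k

/-- The third-order part of the value of a good, for an agent of kind `c`. -/
def tiltValue (c : Bool) : Good N → ℤ
  | .inl none => N
  | .inl (some _) => 0
  | .inr (.inl (b, _)) => if b = c then 0 else -1
  | .inr (.inr _) => 0

/-- The maximin partition of the agents of kind `c`. -/
def share (c : Bool) : Good N → Option (ZMod N)
  | .inl o => o
  | .inr (.inl (b, k)) => if b = c then some k else none
  | .inr (.inr k) => some (if c then k else k + 1)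

theorem sum_good (g : Good N → ℤ) :
    ∑ x, g x = (∑ o, g (.inl o)) + ((∑ y, g (.inr (.inl y))) + ∑ k, g (.inr (.inr k))) := by
  rw [Fintype.sum_sum_type, Fintype.sum_sum_type]

theorem sum_share_main (c : Bool) (o : Option (ZMod N)) :
    (∑ x, if share c x = o then mainValue x else 0) = 4 * (N : ℤ) ^ 2 := by
  rw [sum_good]
  cases c <;> cases o <;>
    simp [Fintype.sum_option, Fintype.sum_prod_type, share, mainValue]

theorem sum_share_tie (c : Bool) (o : Option (ZMod N)) :
    (∑ x, if share c x = o then tieValue x else 0) = 0 := by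
  have hshift : ∑ k : ZMod N, weight (k - 1) = ∑ k : ZMod N, weight k :=
    (Equiv.subRight (1 : ZMod N)).sum_comp weight
  rw [sum_good]
  cases c <;> cases o <;>
    simp [Fintype.sum_option, Fintype.sum_prod_type, share, tieValue, hshift, ← eq_sub_iff_add_eq]

theorem sum_share_tilt (c : Bool) (o : Option (ZMod N)) :
    (∑ x, if share c x = o then tiltValue c x else 0) = 0 := by
  rw [sum_good]
  cases c <;> cases o <;>
    simp [Fintype.sum_option, Fintype.sum_prod_type, share, tiltValue]

theorem weight_lt (k : ZMod N) : weight k < 2 * N := by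
  have := k.val_lt
  unfold weight
  omega

theorem weight_injective : Function.Injective (weight : ZMod N → ℤ) := by
  intro k l h
  apply ZMod.val_injective N
  unfold weight at h
  omega

theorem lt_mainValue_inl (o : Option (ZMod N)) : 2 * (N : ℤ) ^ 2 < mainValue (.inl o) := by
  have hN : (1 : ℤ) ≤ N := by exact_mod_cast NeZero.one_le
  cases o with
  | none =>
    have : ∑ k : ZMod N, weight k < ∑ _k : ZMod N, 2 * (N : ℤ) :=
      Finset.sum_lt_sum_of_nonempty Finset.univ_nonempty fun k _ => weight_lt k
    simp only [Finset.sum_const, Finset.card_univ, ZMod.card, nsmul_eq_mul] at this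
    simp only [mainValue]
    linarith
  | some k =>
    have := weight_lt k
    simp only [mainValue]
    nlinarith

theorem mainValue_nonneg (x : Good N) : 0 ≤ mainValue x := by
  match x with
  | .inl o => exact (by positivity : 0 ≤ 2 * (N : ℤ) ^ 2).trans (lt_mainValue_inl o).le
  | .inr (.inl (_, k)) => exact (Int.natCast_nonneg N).trans (le_weight k)
  | .inr (.inr _) => exact le_rfl

/-- If there are at least two agents of each kind, every allocation that is exact in the first two
parts gives some agent a bundle with negative third-order part. -/
theorem exists_tilt_neg (hN : 2 ≤ N) (kind : Option (ZMod N) → Bool)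
    (hkind : ∀ c i₀, ∃ i ≠ i₀, kind i = c) (f : Good N → Option (ZMod N))
    (hmain : ∀ i, (∑ x, if f x = i then mainValue x else 0) = 4 * (N : ℤ) ^ 2)
    (htie : ∀ i, (∑ x, if f x = i then tieValue x else 0) = 0) :
    ∃ i, (∑ x, if f x = i then tiltValue (kind i) x else 0) < 0 := by
  have hN0 : (0 : ℤ) < N := by exact_mod_cast NeZero.pos N
  have hinj : Function.Injective fun o => f (.inl o) := by
    intro o o' ho
    by_contra hne
    have hsub : ({.inl o, .inl o'} : Finset (Good N)) ⊆
        Finset.univ.filter fun x => f x = f (.inl o') := by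
      intro x hx
      simp only [Finset.mem_insert, Finset.mem_singleton] at hx
      obtain rfl | rfl := hx
      · simpa using ho
      · simp
    have hle := Finset.sum_le_sum_of_subset_of_nonneg hsub fun x _ _ => mainValue_nonneg x
    rw [Finset.sum_filter, hmain, Finset.sum_pair (by simpa using hne)] at hle
    linarith [lt_mainValue_inl o, lt_mainValue_inl o']
  have hsurj : Function.Surjective fun o => f (.inl o) := Finite.injective_iff_surjective.mp hinj
  have hbig (g : Good N → ℤ) (o : Option (ZMod N)) :
      (∑ o', if f (.inl o') = f (.inl o) then g (.inl o') else 0) = g (.inl o) := by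
    have : ∀ o', f (.inl o') = f (.inl o) ↔ o' = o := fun o' => hinj.eq_iff
    simp [this]
  have hmedium : ∀ k, ∃ b, ∀ y, f (.inr (.inl y)) = f (.inl (some k)) ↔ y = (b, k) := by
    intro k
    have h := hmain (f (.inl (some k)))
    rw [sum_good, hbig] at h
    obtain ⟨⟨b, l⟩, hl, hy⟩ := exists_forall_iff_of_sum_eq
      (g := fun y : Bool × ZMod N => weight y.2) hN0 (fun y => le_weight y.2)
      (hN0.trans_le (le_weight k)) (weight_lt k)
      (fun y => f (.inr (.inl y)) = f (.inl (some k))) (by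
        simp only [mainValue, ite_self, Finset.sum_const_zero] at h
        linarith)
    obtain rfl := weight_injective hl
    exact ⟨b, hy⟩
  choose b hb using hmedium
  have hsmall : ∀ k l, f (.inr (.inr l)) = f (.inl (some k)) ↔ l = if b k then k else k - 1 := by
    intro k
    have h := htie (f (.inl (some k)))
    rw [sum_good, hbig] at h
    simp only [hb, Finset.sum_ite_eq', Finset.mem_univ, if_true] at h
    obtain ⟨l, hl, hy⟩ := exists_forall_iff_of_sum_eq (g := fun l : ZMod N => weight l)
      (a := weight (if b k then k else k - 1)) hN0 le_weight
      (hN0.trans_le (le_weight _)) (weight_lt _)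
      (fun l => f (.inr (.inr l)) = f (.inl (some k))) (by
        cases hbk : b k <;> simp [hbk, tieValue] at h ⊢ <;> linarith)
    obtain rfl := weight_injective hl
    exact hy
  have : Fact (1 < N) := ⟨hN⟩
  have hstep : ∀ k, b k = true → b (k + 1) = true := by
    intro k hk
    by_contra hk'
    have h1 := (hsmall k k).mpr (by simp [hk])
    have h2 := (hsmall (k + 1) k).mpr (by simp [hk'])
    have h3 := hinj (h1.symm.trans h2)
    simp at h3
  have hconst : ∃ c, ∀ k, b k = c := by
    by_cases hex : ∃ k, b k = true
    · obtain ⟨k, hk⟩ := hex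
      refine ⟨true, fun l => ?_⟩
      have hiter : ∀ m : ℕ, b (k + m) = true := by
        intro m
        induction m with
        | zero => simpa using hk
        | succ m ih => simpa [add_assoc] using hstep _ ih
      simpa using hiter (l - k).val
    · exact ⟨false, by simpa using hex⟩
  obtain ⟨c, hc⟩ := hconst
  obtain ⟨i, hi, hic⟩ := hkind (!c) (f (.inl none))
  obtain ⟨o, rfl⟩ := hsurj i
  refine ⟨f (.inl o), ?_⟩
  cases o with
  | none => exact absurd rfl hi
  | some k =>
    simp only at hic
    rw [sum_good, hbig, hic]
    simp [hb, hc, tiltValue]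

theorem exists_bad_values (hN : 2 ≤ N) (kind : Option (ZMod N) → Bool)
    (hkind : ∀ c i₀, ∃ i ≠ i₀, kind i = c) :
    ∃ (v : Option (ZMod N) → Good N → ℤ) (V : ℤ), (∀ i x, 0 ≤ v i x) ∧
      (∀ i, ∃ s : Good N → Option (ZMod N), ∀ j, V ≤ ∑ x, if s x = j then v i x else 0) ∧
      ∀ f : Good N → Option (ZMod N), ∃ i, (∑ x, if f x = i then v i x else 0) < V := by
  obtain ⟨K, hK⟩ := exists_bound_subset_sum (fun c => tiltValue (N := N) c)
  have hK0 : 0 < K := (abs_nonneg _).trans_lt (hK true fun _ => False)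
  obtain ⟨H, hH⟩ := exists_bound_subset_sum
    (fun c (x : Good N) => K * tieValue x + tiltValue c x)
  have hsplit (i : Option (ZMod N)) (f : Good N → Option (ZMod N)) (j : Option (ZMod N)) :
      (∑ x, if f x = j then H * mainValue x + (K * tieValue x + tiltValue (kind i) x) else 0) =
        H * (∑ x, if f x = j then mainValue x else 0) +
          (K * (∑ x, if f x = j then tieValue x else 0) +
            ∑ x, if f x = j then tiltValue (kind i) x else 0) := by
    simp only [Finset.mul_sum, ← Finset.sum_add_distrib]
    refine Finset.sum_congr rfl fun x _ => ?_
    split_ifs <;> simp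
  have htotal (g : Good N → ℤ) (f : Good N → Option (ZMod N)) :
      ∑ i, (∑ x, if f x = i then g x else 0) = ∑ x, g x := by
    rw [Finset.sum_comm]
    simp
  refine ⟨fun i x => H * mainValue x + (K * tieValue x + tiltValue (kind i) x),
    H * (4 * (N : ℤ) ^ 2), ?_, ?_, ?_⟩
  · intro i x
    have hbound : |K * tieValue x + tiltValue (kind i) x| < H := by
      simpa using hH (kind i) (fun y => y = x)
    have hH0 : 0 < H := (abs_nonneg _).trans_lt hbound
    have hpos (h : 0 < mainValue x) :
        0 ≤ H * mainValue x + (K * tieValue x + tiltValue (kind i) x) := by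
      have := (abs_lt.mp hbound).1
      nlinarith
    match x with
    | .inl o => exact hpos ((by positivity : 0 ≤ 2 * (N : ℤ) ^ 2).trans_lt (lt_mainValue_inl o))
    | .inr (.inl (_, k)) =>
      exact hpos ((by exact_mod_cast NeZero.pos N : (0 : ℤ) < N).trans_le (le_weight k))
    | .inr (.inr k) =>
      have := (Int.natCast_nonneg N).trans (le_weight k)
      simp only [mainValue, tieValue, tiltValue]
      positivity
  · intro i
    refine ⟨share (kind i), fun j => ?_⟩
    rw [hsplit, sum_share_main, sum_share_tie, sum_share_tilt]
    simp
  · intro f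
    by_contra! hf
    simp only [hsplit] at hf
    have hmain : ∀ i, (∑ x, if f x = i then mainValue x else 0) = 4 * (N : ℤ) ^ 2 := by
      refine eq_of_forall_scaled_le (fun i => ?_) ?_ hf
      · have h := hH (kind i) fun x => f x = i
        convert h using 2
        simp only [Finset.mul_sum, ← Finset.sum_add_distrib]
        refine Finset.sum_congr rfl fun x _ => ?_
        split_ifs <;> simp
      · rw [htotal, ← htotal mainValue (share true)]
        exact Finset.sum_congr rfl fun o _ => sum_share_main true o
    have htie : ∀ i, (∑ x, if f x = i then tieValue x else 0) = 0 := by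
      refine eq_of_forall_scaled_le (fun i => hK (kind i) fun x => f x = i) ?_ fun i => ?_
      · rw [htotal, ← htotal tieValue (share true)]
        exact Finset.sum_congr rfl fun o _ => sum_share_tie true o
      · have h := hf i
        rw [hmain] at h
        linarith
    obtain ⟨i, hi⟩ := exists_tilt_neg hN kind hkind f hmain htie
    have h := hf i
    rw [hmain, htie] at h
    linarith

end CyclicInstance

/-- For every `n ≥ 3`, there exist a finite set of indivisible goods and
additive valuations with nonnegative item values for `n` agents such that no complete
allocation is MMS: in every allocation some agent `i` receives strictly less than its
maximin share `μ_i` (i.e., there is a partition in which every bundle is worth strictly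
more to `i` than `A i`). -/
theorem mms_nonexistence_goods (n : ℕ) (hn : 3 ≤ n) :
    ∃ (m : ℕ) (v : Fin n → Fin m → ℝ),
      (∀ i k, 0 ≤ v i k) ∧
      ∀ A : Fin n → Finset (Fin m),
        (∀ i j, i ≠ j → Disjoint (A i) (A j)) →
        Finset.univ.biUnion A = Finset.univ →
        ∃ i : Fin n, ∃ P : Fin n → Finset (Fin m),
          (∀ j l, j ≠ l → Disjoint (P j) (P l)) ∧
          Finset.univ.biUnion P = Finset.univ ∧
          (∑ k ∈ A i, v i k) <
            Finset.univ.inf' (Finset.univ_nonempty_iff.mpr ⟨⟨0, by omega⟩⟩)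
              (fun j => ∑ k ∈ P j, v i k) := by
  obtain rfl | hn4 := hn.eq_or_lt
  · exact exists_fin_instance (by omega) (Fintype.card_fin 3) threeAgentValue 40
      (by decide +kernel) threeAgentValue_share threeAgentValue_bad
  · obtain ⟨N, rfl⟩ : ∃ N, n = N + 1 := ⟨n - 1, by omega⟩
    have : NeZero N := ⟨by omega⟩
    obtain ⟨kind, hkind⟩ := CyclicInstance.exists_kind (N := N) (by omega)
    obtain ⟨v, V, hv, hshare, hbad⟩ :=
      CyclicInstance.exists_bad_values (by omega) kind hkind
    exact exists_fin_instance (by omega) (by simp) v V hv hshare hbad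
end

section
/- For every n ≥ 3, there exist a finite set M of indivisible chores and additive cost functions with nonnegative item costs c_i(k) ≥ 0 for n agents such that no complete allocation is MMS for chores: for every allocation A = (A_1,…,A_n) there exists an agent i with c_i(A_i) > MMS_i, where MMS_i = min over all partitions (P_1,…,P_n) of M into n bundles of max_j c_i(P_j). -/
/-- A real matrix with zero row and column sums, no sub-sum of which vanishes except over a union
of rows or a union of columns. -/
theorem exists_generic_zero_sum_matrix (n : ℕ) :
    ∃ δ : Fin n × Fin n → ℝ, (∀ i, ∑ j, δ (i, j) = 0) ∧ (∀ j, ∑ i, δ (i, j) = 0) ∧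
      ∀ S : Finset (Fin n × Fin n), ∑ k ∈ S, δ k = 0 →
        (∀ i j j', (i, j) ∈ S → (i, j') ∈ S) ∨ (∀ i i' j, (i, j) ∈ S → (i', j) ∈ S) := by
  classical
  let V : Submodule ℝ (Fin n × Fin n → ℝ) :=
    { carrier := {δ | (∀ i, ∑ j, δ (i, j) = 0) ∧ ∀ j, ∑ i, δ (i, j) = 0}
      zero_mem' := by simp
      add_mem' := by
        rintro a b ⟨ha, ha'⟩ ⟨hb, hb'⟩
        simp [Finset.sum_add_distrib, ha, ha', hb, hb']
      smul_mem' := by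
        rintro t a ⟨ha, ha'⟩
        simp [← Finset.mul_sum, ha, ha'] }
  let ι := {S : Finset (Fin n × Fin n) //
    ¬((∀ i j j', (i, j) ∈ S → (i, j') ∈ S) ∨ (∀ i i' j, (i, j) ∈ S → (i', j) ∈ S))}
  let F (S : ι) : Module.Dual ℝ (Fin n × Fin n → ℝ) := ∑ k ∈ S.1, LinearMap.proj k
  have hF (S : ι) (x) : F S x = ∑ k ∈ S.1, x k := by simp [F]
  obtain ⟨δ, hδ, hne⟩ := Module.Dual.exists_forall_mem_ne_zero_of_forall_exists V F (by
    rintro ⟨S, hS⟩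
    by_contra! hzero
    have hrect (i i' j j' : Fin n) :
        (if (i, j) ∈ S then (1 : ℝ) else 0) - (if (i', j) ∈ S then 1 else 0)
          - (if (i, j') ∈ S then 1 else 0) + (if (i', j') ∈ S then 1 else 0) = 0 := by
      let x : Fin n × Fin n → ℝ := fun k =>
        (if k = (i, j) then 1 else 0) - (if k = (i', j) then 1 else 0)
          - (if k = (i, j') then 1 else 0) + (if k = (i', j') then 1 else 0)
      have hx : x ∈ V := by
        constructor
        · intro a
          simp [x, Finset.sum_add_distrib, Finset.sum_sub_distrib, Prod.ext_iff, ite_and]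
        · intro b
          simp only [x, Finset.sum_add_distrib, Finset.sum_sub_distrib, Prod.ext_iff,
            ite_and]
          simp
      have := hzero x hx
      rw [hF] at this
      simpa [x, Finset.sum_add_distrib, Finset.sum_sub_distrib] using this
    push Not at hS
    obtain ⟨⟨i, j, j', hj, hj'⟩, a, a', b, hb, hb'⟩ := hS
    have h1 (i') : (i', j) ∈ S ∧ (i', j') ∉ S := by
      have := hrect i i' j j'
      by_cases h : (i', j) ∈ S <;> by_cases h' : (i', j') ∈ S <;> simp_all
    have := hrect a a' b j
    have := hrect a a' b j'
    simp_all)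
  refine ⟨δ, hδ.1, hδ.2, fun S hS => ?_⟩
  by_contra h
  exact hne ⟨S, h⟩ (by rw [hF]; exact hS)

/-- A positive `n × n` matrix with all row and column sums equal to `n`, whose rows and columns
are the only sets of entries with sum `n`. -/
theorem exists_generic_doubly_stochastic (n : ℕ) (hn : 0 < n) :
    ∃ w : Fin n × Fin n → ℝ, (∀ k, 0 < w k) ∧ (∀ i, ∑ j, w (i, j) = n) ∧
      (∀ j, ∑ i, w (i, j) = n) ∧
      ∀ S : Finset (Fin n × Fin n), ∑ k ∈ S, w k = n →
        (∃ i, ∀ k, k ∈ S ↔ k.1 = i) ∨ (∃ j, ∀ k, k ∈ S ↔ k.2 = j) := by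
  classical
  obtain ⟨δ, hrow, hcol, hδ⟩ := exists_generic_zero_sum_matrix n
  have hpos : ∀ᶠ t : ℝ in nhdsWithin 0 (Set.Ioi 0), ∀ k, 0 < 1 + t * δ k := by
    refine Filter.eventually_all.2 fun k => Filter.Eventually.filter_mono nhdsWithin_le_nhds ?_
    have : Continuous fun t : ℝ => 1 + t * δ k := by fun_prop
    exact (this.tendsto 0).eventually_const_lt (by simp)
  have hcard : ∀ᶠ t : ℝ in nhdsWithin 0 (Set.Ioi 0), ∀ S : Finset (Fin n × Fin n),
      S.card ≠ n → (S.card : ℝ) + t * ∑ k ∈ S, δ k ≠ n := by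
    refine Filter.eventually_all.2 fun S => Filter.Eventually.filter_mono nhdsWithin_le_nhds ?_
    by_cases hS : S.card = n
    · simp [hS]
    have : Continuous fun t : ℝ => (S.card : ℝ) + t * ∑ k ∈ S, δ k := by fun_prop
    filter_upwards [(this.tendsto 0).eventually_ne (b₂ := (n : ℝ)) (by simpa using hS)]
      with t ht _ using ht
  obtain ⟨t, ⟨hpos, hcard⟩, ht : 0 < t⟩ := ((hpos.and hcard).and self_mem_nhdsWithin).exists
  refine ⟨fun k => 1 + t * δ k, hpos, fun i => ?_, fun j => ?_, fun S hS => ?_⟩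
  · simp [Finset.sum_add_distrib, ← Finset.mul_sum, hrow]
  · simp [Finset.sum_add_distrib, ← Finset.mul_sum, hcol]
  have hS' : (S.card : ℝ) + t * ∑ k ∈ S, δ k = n := by
    simpa [Finset.sum_add_distrib, ← Finset.mul_sum] using hS
  have hSn : S.card = n := by
    by_contra h
    exact hcard S h hS'
  have hS0 : ∑ k ∈ S, δ k = 0 := by simpa [hSn, ht.ne'] using hS'
  obtain ⟨⟨a, b⟩, hab⟩ : S.Nonempty := Finset.card_pos.1 (by omega)
  rcases hδ S hS0 with h | h
  · left
    have hsub : Finset.univ.image (fun j => (a, j)) ⊆ S := by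
      intro k hk
      obtain ⟨j, -, rfl⟩ := Finset.mem_image.1 hk
      exact h a b j hab
    have heq := Finset.eq_of_subset_of_card_le hsub (by
      rw [Finset.card_image_of_injective _ (Prod.mk_right_injective a)]; simp [hSn])
    refine ⟨a, fun k => ?_⟩
    rw [← heq]
    simp [Prod.ext_iff, eq_comm]
  · right
    have hsub : Finset.univ.image (fun i => (i, b)) ⊆ S := by
      intro k hk
      obtain ⟨i, -, rfl⟩ := Finset.mem_image.1 hk
      exact h a i b hab
    have heq := Finset.eq_of_subset_of_card_le hsub (by
      rw [Finset.card_image_of_injective _ (Prod.mk_left_injective b)]; simp [hSn])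
    refine ⟨b, fun k => ?_⟩
    rw [← heq]
    simp [Prod.ext_iff, eq_comm]

/-- For at least four agents: two of them accept any row of a generic matrix but only one of its
columns, and all the others accept any column but only one row. -/
theorem exists_mms_failure_of_four_le (n : ℕ) (hn : 4 ≤ n) :
    ∃ c : Fin n → Fin n × Fin n → ℝ, (∀ i k, 0 ≤ c i k) ∧
      ∀ f : Fin n × Fin n → Fin n, ∃ i, ∃ g : Fin n × Fin n → Fin n,
        ∀ j, ∑ k with g k = j, c i k < ∑ k with f k = i, c i k := by
  classical
  obtain ⟨w, hpos, hrow, hcol, hw⟩ := exists_generic_doubly_stochastic n (by omega)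
  let z : Fin n := ⟨0, by omega⟩
  let u : Fin n → ℝ := fun b => if b = z then 1 - (n : ℝ) else 1
  have hu : ∑ b, u b = 0 := by
    have (b : Fin n) : u b = 1 - if b = z then (n : ℝ) else 0 := by
      by_cases h : b = z <;> simp [u, h]
    simp [this]
  let γ : Fin n → Fin n × Fin n → ℝ := fun i k => if (i : ℕ) < 2 then u k.2 else u k.1
  have γ_of_lt {i : Fin n} (hi : (i : ℕ) < 2) (k) : γ i k = u k.2 := if_pos hi
  have γ_of_not_lt {i : Fin n} (hi : ¬(i : ℕ) < 2) (k) : γ i k = u k.1 := if_neg hi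
  have hnonneg : ∀ᶠ s : ℝ in nhdsWithin 0 (Set.Ioi 0), ∀ i k, 0 < w k + s * γ i k := by
    refine Filter.eventually_all.2 fun i => Filter.eventually_all.2 fun k =>
      Filter.Eventually.filter_mono nhdsWithin_le_nhds ?_
    have : Continuous fun s : ℝ => w k + s * γ i k := by fun_prop
    exact (this.tendsto 0).eventually_const_lt (by simpa using hpos k)
  have hgap : ∀ᶠ s : ℝ in nhdsWithin 0 (Set.Ioi 0), ∀ i, ∀ S : Finset (Fin n × Fin n),
      (n : ℝ) < ∑ k ∈ S, w k → (n : ℝ) < ∑ k ∈ S, (w k + s * γ i k) := by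
    refine Filter.eventually_all.2 fun i => Filter.eventually_all.2 fun S =>
      Filter.Eventually.filter_mono nhdsWithin_le_nhds ?_
    by_cases hS : (n : ℝ) < ∑ k ∈ S, w k
    · have : Continuous fun s : ℝ => ∑ k ∈ S, (w k + s * γ i k) := by fun_prop
      filter_upwards [(this.tendsto 0).eventually_const_lt (u := (n : ℝ)) (by simpa using hS)]
        with s hs _ using hs
    · simp [hS]
  obtain ⟨s, ⟨hnonneg, hgap⟩, hs : 0 < s⟩ := ((hnonneg.and hgap).and self_mem_nhdsWithin).exists
  refine ⟨fun i k => w k + s * γ i k, fun i k => (hnonneg i k).le, fun f => ?_⟩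
  by_contra! hf
  have sum_row (x : Fin n × Fin n → ℝ) (a : Fin n) :
      ∑ k with k.1 = a, x k = ∑ b, x (a, b) := by
    rw [Finset.sum_filter, Fintype.sum_prod_type, Finset.sum_eq_single a] <;> simp +contextual
  have sum_col (x : Fin n × Fin n → ℝ) (b : Fin n) :
      ∑ k with k.2 = b, x k = ∑ a, x (a, b) := by
    rw [Finset.sum_filter, Fintype.sum_prod_type_right, Finset.sum_eq_single b] <;>
      simp +contextual
  have hshare (i : Fin n) : ∑ k with f k = i, (w k + s * γ i k) ≤ n := by
    by_cases hi : (i : ℕ) < 2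
    · obtain ⟨j, hj⟩ := hf i Prod.fst
      refine hj.trans_eq ?_
      rw [sum_row]
      simp [γ_of_lt hi, Finset.sum_add_distrib, hrow, ← Finset.mul_sum, hu]
    · obtain ⟨j, hj⟩ := hf i Prod.snd
      refine hj.trans_eq ?_
      rw [sum_col]
      simp [γ_of_not_lt hi, Finset.sum_add_distrib, hcol, ← Finset.mul_sum, hu]
  have hle (i : Fin n) : ∑ k with f k = i, w k ≤ n := by
    by_contra! h
    exact (hgap i _ h).not_ge (hshare i)
  have heq (i : Fin n) : ∑ k with f k = i, w k = n := by
    refine (Finset.sum_eq_sum_iff_of_le fun i _ => hle i).1 ?_ i (Finset.mem_univ i)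
    rw [Finset.sum_fiberwise, Fintype.sum_prod_type]
    simp [hrow]
  have hline (i : Fin n) : (∃ a, ∀ k, f k = i ↔ k.1 = a) ∨ (∃ b, ∀ k, f k = i ↔ k.2 = b) := by
    simpa using hw _ (heq i)
  have hn0 : (0 : ℝ) < n := by exact_mod_cast (by omega : 0 < n)
  have column_eq (i : Fin n) (hi : (i : ℕ) < 2) (b : Fin n) (h : ∀ k, f k = i ↔ k.2 = b) :
      f (z, z) = i := by
    rw [h]
    by_contra hb
    have := hshare i
    simp only [h] at this
    rw [sum_col] at this
    simp [γ_of_lt hi, Finset.sum_add_distrib, hcol, u, Ne.symm hb] at this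
    nlinarith
  have row_eq (i : Fin n) (hi : ¬ (i : ℕ) < 2) (a : Fin n) (h : ∀ k, f k = i ↔ k.1 = a) :
      f (z, z) = i := by
    rw [h]
    by_contra ha
    have := hshare i
    simp only [h] at this
    rw [sum_row] at this
    simp [γ_of_not_lt hi, Finset.sum_add_distrib, hrow, u, Ne.symm ha] at this
    nlinarith
  have hexrow : ∃ i : Fin n, (i : ℕ) < 2 ∧ ∃ a, ∀ k, f k = i ↔ k.1 = a := by
    rcases hline ⟨0, by omega⟩ with h | ⟨b, h⟩
    · exact ⟨_, by simp, h⟩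
    rcases hline ⟨1, by omega⟩ with h' | ⟨b', h'⟩
    · exact ⟨_, by simp, h'⟩
    have := (column_eq _ (by simp) b h).symm.trans (column_eq _ (by simp) b' h')
    simp at this
  have hexcol : ∃ i : Fin n, ¬ (i : ℕ) < 2 ∧ ∃ b, ∀ k, f k = i ↔ k.2 = b := by
    rcases hline ⟨2, by omega⟩ with ⟨a, h⟩ | h
    swap
    · exact ⟨_, by simp, h⟩
    rcases hline ⟨3, by omega⟩ with ⟨a', h'⟩ | h'
    swap
    · exact ⟨_, by simp, h'⟩
    have := (row_eq _ (by simp) a h).symm.trans (row_eq _ (by simp) a' h')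
    simp at this
  obtain ⟨i, hi, a, ha⟩ := hexrow
  obtain ⟨j, hj, b, hb⟩ := hexcol
  have hij : i = j := ((ha (a, b)).2 rfl).symm.trans ((hb (a, b)).2 rfl)
  exact hj (hij ▸ hi)

/-- Whether the items in the list, each given by its costs to three agents, can be distributed so
that the agents incur at most `x`, `y` and `z`. -/
def distributable : List (ℕ × ℕ × ℕ) → ℕ → ℕ → ℕ → Bool
  | [], _, _, _ => true
  | p :: l, x, y, z =>
    (decide (p.1 ≤ x) && distributable l (x - p.1) y z) ||
    ((decide (p.2.1 ≤ y) && distributable l x (y - p.2.1) z) ||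
     (decide (p.2.2 ≤ z) && distributable l x y (z - p.2.2)))

/-- A distribution within the given bounds is found by the search. -/
theorem distributable_ofFn {m : ℕ} (c : Fin m → ℕ × ℕ × ℕ) (f : Fin m → Fin 3) (x y z : ℕ)
    (hx : ∑ k with f k = 0, (c k).1 ≤ x) (hy : ∑ k with f k = 1, (c k).2.1 ≤ y)
    (hz : ∑ k with f k = 2, (c k).2.2 ≤ z) : distributable (List.ofFn c) x y z = true := by
  induction m generalizing x y z with
  | zero => simp [distributable]
  | succ m ih =>
    simp only [Finset.sum_filter, Fin.sum_univ_succ] at hx hy hz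
    have ih := ih (fun k => c k.succ) (fun k => f k.succ)
    simp only [Finset.sum_filter] at ih
    simp only [List.ofFn_succ, distributable, Bool.or_eq_true, Bool.and_eq_true,
      decide_eq_true_eq]
    have h3 : f 0 = 0 ∨ f 0 = 1 ∨ f 0 = 2 := by
      generalize f 0 = a
      fin_cases a <;> simp
    rcases h3 with h | h | h <;> simp [h] at hx hy hz
    · exact Or.inl ⟨by omega, ih _ _ _ (by omega) (by omega) (by omega)⟩
    · exact Or.inr (Or.inl ⟨by omega, ih _ _ _ (by omega) (by omega) (by omega)⟩)
    · exact Or.inr (Or.inr ⟨by omega, ih _ _ _ (by omega) (by omega) (by omega)⟩)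

/-- The instance of Feige, Sapir and Tauber: three agents, nine chores, minimax shares `43`. -/
theorem exists_mms_failure_three :
    ∃ c : Fin 3 → Fin 9 → ℝ, (∀ i k, 0 ≤ c i k) ∧
      ∀ f : Fin 9 → Fin 3, ∃ i, ∃ g : Fin 9 → Fin 3,
        ∀ j, ∑ k with g k = j, c i k < ∑ k with f k = i, c i k := by
  let c : Fin 3 → Fin 9 → ℕ :=
    ![![6, 15, 22, 26, 10, 7, 12, 19, 12], ![6, 15, 23, 26, 10, 8, 11, 18, 12],
      ![6, 16, 22, 27, 10, 7, 11, 18, 12]]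
  let g : Fin 3 → Fin 9 → Fin 3 :=
    ![![0, 0, 0, 1, 1, 1, 2, 2, 2], ![0, 1, 2, 0, 1, 2, 0, 1, 2], ![0, 1, 2, 1, 2, 0, 2, 0, 0]]
  have hg : ∀ i j, ∑ k with g i k = j, c i k ≤ 43 := by decide +kernel
  have hc : distributable (List.ofFn fun k => (c 0 k, c 1 k, c 2 k)) 43 43 43 = false := by
    decide +kernel
  refine ⟨fun i k => c i k, fun i k => Nat.cast_nonneg _, fun f => ?_⟩
  obtain ⟨i, hi⟩ : ∃ i, 43 < ∑ k with f k = i, c i k := by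
    by_contra! h
    exact Bool.false_ne_true (hc.symm.trans
      (distributable_ofFn (fun k => (c 0 k, c 1 k, c 2 k)) f 43 43 43 (h 0) (h 1) (h 2)))
  refine ⟨i, g i, fun j => ?_⟩
  beta_reduce
  exact_mod_cast (hg i j).trans_lt hi

/-- Failure of MMS for chores, with allocations given as maps from items to agents. -/
theorem exists_mms_failure (n : ℕ) (hn : 3 ≤ n) :
    ∃ (m : ℕ) (c : Fin n → Fin m → ℝ), (∀ i k, 0 ≤ c i k) ∧
      ∀ f : Fin m → Fin n, ∃ i, ∃ g : Fin m → Fin n,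
        ∀ j, ∑ k with g k = j, c i k < ∑ k with f k = i, c i k := by
  rcases hn.eq_or_lt with rfl | hn
  · exact ⟨9, exists_mms_failure_three⟩
  obtain ⟨c, hc, h⟩ := exists_mms_failure_of_four_le n hn
  let e : Fin (n * n) ≃ Fin n × Fin n := finProdFinEquiv.symm
  refine ⟨n * n, fun i k => c i (e k), fun i k => hc i _, fun f => ?_⟩
  obtain ⟨i, g, hg⟩ := h (f ∘ e.symm)
  refine ⟨i, g ∘ e, fun j => ?_⟩
  have := hg j
  simp only [Finset.sum_filter] at this ⊢
  rw [← e.sum_comp, ← e.sum_comp (fun k => if (f ∘ e.symm) k = i then c i k else 0)] at this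
  simpa using this

/-- For every `n ≥ 3`, there exist a finite set of indivisible chores and
additive cost functions with nonnegative item costs for `n` agents such that no complete
allocation is MMS for chores: in every allocation some agent `i` incurs strictly more than
its minimax share `MMS_i` (i.e., there is a partition whose every bundle costs `i` strictly
less than `A i`). -/
theorem mms_nonexistence_chores (n : ℕ) (hn : 3 ≤ n) :
    ∃ (m : ℕ) (c : Fin n → Fin m → ℝ),
      (∀ i k, 0 ≤ c i k) ∧
      ∀ A : Fin n → Finset (Fin m),
        (∀ i j, i ≠ j → Disjoint (A i) (A j)) →
        Finset.univ.biUnion A = Finset.univ →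
        ∃ i : Fin n, ∃ P : Fin n → Finset (Fin m),
          (∀ j l, j ≠ l → Disjoint (P j) (P l)) ∧
          Finset.univ.biUnion P = Finset.univ ∧
          Finset.univ.sup' (Finset.univ_nonempty_iff.mpr ⟨⟨0, by omega⟩⟩)
              (fun j => ∑ k ∈ P j, c i k) <
            (∑ k ∈ A i, c i k) := by
  classical
  obtain ⟨m, c, hc, h⟩ := exists_mms_failure n hn
  refine ⟨m, c, hc, fun A hA hcover => ?_⟩
  have hex (k : Fin m) : ∃ i, k ∈ A i := by
    have := Finset.mem_univ k
    rw [← hcover] at this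
    simpa using this
  choose f hf using hex
  have hAf (i : Fin n) : A i = Finset.univ.filter fun k => f k = i := by
    ext k
    simp only [Finset.mem_filter, Finset.mem_univ, true_and]
    refine ⟨fun hk => ?_, fun hk => hk ▸ hf k⟩
    by_contra hne
    exact Finset.disjoint_left.1 (hA _ _ hne) (hf k) hk
  obtain ⟨i, g, hg⟩ := h f
  refine ⟨i, fun j => Finset.univ.filter fun k => g k = j, fun j l hjl => ?_, ?_, ?_⟩
  · refine Finset.disjoint_left.2 fun k hk hk' => hjl ?_
    simp only [Finset.mem_filter, Finset.mem_univ, true_and] at hk hk'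
    exact hk.symm.trans hk'
  · ext k
    simp
  · rw [Finset.sup'_lt_iff, hAf]
    exact fun j _ => hg j
end
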